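/- Let d ≥ 3 and δ > 0. Suppose E ⊂ ℝ^d is a compact set with dim_H(E) > d − δ, and suppose there exist a Borel probability measure μ supported on E and a constant C > 0 such that |μ̂(ξ)| ≤ C |ξ|^{−1−δ/2} for all ξ ∈ ℝ^d, ξ ≠ 0. Then there exists a non-empty open interval I ⊂ (0,∞) such that for every t ∈ I, E contains four pairwise distinct points x, y, z, w with |x−y| = |y−z| = |z−w| = |w−x| = t (i.e., the vertices of a rhombus of side length t). -/

import Mathlib

open MeasureTheory Set
open scoped ENNReal RealInnerProductSpace

/-- The Fourier transform `μ̂(ξ) = ∫ e^{-2πi x·ξ} dμ(x)` of a measure on `ℝ^d`. -/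
noncomputable def fourierMeasure {d : ℕ} (μ : Measure (EuclideanSpace ℝ (Fin d)))
    (ξ : EuclideanSpace ℝ (Fin d)) : ℂ :=
  ∫ x, Complex.exp (-(2 * Real.pi * ⟪x, ξ⟫) * Complex.I) ∂μ

section Frostman

open Filter Metric Topology

theorem ediam_closedBall_le_ofReal {X : Type*} [MetricSpace X] (x : X) (r : ℝ) :
    ediam (closedBall x r) ≤ ENNReal.ofReal (2 * r) :=
  Metric.ediam_le_of_forall_dist_le fun y hy z hz => by
    linarith [dist_triangle_right y z x, mem_closedBall.1 hy, mem_closedBall.1 hz]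

/-- A space of positive `s`-dimensional Hausdorff measure has positive content. -/
theorem exists_pos_le_sum_rpow_of_hausdorffMeasure_ne_zero {X : Type*} [MetricSpace X]
    [MeasurableSpace X] [BorelSpace X] {s : ℝ} (hs : 0 < s)
    (h : Measure.hausdorffMeasure s (univ : Set X) ≠ 0) :
    ∃ c : ℝ, 0 < c ∧ ∀ F : Finset (X × ℝ), (∀ p ∈ F, 0 < p.2) →
      (∀ x, ∃ p ∈ F, x ∈ closedBall p.1 p.2) → c ≤ ∑ p ∈ F, p.2 ^ s := by
  by_contra! hc
  choose F hF0 hFc hFs using fun n : ℕ => hc (1 / ((n : ℝ) + 1)) Nat.one_div_pos_of_nat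
  have h0 : Tendsto (fun n : ℕ => 1 / ((n : ℝ) + 1)) atTop (𝓝 0) :=
    tendsto_one_div_add_atTop_nhds_zero_nat
  have hr : Tendsto (fun n : ℕ => ENNReal.ofReal (2 * (1 / ((n : ℝ) + 1)) ^ (1 / s))) atTop
      (𝓝 0) := by
    have h1 : Tendsto (fun n : ℕ => 2 * (1 / ((n : ℝ) + 1)) ^ (1 / s)) atTop (𝓝 (2 * 0)) := by
      refine Tendsto.const_mul _ ?_
      have := h0.rpow_const (p := 1 / s) (Or.inr (by positivity))
      rwa [Real.zero_rpow (by positivity)] at this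
    have := ENNReal.tendsto_ofReal h1
    simpa using this
  have key := Measure.hausdorffMeasure_le_liminf_sum (β := ℕ) (ι := fun n => ↥(F n)) s
    (univ : Set X) (l := atTop) _ hr (fun n p => closedBall p.1.1 p.1.2) ?_ ?_
  · apply h
    rw [← nonpos_iff_eq_zero]
    refine key.trans ?_
    have hb : ∀ n, ∑ i : ↥(F n), ediam (closedBall i.1.1 i.1.2) ^ s ≤
        ENNReal.ofReal (2 ^ s * (1 / ((n : ℝ) + 1))) := by
      intro n
      rw [Finset.sum_coe_sort (F n) (fun i => ediam (closedBall i.1 i.2) ^ s)]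
      calc ∑ i ∈ F n, ediam (closedBall i.1 i.2) ^ s
          ≤ ∑ i ∈ F n, ENNReal.ofReal (2 ^ s * i.2 ^ s) := by
            refine Finset.sum_le_sum fun i hi => ?_
            have hpos := hF0 n i hi
            rw [← Real.mul_rpow (by norm_num) hpos.le,
              ← ENNReal.ofReal_rpow_of_nonneg (by positivity) hs.le]
            gcongr
            exact ediam_closedBall_le_ofReal i.1 i.2
        _ = ENNReal.ofReal (2 ^ s * ∑ i ∈ F n, i.2 ^ s) := by
            rw [Finset.mul_sum, ENNReal.ofReal_sum_of_nonneg]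
            intro i hi
            have := hF0 n i hi
            positivity
        _ ≤ _ := by
            gcongr
            exact (hFs n).le
    have hl : Tendsto (fun n : ℕ => ENNReal.ofReal (2 ^ s * (1 / ((n : ℝ) + 1)))) atTop (𝓝 0) := by
      have := ENNReal.tendsto_ofReal (h0.const_mul (2 ^ s))
      simpa using this
    calc _ ≤ liminf (fun n : ℕ => ENNReal.ofReal (2 ^ s * (1 / ((n : ℝ) + 1)))) atTop :=
          liminf_le_liminf (Eventually.of_forall hb)
      _ = 0 := hl.liminf_eq
  · refine Eventually.of_forall fun n i => ?_
    have hpos := hF0 n i.1 i.2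
    have h1 : i.1.2 ≤ (1 / ((n : ℝ) + 1)) ^ (1 / s) := by
      have h2 : i.1.2 ^ s ≤ 1 / ((n : ℝ) + 1) :=
        (Finset.single_le_sum (f := fun p : X × ℝ => p.2 ^ s)
          (fun p hp => (Real.rpow_pos_of_pos (hF0 n p hp) s).le) i.2).trans (hFs n).le
      have := Real.rpow_le_rpow (by positivity) h2 (by positivity : 0 ≤ 1 / s)
      rwa [← Real.rpow_mul hpos.le, mul_one_div_cancel hs.ne', Real.rpow_one] at this
    refine (ediam_closedBall_le_ofReal i.1.1 i.1.2).trans ?_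
    gcongr
  · refine Eventually.of_forall fun n x _ => ?_
    obtain ⟨p, hp, hx⟩ := hFc n x
    exact mem_iUnion.2 ⟨⟨p, hp⟩, hx⟩

/-- Extremal weights on a finite set, subject to an upper bound on the mass of balls. -/
theorem exists_saturated_weights {X : Type*} [MetricSpace X] {s : ℝ} (P : Finset X)
    (R : ℝ) (hR : 0 < R) (hdiam : ∀ x y : ↥P, dist x y ≤ R) (n : ℕ) :
    ∃ w : ↥P → ℝ, (∀ p, 0 ≤ w p) ∧
      (∀ p : ↥P, ∀ j ∈ Finset.range (n + 1),
        ∑ q with dist q p ≤ R / 2 ^ j, w q ≤ (R / 2 ^ j) ^ s) ∧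
      ∀ q : ↥P, ∃ p : ↥P, ∃ j ∈ Finset.range (n + 1), dist q p ≤ R / 2 ^ j ∧
        ∑ q with dist q p ≤ R / 2 ^ j, w q = (R / 2 ^ j) ^ s := by
  classical
  set K : Set (↥P → ℝ) := {w | (∀ p, 0 ≤ w p) ∧ ∀ p : ↥P, ∀ j ∈ Finset.range (n + 1),
        ∑ q with dist q p ≤ R / 2 ^ j, w q ≤ (R / 2 ^ j) ^ s} with hK
  have hKclosed : IsClosed K := by
    have : K = (⋂ p, {w | 0 ≤ w p}) ∩ ⋂ p : ↥P, ⋂ j ∈ Finset.range (n + 1),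
        {w | ∑ q with dist q p ≤ R / 2 ^ j, w q ≤ (R / 2 ^ j) ^ s} := by
      ext w; simp [hK]
    rw [this]
    refine IsClosed.inter (isClosed_iInter fun p => ?_)
      (isClosed_iInter fun p => isClosed_iInter fun j => isClosed_iInter fun _ => ?_)
    · exact isClosed_le continuous_const (continuous_apply p)
    · exact isClosed_le (by fun_prop) continuous_const
  have hKsub : K ⊆ Icc 0 (fun _ => R ^ s) := by
    intro w hw
    refine ⟨hw.1, fun q => ?_⟩
    have h1 := hw.2 q 0 (by simp)
    simp only [pow_zero, div_one] at h1
    exact (Finset.single_le_sum (f := w) (fun i _ => hw.1 i) (by simpa using hdiam q q)).trans h1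
  have hKc : IsCompact K := isCompact_Icc.of_isClosed_subset hKclosed hKsub
  have hKne : K.Nonempty := ⟨0, by simp, fun p j _ => by
    simp only [Pi.zero_apply, Finset.sum_const_zero]; positivity⟩
  obtain ⟨w, hwK, hmax⟩ := hKc.exists_isMaxOn hKne
    (f := fun w => ∑ q, w q) (by fun_prop)
  refine ⟨w, hwK.1, hwK.2, fun q => ?_⟩
  by_contra! hcon
  have hev : ∀ p : ↥P, ∀ j ∈ Finset.range (n + 1), ∀ᶠ ε in 𝓝[>] (0 : ℝ),
      ∑ r with dist r p ≤ R / 2 ^ j, (w + Pi.single q ε : ↥P → ℝ) r ≤ (R / 2 ^ j) ^ s := by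
    intro p j hj
    by_cases hd : dist q p ≤ R / 2 ^ j
    · have hlt := lt_of_le_of_ne (hwK.2 p j hj) (hcon p j hj hd)
      have hcont : ContinuousAt (fun ε : ℝ =>
          ∑ r with dist r p ≤ R / 2 ^ j, (w + Pi.single q ε : ↥P → ℝ) r) 0 := by
        have : Continuous (fun ε : ℝ =>
          ∑ r with dist r p ≤ R / 2 ^ j, (w + Pi.single q ε : ↥P → ℝ) r) := by
          refine continuous_finsetSum _ fun r _ => ?_
          by_cases hr : r = q
          · subst hr; simp; fun_prop
          · simp [Pi.single_eq_of_ne hr]; fun_prop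
        exact this.continuousAt
      have := hcont.eventually_lt (g := fun _ => (R / 2 ^ j) ^ s) continuousAt_const
        (by simpa using hlt)
      exact (this.filter_mono nhdsWithin_le_nhds).mono fun _ h => h.le
    · refine Eventually.of_forall fun ε => ?_
      refine le_trans (le_of_eq (Finset.sum_congr rfl fun r hr => ?_)) (hwK.2 p j hj)
      have : r ≠ q := by rintro rfl; exact hd (by simpa using hr)
      simp [Pi.single_eq_of_ne this]
  have hev' : ∀ᶠ ε in 𝓝[>] (0 : ℝ), ∀ p : ↥P, ∀ j ∈ Finset.range (n + 1),
      ∑ r with dist r p ≤ R / 2 ^ j, (w + Pi.single q ε : ↥P → ℝ) r ≤ (R / 2 ^ j) ^ s := by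
    rw [eventually_all]
    intro p
    rw [Filter.eventually_all_finset]
    exact hev p
  obtain ⟨ε, hε, hεpos⟩ := (hev'.and self_mem_nhdsWithin).exists
  have hmem : w + Pi.single q ε ∈ K := by
    refine ⟨fun p => ?_, hε⟩
    have hsg : (0 : ↥P → ℝ) ≤ Pi.single q ε := Pi.single_nonneg.2 (le_of_lt hεpos)
    exact add_nonneg (hwK.1 p) (hsg p)
  have := hmax hmem
  simp [Finset.sum_add_distrib] at this
  exact absurd hεpos (not_lt.2 this)


/-- At every scale there is a probability measure with `s`-dimensional ball growth above it. -/
theorem exists_probabilityMeasure_growth_above_scale {X : Type*} [MetricSpace X]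
    [CompactSpace X] [MeasurableSpace X] [BorelSpace X] {s : ℝ} (hs : 0 < s)
    {c : ℝ} (hc : 0 < c)
    (hcov : ∀ F : Finset (X × ℝ), (∀ p ∈ F, 0 < p.2) →
      (∀ x, ∃ p ∈ F, x ∈ closedBall p.1 p.2) → c ≤ ∑ p ∈ F, p.2 ^ s)
    {R : ℝ} (hR : 0 < R) (hdiam : ∀ x y : X, dist x y ≤ R) (n : ℕ) :
    ∃ ν : ProbabilityMeasure X, ∀ x r, R / 2 ^ n ≤ r →
      (ν : Measure X) (closedBall x r) ≤ ENNReal.ofReal (24 ^ s / c * r ^ s) := by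
  classical
  obtain ⟨P₀, -, hPfin, hPcov₀⟩ := finite_cover_balls_of_compact (isCompact_univ (X := X))
    (e := R / 2 ^ n) (by positivity)
  set P : Finset X := hPfin.toFinset
  have hPcov : ∀ x, ∃ q ∈ P, dist x q < R / 2 ^ n := fun x => by
    simpa [P] using hPcov₀ (mem_univ x)
  obtain ⟨w, hw0, hwle, hwsat⟩ := exists_saturated_weights (s := s) P R hR
    (fun x y => hdiam x y) n
  set W := ∑ q, w q with hW
  have hcW : c ≤ 6 ^ s * W := by
    set t : Set (↥P × ℕ) := {a | a.2 ∈ Finset.range (n + 1) ∧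
      ∑ q with dist q a.1 ≤ R / 2 ^ a.2, w q = (R / 2 ^ a.2) ^ s} with ht
    obtain ⟨u, hut, hudisj, hucov⟩ :=
      Vitali.exists_disjoint_subfamily_covering_enlargement_closedBall t
        (fun a => (a.1 : X)) (fun a => R / 2 ^ a.2) R
        (fun a _ => div_le_self hR.le (one_le_pow₀ (by norm_num))) 5 (by norm_num)
    have htfin : t.Finite := by
      refine Set.Finite.subset (Set.Finite.prod (Set.finite_univ (α := ↥P))
        (Finset.finite_toSet (Finset.range (n + 1)))) ?_
      intro a ha
      exact ⟨mem_univ _, ha.1⟩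
    have hufin := htfin.subset hut
    set U := hufin.toFinset with hU
    have h1 := hcov (U.image fun a => ((a.1 : X), 6 * (R / 2 ^ a.2))) ?_ ?_
    · calc c ≤ _ := h1
        _ ≤ ∑ a ∈ U, (6 * (R / 2 ^ a.2)) ^ s := by
          refine (Finset.sum_image ?_).le
          intro a ha b hb hab
          by_contra hne
          have hd := hudisj (hufin.mem_toFinset.1 ha) (hufin.mem_toFinset.1 hb) hne
          have hab1 : (a.1 : X) = b.1 := (Prod.ext_iff.1 hab).1
          refine Set.disjoint_left.1 hd (mem_closedBall_self (by positivity)) ?_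
          rw [hab1]
          exact mem_closedBall_self (by positivity)
        _ = 6 ^ s * ∑ a ∈ U, ∑ q with dist q a.1 ≤ R / 2 ^ a.2, w q := by
          rw [Finset.mul_sum]
          refine Finset.sum_congr rfl fun a ha => ?_
          rw [(hut (hufin.mem_toFinset.1 ha)).2, Real.mul_rpow (by norm_num) (by positivity)]
        _ = 6 ^ s * ∑ q ∈ U.biUnion (fun a => {q | dist q a.1 ≤ R / 2 ^ a.2}), w q := by
          rw [Finset.sum_biUnion]
          intro a ha b hb hab
          have := hudisj (hufin.mem_toFinset.1 ha) (hufin.mem_toFinset.1 hb) hab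
          rw [Function.onFun, Finset.disjoint_left]
          intro q hqa hqb
          exact Set.disjoint_left.1 this (Finset.mem_filter.1 hqa).2 (Finset.mem_filter.1 hqb).2
        _ ≤ 6 ^ s * W := by
          gcongr
          exact Finset.sum_le_sum_of_subset_of_nonneg (Finset.subset_univ _) fun q _ _ => hw0 q
    · intro p hp
      obtain ⟨a, -, rfl⟩ := Finset.mem_image.1 hp
      positivity
    · intro x
      obtain ⟨q, hqP, hxq⟩ := hPcov x
      obtain ⟨p, j, hj, hqp, hsat⟩ := hwsat ⟨q, hqP⟩
      obtain ⟨b, hbu, hb⟩ := hucov (p, j) ⟨hj, hsat⟩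
      refine ⟨_, Finset.mem_image_of_mem _ (hufin.mem_toFinset.2 hbu), ?_⟩
      have h2 : dist q b.1 ≤ 5 * (R / 2 ^ b.2) := hb hqp
      have h3 : R / 2 ^ n ≤ R / 2 ^ b.2 := by
        have := Finset.mem_range.1 (hut hbu).1
        gcongr
        · norm_num
        · omega
      rw [mem_closedBall]
      linarith [dist_triangle x q b.1]
  have hWpos : 0 < W := by
    by_contra hneg
    have : (6 : ℝ) ^ s * W ≤ 0 := mul_nonpos_of_nonneg_of_nonpos (by positivity) (not_lt.1 hneg)
    linarith
  set m : Measure X := ∑ q, ENNReal.ofReal (w q / W) • Measure.dirac (q : X) with hm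
  have hmapply : ∀ S : Set X, MeasurableSet S →
      m S = ENNReal.ofReal ((∑ q ∈ Finset.univ.filter (fun q : ↥P => (q : X) ∈ S), w q) / W) := by
    intro S hS
    rw [hm, Measure.finsetSum_apply, Finset.sum_div, ENNReal.ofReal_sum_of_nonneg,
      Finset.sum_filter]
    · refine Finset.sum_congr rfl fun q _ => ?_
      by_cases hq : (q : X) ∈ S <;> simp [hq, Measure.dirac_apply' _ hS]
    · intro q _
      exact div_nonneg (hw0 q) hWpos.le
  have hprob : IsProbabilityMeasure m := ⟨by
    rw [hmapply _ MeasurableSet.univ]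
    simp only [mem_univ, Finset.filter_true]
    rw [← hW, div_self hWpos.ne', ENNReal.ofReal_one]⟩
  refine ⟨⟨m, hprob⟩, fun x r hr => ?_⟩
  have hrpos : 0 < r := lt_of_lt_of_le (by positivity) hr
  change m (closedBall x r) ≤ _
  rw [hmapply _ isClosed_closedBall.measurableSet]
  apply ENNReal.ofReal_le_ofReal
  have hmain : ∑ q ∈ Finset.univ.filter (fun q : ↥P => (q : X) ∈ closedBall x r), w q ≤
      (4 * r) ^ s := by
    by_cases hne : ∃ p : ↥P, (p : X) ∈ closedBall x r
    swap
    · push Not at hne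
      rw [Finset.filter_false_of_mem (fun q _ => hne q)]
      simp only [Finset.sum_empty]
      positivity
    obtain ⟨p, hp⟩ := hne
    have hdist : ∀ q : ↥P, (q : X) ∈ closedBall x r → dist q p ≤ 2 * r := by
      intro q hq
      have : dist (q : X) p ≤ 2 * r := by
        linarith [dist_triangle_right (q : X) p x, mem_closedBall.1 hq, mem_closedBall.1 hp]
      exact this
    rcases le_or_gt R (2 * r) with hcase | hcase
    · have h0 := hwle p 0 (by simp)
      have h04 : R / 2 ^ 0 ≤ 4 * r := by
        rw [pow_zero, div_one]
        linarith
      refine (Finset.sum_le_sum_of_subset_of_nonneg ?_ fun q _ _ => hw0 q).trans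
        (h0.trans (Real.rpow_le_rpow (by positivity) h04 hs.le))
      intro q _
      refine Finset.mem_filter.2 ⟨Finset.mem_univ _, ?_⟩
      rw [pow_zero, div_one]
      exact hdiam q p
    · obtain ⟨j, hj1, hj2⟩ := exists_nat_pow_near (x := R / (2 * r)) (y := 2)
        ((one_le_div (by positivity)).2 hcase.le) (by norm_num)
      have hj1' : 2 * r ≤ R / 2 ^ j := by
        rw [le_div_iff₀ (by positivity)] at hj1 ⊢
        linarith
      have hj2' : R / 2 ^ j ≤ 4 * r := by
        rw [div_lt_iff₀ (by positivity), pow_succ] at hj2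
        rw [div_le_iff₀ (by positivity)]
        linarith
      have hjn : j ∈ Finset.range (n + 1) := by
        rw [Finset.mem_range]
        by_contra hjn
        have : R / 2 ^ j ≤ R / 2 ^ n := by
          gcongr
          · norm_num
          · omega
        linarith
      refine (Finset.sum_le_sum_of_subset_of_nonneg ?_ fun q _ _ => hw0 q).trans
        ((hwle p j hjn).trans (Real.rpow_le_rpow (by positivity) hj2' hs.le))
      intro q hq
      simp only [Finset.mem_filter, Finset.mem_univ, true_and] at hq ⊢
      exact (hdist q hq).trans hj1'
  rw [div_le_iff₀ hWpos]
  calc _ ≤ (4 * r) ^ s := hmain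
    _ = 4 ^ s * r ^ s * 1 := by rw [Real.mul_rpow (by norm_num) hrpos.le, mul_one]
    _ ≤ 4 ^ s * r ^ s * (6 ^ s * W / c) := by
      gcongr
      rwa [le_div_iff₀ hc, one_mul]
    _ = 24 ^ s / c * r ^ s * W := by
      rw [show (24 : ℝ) = 4 * 6 by norm_num, Real.mul_rpow (by norm_num) (by norm_num)]
      ring

/-- Frostman's lemma on a compact metric space. -/
theorem exists_growth_of_hausdorffMeasure_univ_ne_zero {X : Type*} [MetricSpace X]
    [CompactSpace X] [MeasurableSpace X] [BorelSpace X] {s : ℝ} (hs : 0 < s)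
    (h : Measure.hausdorffMeasure s (univ : Set X) ≠ 0) :
    ∃ ν : Measure X, IsProbabilityMeasure ν ∧ ∃ A : ℝ, 0 < A ∧
      ∀ x r, 0 < r → ν (closedBall x r) ≤ ENNReal.ofReal (A * r ^ s) := by
  obtain ⟨c, hc, hcov⟩ := exists_pos_le_sum_rpow_of_hausdorffMeasure_ne_zero hs h
  obtain ⟨R, hRd⟩ := isBounded_iff.1 (isCompact_univ (X := X)).isBounded
  set R' := max R 1 with hR'
  have hR'pos : 0 < R' := lt_of_lt_of_le one_pos (le_max_right _ _)
  choose ν hν using exists_probabilityMeasure_growth_above_scale hs hc hcov hR'pos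
    (fun x y => (hRd (mem_univ x) (mem_univ y)).trans (le_max_left _ _))
  obtain ⟨ν₀, -, hν₀⟩ := (isCompact_univ (X := ProbabilityMeasure X)).exists_mapClusterPt
    (f := atTop) (u := ν) (by simp)
  obtain ⟨U, hU, hlim⟩ := mapClusterPt_iff_ultrafilter.1 hν₀
  refine ⟨ν₀, inferInstance, 24 ^ s / c * 2 ^ s, by positivity, fun x r hr => ?_⟩
  have hev : ∀ᶠ n in (U : Filter ℕ),
      (ν n : Measure X) (ball x (2 * r)) ≤ ENNReal.ofReal (24 ^ s / c * (2 * r) ^ s) := by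
    apply hU
    have h1 : Tendsto (fun n : ℕ => R' / 2 ^ n) atTop (𝓝 0) := by
      have := (tendsto_pow_atTop_nhds_zero_of_lt_one (r := (1 / 2 : ℝ)) (by norm_num)
        (by norm_num)).const_mul R'
      simpa [div_eq_mul_inv] using this
    filter_upwards [h1.eventually_le_const (show 0 < 2 * r by positivity)] with n hn
    exact (measure_mono ball_subset_closedBall).trans (hν n x (2 * r) hn)
  calc (ν₀ : Measure X) (closedBall x r) ≤ (ν₀ : Measure X) (ball x (2 * r)) :=
        measure_mono (closedBall_subset_ball (by linarith))
    _ ≤ liminf (fun n => (ν n : Measure X) (ball x (2 * r))) (U : Filter ℕ) :=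
        ProbabilityMeasure.le_liminf_measure_open_of_tendsto hlim isOpen_ball
    _ ≤ liminf (fun _ => ENNReal.ofReal (24 ^ s / c * (2 * r) ^ s)) (U : Filter ℕ) :=
        liminf_le_liminf hev
    _ = ENNReal.ofReal (24 ^ s / c * 2 ^ s * r ^ s) := by
        rw [liminf_const, Real.mul_rpow (by norm_num) hr.le, mul_assoc]

/-- Frostman's lemma: a compact set of positive `s`-dimensional Hausdorff measure carries a
probability measure with `s`-dimensional ball growth. -/
theorem exists_growth_of_hausdorffMeasure_ne_zero {X : Type*} [MetricSpace X]
    [MeasurableSpace X] [BorelSpace X] {E : Set X} (hE : IsCompact E) {s : ℝ} (hs : 0 < s)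
    (h : Measure.hausdorffMeasure s E ≠ 0) :
    ∃ ν : Measure X, IsProbabilityMeasure ν ∧ ν Eᶜ = 0 ∧ ∃ A : ℝ, 0 < A ∧
      ∀ x r, 0 < r → ν (closedBall x r) ≤ ENNReal.ofReal (A * r ^ s) := by
  have : CompactSpace E := isCompact_iff_compactSpace.1 hE
  have h' : Measure.hausdorffMeasure s (univ : Set E) ≠ 0 := by
    rwa [← (isometry_subtype_coe (s := E)).hausdorffMeasure_image (Or.inl hs.le), image_univ,
      Subtype.range_coe]
  obtain ⟨ν, hν, A, hA, hball⟩ := exists_growth_of_hausdorffMeasure_univ_ne_zero hs h'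
  have hmeas : Measurable (Subtype.val : E → X) := measurable_subtype_coe
  refine ⟨ν.map Subtype.val, Measure.isProbabilityMeasure_map hmeas.aemeasurable, ?_,
    A * 2 ^ s, by positivity, fun x r hr => ?_⟩
  · rw [Measure.map_apply hmeas hE.isClosed.measurableSet.compl]
    simp
  · rw [Measure.map_apply hmeas isClosed_closedBall.measurableSet]
    by_cases hne : ∃ e : E, (e : X) ∈ closedBall x r
    · obtain ⟨e, he⟩ := hne
      have hsub : Subtype.val ⁻¹' closedBall x r ⊆ closedBall e (2 * r) := by
        intro y hy
        have : dist (y : X) e ≤ 2 * r := by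
          linarith [dist_triangle_right (y : X) e x, mem_closedBall.1 hy, mem_closedBall.1 he]
        exact this
      refine (measure_mono hsub).trans ((hball e (2 * r) (by positivity)).trans (le_of_eq ?_))
      rw [Real.mul_rpow (by norm_num) hr.le, mul_assoc]
    · have : Subtype.val ⁻¹' closedBall x r = (∅ : Set E) := by
        ext y
        simp only [mem_preimage, mem_empty_iff_false, iff_false]
        exact fun hy => hne ⟨y, hy⟩
      simp [this]

end Frostman

theorem summable_exp_neg_sq_mul_rpow (s : ℝ) :
    Summable fun l : ℕ => Real.exp (-Real.pi * (l : ℝ) ^ 2) * ((l : ℝ) + 1) ^ s := by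
  obtain ⟨N, hN⟩ := exists_nat_ge s
  have h1 : Summable fun l : ℕ => ((l + 1 : ℕ) : ℝ) ^ N * Real.exp (-Real.pi * ((l + 1 : ℕ) : ℝ)) :=
    (summable_nat_add_iff 1).2 (Real.summable_pow_mul_exp_neg_nat_mul N Real.pi_pos)
  refine Summable.of_nonneg_of_le (fun l => by positivity) (fun l => ?_)
    (h1.mul_left (Real.exp Real.pi))
  have h2 : ((l : ℝ) + 1) ^ s ≤ ((l : ℝ) + 1) ^ N := by
    rw [← Real.rpow_natCast]
    exact Real.rpow_le_rpow_of_exponent_le (by linarith [Nat.cast_nonneg (α := ℝ) l]) hN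
  have h3 : Real.exp (-Real.pi * (l : ℝ) ^ 2) ≤
      Real.exp Real.pi * Real.exp (-Real.pi * ((l + 1 : ℕ) : ℝ)) := by
    rw [← Real.exp_add]
    apply Real.exp_le_exp.2
    have : (l : ℝ) ≤ (l : ℝ) ^ 2 := by
      exact_mod_cast Nat.le_self_pow two_ne_zero l
    push_cast
    nlinarith [Real.pi_pos]
  calc _ ≤ (Real.exp Real.pi * Real.exp (-Real.pi * ((l + 1 : ℕ) : ℝ))) * ((l : ℝ) + 1) ^ N := by
        gcongr
    _ = _ := by push_cast; ring

/-- The constant in `integral_gaussian_le_of_growth`. -/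
noncomputable def gaussianGrowthConst (s : ℝ) : ℝ :=
  ∑' l : ℕ, Real.exp (-Real.pi * (l : ℝ) ^ 2) * ((l : ℝ) + 1) ^ s

theorem gaussianGrowthConst_pos (s : ℝ) : 0 < gaussianGrowthConst s :=
  (summable_exp_neg_sq_mul_rpow s).tsum_pos (fun l => by positivity) 0 (by positivity)

theorem lintegral_gaussian_le_of_growth {X : Type*} [MetricSpace X] [MeasurableSpace X]
    [BorelSpace X] {m : Measure X} {A s : ℝ} (hA : 0 ≤ A) {x : X}
    (hm : ∀ r, 0 < r → m (Metric.closedBall x r) ≤ ENNReal.ofReal (A * r ^ s)) {r : ℝ}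
    (hr : 0 < r) :
    ∫⁻ y, ENNReal.ofReal (Real.exp (-Real.pi * (dist x y) ^ 2 / r ^ 2)) ∂m ≤
      ENNReal.ofReal (A * gaussianGrowthConst s * r ^ s) := by
  have hpt : ∀ y, ENNReal.ofReal (Real.exp (-Real.pi * (dist x y) ^ 2 / r ^ 2)) ≤
      ∑' l : ℕ, (Metric.closedBall x (((l : ℝ) + 1) * r)).indicator
        (fun _ => ENNReal.ofReal (Real.exp (-Real.pi * (l : ℝ) ^ 2))) y := by
    intro y
    set l := ⌊dist x y / r⌋₊ with hl
    have h1 : (l : ℝ) ≤ dist x y / r := Nat.floor_le (by positivity)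
    have h2 : dist x y / r < l + 1 := Nat.lt_floor_add_one _
    refine le_trans ?_ (ENNReal.le_tsum l)
    rw [indicator_of_mem]
    · apply ENNReal.ofReal_le_ofReal
      apply Real.exp_le_exp.2
      have : (l : ℝ) ^ 2 ≤ (dist x y / r) ^ 2 := by gcongr
      rw [mul_div_assoc, ← div_pow]
      nlinarith [Real.pi_pos]
    · rw [Metric.mem_closedBall, dist_comm]
      exact ((div_lt_iff₀ hr).1 h2).le
  calc _ ≤ ∫⁻ y, ∑' l : ℕ, (Metric.closedBall x (((l : ℝ) + 1) * r)).indicator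
        (fun _ => ENNReal.ofReal (Real.exp (-Real.pi * (l : ℝ) ^ 2))) y ∂m := lintegral_mono hpt
    _ = ∑' l : ℕ, ENNReal.ofReal (Real.exp (-Real.pi * (l : ℝ) ^ 2)) *
          m (Metric.closedBall x (((l : ℝ) + 1) * r)) := by
        rw [lintegral_tsum]
        · congr with l
          rw [lintegral_indicator_const Metric.isClosed_closedBall.measurableSet]
        · intro l
          exact (measurable_const.indicator Metric.isClosed_closedBall.measurableSet).aemeasurable
    _ ≤ ∑' l : ℕ, ENNReal.ofReal
          (A * r ^ s * (Real.exp (-Real.pi * (l : ℝ) ^ 2) * ((l : ℝ) + 1) ^ s)) := by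
        refine ENNReal.tsum_le_tsum fun l => ?_
        have hl1 : (0 : ℝ) < (l : ℝ) + 1 := by positivity
        refine (mul_le_mul_right (hm _ (mul_pos hl1 hr)) _).trans ?_
        rw [← ENNReal.ofReal_mul (by positivity), Real.mul_rpow hl1.le hr.le]
        apply ENNReal.ofReal_le_ofReal
        apply le_of_eq
        ring
    _ = _ := by
        rw [← ENNReal.ofReal_tsum_of_nonneg (fun l => by positivity)
          ((summable_exp_neg_sq_mul_rpow s).mul_left _), tsum_mul_left, gaussianGrowthConst]
        congr 1
        ring

theorem integral_gaussian_le_of_growth {X : Type*} [MetricSpace X] [MeasurableSpace X]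
    [BorelSpace X] {m : Measure X} {A s : ℝ} (hA : 0 ≤ A) {x : X}
    (hm : ∀ r, 0 < r → m (Metric.closedBall x r) ≤ ENNReal.ofReal (A * r ^ s)) {r : ℝ}
    (hr : 0 < r) :
    ∫ y, Real.exp (-Real.pi * (dist x y) ^ 2 / r ^ 2) ∂m ≤ A * gaussianGrowthConst s * r ^ s := by
  have hpos : 0 ≤ A * gaussianGrowthConst s * r ^ s :=
    mul_nonneg (mul_nonneg hA (gaussianGrowthConst_pos s).le) (by positivity)
  rw [integral_eq_lintegral_of_nonneg_ae (Filter.Eventually.of_forall fun y => by positivity)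
    (by
      have : Measurable fun y : X => dist x y := by
        have : Continuous fun y : X => dist x y := by fun_prop
        exact this.measurable
      exact Measurable.aestronglyMeasurable (by fun_prop))]
  exact ENNReal.toReal_le_of_le_ofReal hpos (lintegral_gaussian_le_of_growth hA hm hr)

theorem cexp_gaussian_eq {V : Type*} [NormedAddCommGroup V] [InnerProductSpace ℝ V] (r : ℝ)
    (x ξ : V) :
    Complex.exp (-((Real.pi * r ^ 2 : ℝ) : ℂ) * ‖ξ‖ ^ 2 + (2 * Real.pi * Complex.I) * ⟪x, ξ⟫) =
      ((Real.exp (-Real.pi * r ^ 2 * ‖ξ‖ ^ 2) : ℝ) : ℂ) *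
        (((Real.cos (2 * Real.pi * ⟪x, ξ⟫) : ℝ) : ℂ) +
          ((Real.sin (2 * Real.pi * ⟪x, ξ⟫) : ℝ) : ℂ) * Complex.I) := by
  rw [Complex.exp_add]
  congr 1
  · push_cast
    congr 1
    ring
  · rw [Complex.ofReal_cos, Complex.ofReal_sin, ← Complex.exp_mul_I]
    congr 1
    push_cast
    ring

section

variable {V : Type*} [NormedAddCommGroup V] [InnerProductSpace ℝ V] [FiniteDimensional ℝ V]
  [MeasurableSpace V] [BorelSpace V]

theorem integrable_gaussian (V : Type*) [NormedAddCommGroup V] [InnerProductSpace ℝ V]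
    [FiniteDimensional ℝ V] [MeasurableSpace V] [BorelSpace V] {r : ℝ} (hr : 0 < r) :
    Integrable fun ξ : V => Real.exp (-Real.pi * r ^ 2 * ‖ξ‖ ^ 2) := by
  have h := (GaussianFourier.integrable_cexp_neg_mul_sq_norm_add (V := V)
    (b := ((Real.pi * r ^ 2 : ℝ) : ℂ)) (by rw [Complex.ofReal_re]; positivity) 0 0).re
  refine h.congr (Filter.Eventually.of_forall fun ξ => ?_)
  simp only [zero_mul, add_zero]
  have : (-((Real.pi * r ^ 2 : ℝ) : ℂ) * ‖ξ‖ ^ 2) =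
      ((-Real.pi * r ^ 2 * ‖ξ‖ ^ 2 : ℝ) : ℂ) := by push_cast; ring
  rw [this, ← Complex.ofReal_exp]
  exact Complex.ofReal_re _

theorem integral_gaussian_mul_cos {r : ℝ} (hr : 0 < r) (x : V) :
    ∫ ξ : V, Real.exp (-Real.pi * r ^ 2 * ‖ξ‖ ^ 2) * Real.cos (2 * Real.pi * ⟪x, ξ⟫) =
      (r ^ Module.finrank ℝ V)⁻¹ * Real.exp (-Real.pi * ‖x‖ ^ 2 / r ^ 2) := by
  have hb : 0 < ((Real.pi * r ^ 2 : ℝ) : ℂ).re := by rw [Complex.ofReal_re]; positivity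
  have h := GaussianFourier.integral_cexp_neg_mul_sq_norm_add hb (2 * Real.pi * Complex.I) x
  have hi := GaussianFourier.integrable_cexp_neg_mul_sq_norm_add hb (2 * Real.pi * Complex.I) x
  have h2 := congrArg Complex.re h
  rw [← Complex.reCLM_apply, ← ContinuousLinearMap.integral_comp_comm _ hi] at h2
  have hl : ∀ ξ : V, Complex.reCLM (Complex.exp (-((Real.pi * r ^ 2 : ℝ) : ℂ) * ‖ξ‖ ^ 2 +
      (2 * Real.pi * Complex.I) * ⟪x, ξ⟫)) =
      Real.exp (-Real.pi * r ^ 2 * ‖ξ‖ ^ 2) * Real.cos (2 * Real.pi * ⟪x, ξ⟫) := by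
    intro ξ
    rw [cexp_gaussian_eq, Complex.reCLM_apply, Complex.re_ofReal_mul]
    simp only [Complex.add_re, Complex.ofReal_re, Complex.re_ofReal_mul, Complex.I_re, mul_zero,
      add_zero]
  simp only [hl] at h2
  rw [h2]
  have e1 : ((Real.pi : ℂ) / ((Real.pi * r ^ 2 : ℝ) : ℂ)) ^ ((Module.finrank ℝ V : ℂ) / 2) =
      (((r ^ Module.finrank ℝ V)⁻¹ : ℝ) : ℂ) := by
    have h1 : ((Real.pi : ℂ) / ((Real.pi * r ^ 2 : ℝ) : ℂ)) = (((r ^ 2)⁻¹ : ℝ) : ℂ) := by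
      rw [← Complex.ofReal_div]
      congr 1
      field_simp
    have h2 : ((Module.finrank ℝ V : ℂ) / 2) = (((Module.finrank ℝ V : ℝ) / 2 : ℝ) : ℂ) := by
      push_cast; ring
    rw [h1, h2, ← Complex.ofReal_cpow (by positivity)]
    congr 1
    rw [Real.inv_rpow (by positivity), ← Real.rpow_natCast r 2, ← Real.rpow_mul hr.le,
      ← Real.rpow_natCast]
    congr 2
    push_cast
    ring
  have e2 : Complex.exp ((2 * Real.pi * Complex.I) ^ 2 * ‖x‖ ^ 2 /
      (4 * ((Real.pi * r ^ 2 : ℝ) : ℂ))) =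
      ((Real.exp (-Real.pi * ‖x‖ ^ 2 / r ^ 2) : ℝ) : ℂ) := by
    rw [Complex.ofReal_exp]
    congr 1
    have hpi : (Real.pi : ℂ) ≠ 0 := by exact_mod_cast Real.pi_ne_zero
    have hrc : (r : ℂ) ≠ 0 := by exact_mod_cast hr.ne'
    push_cast
    field_simp
    rw [Complex.I_sq]
    ring
  rw [e1, e2, ← Complex.ofReal_mul, Complex.ofReal_re]

end

section

variable {V : Type*} [NormedAddCommGroup V] [InnerProductSpace ℝ V] [FiniteDimensional ℝ V]
  [MeasurableSpace V] [BorelSpace V]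

/-- The real (cosine) Fourier transform of a function. -/
noncomputable def cosTransform (m : V → ℝ) (x : V) : ℝ :=
  ∫ ξ, m ξ * Real.cos (2 * Real.pi * ⟪x, ξ⟫)

theorem integrable_mul_cos {m : V → ℝ} (hm : Integrable m) (x : V) :
    Integrable fun ξ => m ξ * Real.cos (2 * Real.pi * ⟪x, ξ⟫) := by
  refine hm.mul_bdd (c := 1) (Continuous.aestronglyMeasurable (by fun_prop)) ?_
  exact Filter.Eventually.of_forall fun ξ => by
    rw [Real.norm_eq_abs]
    exact Real.abs_cos_le_one _

theorem integral_cosTransform_eq {m : V → ℝ} (hm : Integrable m) {ν : Measure V}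
    [IsFiniteMeasure ν] {g h : V → ℝ} (hg : Integrable g ν) (hh : Integrable h ν) :
    ∫ p, cosTransform m (p.1 - p.2) * (g p.1 * h p.2) ∂(ν.prod ν) =
      ∫ ξ, m ξ * ((∫ x, Real.cos (2 * Real.pi * ⟪x, ξ⟫) * g x ∂ν) *
          (∫ y, Real.cos (2 * Real.pi * ⟪y, ξ⟫) * h y ∂ν) +
        (∫ x, Real.sin (2 * Real.pi * ⟪x, ξ⟫) * g x ∂ν) *
          (∫ y, Real.sin (2 * Real.pi * ⟪y, ξ⟫) * h y ∂ν)) := by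
  have hF : Integrable (fun q : (V × V) × V =>
      (g q.1.1 * h q.1.2) * m q.2 * Real.cos (2 * Real.pi * ⟪q.1.1 - q.1.2, q.2⟫))
      ((ν.prod ν).prod volume) := by
    refine ((hg.mul_prod hh).mul_prod hm).mul_bdd (c := 1)
      (Continuous.aestronglyMeasurable (by fun_prop)) ?_
    exact Filter.Eventually.of_forall fun ξ => by
      rw [Real.norm_eq_abs]
      exact Real.abs_cos_le_one _
  calc _ = ∫ p : V × V, (∫ ξ, (g p.1 * h p.2) * m ξ *
        Real.cos (2 * Real.pi * ⟪p.1 - p.2, ξ⟫)) ∂(ν.prod ν) := by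
        congr with p
        rw [cosTransform, ← integral_mul_const]
        congr with ξ
        ring
    _ = ∫ ξ, ∫ p : V × V, (g p.1 * h p.2) * m ξ *
        Real.cos (2 * Real.pi * ⟪p.1 - p.2, ξ⟫) ∂(ν.prod ν) :=
        integral_integral_swap (f := fun (p : V × V) ξ => (g p.1 * h p.2) * m ξ *
        Real.cos (2 * Real.pi * ⟪p.1 - p.2, ξ⟫)) hF
    _ = _ := by
        congr with ξ
        have bdc : ∀ {f : V → ℝ}, Integrable f ν →
            Integrable (fun x => Real.cos (2 * Real.pi * ⟪x, ξ⟫) * f x) ν := fun hf =>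
          hf.bdd_mul (c := 1) (Continuous.aestronglyMeasurable (by fun_prop))
            (Filter.Eventually.of_forall fun x => by
              rw [Real.norm_eq_abs]
              exact Real.abs_cos_le_one _)
        have bds : ∀ {f : V → ℝ}, Integrable f ν →
            Integrable (fun x => Real.sin (2 * Real.pi * ⟪x, ξ⟫) * f x) ν := fun hf =>
          hf.bdd_mul (c := 1) (Continuous.aestronglyMeasurable (by fun_prop))
            (Filter.Eventually.of_forall fun x => by
              rw [Real.norm_eq_abs]
              exact Real.abs_sin_le_one _)
        rw [← integral_prod_mul, ← integral_prod_mul, ← integral_add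
          ((bdc hg).mul_prod (bdc hh)) ((bds hg).mul_prod (bds hh)), ← integral_const_mul]
        congr with p
        rw [inner_sub_left, mul_sub, Real.cos_sub]
        ring

theorem continuous_cosTransform {m : V → ℝ} (hm : Integrable m) : Continuous (cosTransform m) := by
  refine continuous_of_dominated (bound := fun ξ => |m ξ|)
    (fun x => (integrable_mul_cos hm x).aestronglyMeasurable) (fun x => ?_) hm.abs ?_
  · refine Filter.Eventually.of_forall fun ξ => ?_
    rw [Real.norm_eq_abs, abs_mul]
    exact mul_le_of_le_one_right (abs_nonneg _) (Real.abs_cos_le_one _)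
  · exact Filter.Eventually.of_forall fun ξ => by fun_prop

theorem abs_cosTransform_le {m : V → ℝ} (hm : Integrable m) (x : V) :
    |cosTransform m x| ≤ ∫ ξ, |m ξ| := by
  refine (abs_integral_le_integral_abs).trans
    (integral_mono (integrable_mul_cos hm x).abs hm.abs ?_)
  intro ξ
  simp only [abs_mul]
  exact mul_le_of_le_one_right (abs_nonneg _) (Real.abs_cos_le_one _)

theorem cosTransform_neg (m : V → ℝ) (x : V) : cosTransform m (-x) = cosTransform m x := by
  simp only [cosTransform, inner_neg_left, mul_neg, Real.cos_neg]

theorem integrable_cosTransform_sub_mul {m : V → ℝ} (hm : Integrable m) {ν : Measure V}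
    [IsFiniteMeasure ν] {f : V × V → ℝ} (hf : Integrable f (ν.prod ν)) :
    Integrable (fun p : V × V => cosTransform m (p.1 - p.2) * f p) (ν.prod ν) := by
  refine hf.bdd_mul (c := ∫ ξ, |m ξ|)
    ((continuous_cosTransform hm).comp (by fun_prop)).aestronglyMeasurable ?_
  exact Filter.Eventually.of_forall fun p => abs_cosTransform_le hm _

theorem integral_cosTransform_quadratic_le {m : V → ℝ} (hm : Integrable m) {ν : Measure V}
    [IsFiniteMeasure ν] {B : ℝ} (hB : ∀ x, ∫ y, |cosTransform m (x - y)| ∂ν ≤ B) {g : V → ℝ}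
    (hg : MemLp g 2 ν) :
    ∫ p, cosTransform m (p.1 - p.2) * (g p.1 * g p.2) ∂(ν.prod ν) ≤ B * ∫ x, g x ^ 2 ∂ν := by
  have hg1 : Integrable g ν := hg.integrable (by norm_num)
  have hg2 : Integrable (fun x => g x ^ 2) ν := hg.integrable_sq
  have i1 : Integrable (fun p : V × V => g p.1 ^ 2) (ν.prod ν) := hg2.comp_fst ν
  have i2 : Integrable (fun p : V × V => g p.2 ^ 2) (ν.prod ν) := hg2.comp_snd ν
  have j1 : Integrable (fun p : V × V => |cosTransform m (p.1 - p.2)| * g p.1 ^ 2) (ν.prod ν) := by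
    refine (integrable_cosTransform_sub_mul hm i1).abs.congr
      (Filter.Eventually.of_forall fun p => ?_)
    simp only [abs_mul, abs_pow, sq_abs]
  have j2 : Integrable (fun p : V × V => |cosTransform m (p.1 - p.2)| * g p.2 ^ 2) (ν.prod ν) := by
    refine (integrable_cosTransform_sub_mul hm i2).abs.congr
      (Filter.Eventually.of_forall fun p => ?_)
    simp only [abs_mul, abs_pow, sq_abs]
  have k1 : ∫ p : V × V, |cosTransform m (p.1 - p.2)| * g p.1 ^ 2 ∂(ν.prod ν) ≤
      B * ∫ x, g x ^ 2 ∂ν := by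
    rw [integral_prod _ j1, ← integral_const_mul]
    refine integral_mono j1.integral_prod_left (hg2.const_mul B) fun x => ?_
    simp only [integral_mul_const]
    exact mul_le_mul_of_nonneg_right (hB x) (sq_nonneg _)
  have k2 : ∫ p : V × V, |cosTransform m (p.1 - p.2)| * g p.2 ^ 2 ∂(ν.prod ν) ≤
      B * ∫ x, g x ^ 2 ∂ν := by
    rw [integral_prod_symm _ j2, ← integral_const_mul]
    refine integral_mono j2.integral_prod_right (hg2.const_mul B) fun x => ?_
    simp only [integral_mul_const]
    refine mul_le_mul_of_nonneg_right ?_ (sq_nonneg _)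
    refine le_of_eq_of_le (integral_congr_ae (Filter.Eventually.of_forall fun y => ?_)) (hB x)
    simp only
    rw [← cosTransform_neg, neg_sub]
  calc _ ≤ ∫ p : V × V, ((1 / 2) * (|cosTransform m (p.1 - p.2)| * g p.1 ^ 2) +
        (1 / 2) * (|cosTransform m (p.1 - p.2)| * g p.2 ^ 2)) ∂(ν.prod ν) := by
        refine integral_mono (integrable_cosTransform_sub_mul hm (hg1.mul_prod hg1))
          ((j1.const_mul _).add (j2.const_mul _)) fun p => ?_
        refine (le_abs_self _).trans ?_
        simp only [abs_mul]
        have h1 := two_mul_le_add_sq |g p.1| |g p.2|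
        rw [sq_abs, sq_abs] at h1
        nlinarith [abs_nonneg (cosTransform m (p.1 - p.2))]
    _ ≤ _ := by
        rw [integral_add (j1.const_mul _) (j2.const_mul _), integral_const_mul, integral_const_mul]
        linarith

theorem abs_integral_cosTransform_bilinear_le {m M : V → ℝ} (hm : Integrable m)
    (hM : Integrable M) (hmM : ∀ ξ, |m ξ| ≤ M ξ) {ν : Measure V} [IsFiniteMeasure ν] {B : ℝ}
    (hB : ∀ x, ∫ y, |cosTransform M (x - y)| ∂ν ≤ B) {g h : V → ℝ} (hg : MemLp g 2 ν)
    (hh : MemLp h 2 ν) :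
    |∫ p, cosTransform m (p.1 - p.2) * (g p.1 * h p.2) ∂(ν.prod ν)| ≤
      B / 2 * (∫ x, g x ^ 2 ∂ν + ∫ x, h x ^ 2 ∂ν) := by
  have hg1 : Integrable g ν := hg.integrable (by norm_num)
  have hh1 : Integrable h ν := hh.integrable (by norm_num)
  have qg := integral_cosTransform_quadratic_le hM hB hg
  have qh := integral_cosTransform_quadratic_le hM hB hh
  rw [integral_cosTransform_eq hM hg1 hg1] at qg
  rw [integral_cosTransform_eq hM hh1 hh1] at qh
  rw [integral_cosTransform_eq hm hg1 hh1]
  have hcont : ∀ {f : V → ℝ}, Integrable f ν → ∀ {φ : ℝ → ℝ}, Continuous φ → (∀ t, |φ t| ≤ 1) →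
      Continuous (fun ξ : V => ∫ x, φ (2 * Real.pi * ⟪x, ξ⟫) * f x ∂ν) ∧
      ∀ ξ : V, |∫ x, φ (2 * Real.pi * ⟪x, ξ⟫) * f x ∂ν| ≤ ∫ x, |f x| ∂ν := by
    intro f hf φ hφ hφ1
    have hm1 : ∀ ξ : V, AEStronglyMeasurable (fun x => φ (2 * Real.pi * ⟪x, ξ⟫) * f x) ν := fun ξ =>
      (Continuous.aestronglyMeasurable (by fun_prop)).mul hf.aestronglyMeasurable
    have hb1 : ∀ ξ x : V, ‖φ (2 * Real.pi * ⟪x, ξ⟫) * f x‖ ≤ |f x| := fun ξ x => by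
      rw [Real.norm_eq_abs, abs_mul]
      exact mul_le_of_le_one_left (abs_nonneg _) (hφ1 _)
    refine ⟨continuous_of_dominated (bound := fun x => |f x|) hm1
      (fun ξ => Filter.Eventually.of_forall (hb1 ξ)) hf.abs
      (Filter.Eventually.of_forall fun x => by fun_prop), fun ξ => ?_⟩
    rw [← Real.norm_eq_abs]
    exact norm_integral_le_of_norm_le hf.abs (Filter.Eventually.of_forall (hb1 ξ))
  have hint : ∀ {f e : V → ℝ}, Integrable f ν → Integrable e ν → ∀ {w : V → ℝ}, Integrable w →
      Integrable fun ξ : V => w ξ * ((∫ x, Real.cos (2 * Real.pi * ⟪x, ξ⟫) * f x ∂ν) *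
          (∫ y, Real.cos (2 * Real.pi * ⟪y, ξ⟫) * e y ∂ν) +
        (∫ x, Real.sin (2 * Real.pi * ⟪x, ξ⟫) * f x ∂ν) *
          (∫ y, Real.sin (2 * Real.pi * ⟪y, ξ⟫) * e y ∂ν)) := by
    intro f e hf he w hw
    obtain ⟨c1, b1⟩ := hcont hf Real.continuous_cos Real.abs_cos_le_one
    obtain ⟨c2, b2⟩ := hcont he Real.continuous_cos Real.abs_cos_le_one
    obtain ⟨c3, b3⟩ := hcont hf Real.continuous_sin Real.abs_sin_le_one
    obtain ⟨c4, b4⟩ := hcont he Real.continuous_sin Real.abs_sin_le_one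
    refine hw.mul_bdd (c := (∫ x, |f x| ∂ν) * (∫ x, |e x| ∂ν) + (∫ x, |f x| ∂ν) * (∫ x, |e x| ∂ν))
      ((c1.mul c2).add (c3.mul c4)).aestronglyMeasurable
      (Filter.Eventually.of_forall fun ξ => ?_)
    rw [Real.norm_eq_abs]
    refine (abs_add_le _ _).trans ?_
    rw [abs_mul, abs_mul]
    have hf0 : 0 ≤ ∫ x, |f x| ∂ν := integral_nonneg fun x => abs_nonneg _
    exact add_le_add (mul_le_mul (b1 ξ) (b2 ξ) (abs_nonneg _) hf0)
      (mul_le_mul (b3 ξ) (b4 ξ) (abs_nonneg _) hf0)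
  have hsum := ((hint hg1 hg1 hM).const_mul (1 / 2)).add ((hint hh1 hh1 hM).const_mul (1 / 2))
  rw [← Real.norm_eq_abs]
  refine (norm_integral_le_of_norm_le hsum (Filter.Eventually.of_forall fun ξ => ?_)).trans ?_
  · simp only [Pi.add_apply, Real.norm_eq_abs, abs_mul]
    generalize (∫ x, Real.cos (2 * Real.pi * ⟪x, ξ⟫) * g x ∂ν) = a
    generalize (∫ x, Real.cos (2 * Real.pi * ⟪x, ξ⟫) * h x ∂ν) = b
    generalize (∫ x, Real.sin (2 * Real.pi * ⟪x, ξ⟫) * g x ∂ν) = c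
    generalize (∫ x, Real.sin (2 * Real.pi * ⟪x, ξ⟫) * h x ∂ν) = e
    have h1 : |a * b + c * e| ≤ (a * a + b * b + c * c + e * e) / 2 := by
      rw [abs_le]
      constructor <;> nlinarith [sq_nonneg (a + b), sq_nonneg (c + e), sq_nonneg (a - b),
        sq_nonneg (c - e)]
    have h2 : 0 ≤ M ξ := (abs_nonneg _).trans (hmM ξ)
    calc |m ξ| * |a * b + c * e| ≤ M ξ * ((a * a + b * b + c * c + e * e) / 2) :=
          mul_le_mul (hmM ξ) h1 (abs_nonneg _) h2
      _ = _ := by ring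
  · simp only [Pi.add_apply]
    rw [integral_add ((hint hg1 hg1 hM).const_mul _) ((hint hh1 hh1 hM).const_mul _),
      integral_const_mul, integral_const_mul]
    linarith

theorem integral_sq_cosTransform_conv_le {m M : V → ℝ} (hm : Integrable m)
    (hM : Integrable M) (hmM : ∀ ξ, |m ξ| ≤ M ξ) {ν : Measure V} [IsFiniteMeasure ν] {B : ℝ}
    (hB0 : 0 < B) (hB : ∀ x, ∫ y, |cosTransform M (x - y)| ∂ν ≤ B) {h : V → ℝ}
    (hh : MemLp h 2 ν) :
    ∫ y, (∫ x, cosTransform m (y - x) * h x ∂ν) ^ 2 ∂ν ≤ B ^ 2 * ∫ x, h x ^ 2 ∂ν := by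
  have hh1 : Integrable h ν := hh.integrable (by norm_num)
  set u : V → ℝ := fun y => ∫ x, cosTransform m (y - x) * h x ∂ν with hu
  have hb : ∀ y x, ‖cosTransform m (y - x) * h x‖ ≤ (∫ ξ, |m ξ|) * |h x| := fun y x => by
    rw [norm_mul]
    exact mul_le_mul_of_nonneg_right (abs_cosTransform_le hm _) (abs_nonneg _)
  have hc := continuous_cosTransform hm
  have hucont : Continuous u := by
    refine continuous_of_dominated (bound := fun x => (∫ ξ, |m ξ|) * |h x|) (fun y => ?_)
      (fun y => Filter.Eventually.of_forall (hb y)) (hh1.abs.const_mul _)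
      (Filter.Eventually.of_forall fun x => by fun_prop)
    exact (Continuous.aestronglyMeasurable (by fun_prop)).mul hh1.aestronglyMeasurable
  have hubd : ∀ y, ‖u y‖ ≤ (∫ ξ, |m ξ|) * ∫ x, |h x| ∂ν := fun y => by
    rw [← integral_const_mul]
    exact norm_integral_le_of_norm_le (hh1.abs.const_mul _) (Filter.Eventually.of_forall (hb y))
  have humem : MemLp u 2 ν := MemLp.of_bound hucont.aestronglyMeasurable _
    (Filter.Eventually.of_forall hubd)
  have hu1 : Integrable u ν := humem.integrable (by norm_num)
  have key := abs_integral_cosTransform_bilinear_le hm hM hmM hB humem (hh.const_mul B)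
  have e1 : ∫ p, cosTransform m (p.1 - p.2) * (u p.1 * (B * h p.2)) ∂(ν.prod ν) =
      B * ∫ y, u y ^ 2 ∂ν := by
    rw [integral_prod _ (integrable_cosTransform_sub_mul hm (hu1.mul_prod (hh1.const_mul B))),
      ← integral_const_mul]
    congr with y
    have : ∀ x, cosTransform m (y - x) * (u y * (B * h x)) =
        (B * u y) * (cosTransform m (y - x) * h x) := fun x => by ring
    simp only [this]
    rw [integral_const_mul]
    change B * u y * u y = _
    ring
  have e2 : ∫ x, (B * h x) ^ 2 ∂ν = B ^ 2 * ∫ x, h x ^ 2 ∂ν := by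
    rw [← integral_const_mul]
    congr with x
    ring
  rw [e1, e2] at key
  have key2 := (le_abs_self _).trans key
  have : B * (∫ y, u y ^ 2 ∂ν) ≤ B * (B ^ 2 * ∫ x, h x ^ 2 ∂ν) := by linarith
  exact le_of_mul_le_mul_left this hB0

end

section

open scoped Pointwise

variable (V : Type*) [NormedAddCommGroup V] [InnerProductSpace ℝ V] [FiniteDimensional ℝ V]
  [MeasurableSpace V] [BorelSpace V]

/-- Surface measure on the unit sphere of `V`, as a measure on `V`. -/
noncomputable def sphereMeasure : Measure V :=
  (Measure.toSphere (volume : Measure V)).map Subtype.val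

instance : IsFiniteMeasure (sphereMeasure V) := by
  unfold sphereMeasure
  infer_instance

variable {V}

theorem sphereMeasure_apply {S : Set V} (hS : MeasurableSet S) :
    sphereMeasure V S = Module.finrank ℝ V *
      volume (Ioo (0 : ℝ) 1 • (S ∩ Metric.sphere (0 : V) 1)) := by
  rw [sphereMeasure, Measure.map_apply measurable_subtype_coe hS,
    Measure.toSphere_apply' _ (measurable_subtype_coe hS), Subtype.image_preimage_coe, inter_comm]

theorem sphereMeasure_compl_sphere : sphereMeasure V (Metric.sphere (0 : V) 1)ᶜ = 0 := by
  rw [sphereMeasure_apply Metric.isClosed_sphere.measurableSet.compl, compl_inter_self]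
  simp

theorem measurePreserving_sphereMeasure (T : V ≃ₗᵢ[ℝ] V) :
    MeasurePreserving T (sphereMeasure V) (sphereMeasure V) := by
  refine ⟨T.continuous.measurable, ?_⟩
  ext S hS
  rw [Measure.map_apply T.continuous.measurable hS,
    sphereMeasure_apply (T.continuous.measurable hS), sphereMeasure_apply hS]
  congr 1
  have : Ioo (0 : ℝ) 1 • (T ⁻¹' S ∩ Metric.sphere (0 : V) 1) =
      T ⁻¹' (Ioo (0 : ℝ) 1 • (S ∩ Metric.sphere (0 : V) 1)) := by
    ext x
    simp only [mem_smul, mem_preimage, mem_inter_iff, mem_sphere_zero_iff_norm]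
    constructor
    · rintro ⟨a, ha, y, ⟨hy1, hy2⟩, rfl⟩
      exact ⟨a, ha, T y, ⟨hy1, by rw [T.norm_map, hy2]⟩, by simp⟩
    · rintro ⟨a, ha, y, ⟨hy1, hy2⟩, hx⟩
      refine ⟨a, ha, T.symm y, ⟨by simpa using hy1, by simpa using hy2⟩, ?_⟩
      apply T.injective
      rw [← hx]
      simp
  rw [this, T.measurePreserving.measure_preimage_emb T.toHomeomorph.measurableEmbedding]

theorem exists_sphereMeasure_growth [Nontrivial V] : ∃ C : ℝ, 0 < C ∧ ∀ (x : V) (r : ℝ), 0 < r →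
    sphereMeasure V (Metric.closedBall x r) ≤
      ENNReal.ofReal (C * r ^ ((Module.finrank ℝ V : ℝ) - 1)) := by
  set d := Module.finrank ℝ V with hd
  have hd0 : 0 < d := Module.finrank_pos
  have hd1 : (1 : ℝ) ≤ d := by exact_mod_cast hd0
  set κ : ℝ := volume.real (Metric.ball (0 : V) 1) with hκ
  have hκ0 : 0 < κ := by
    rw [hκ, measureReal_def]
    exact ENNReal.toReal_pos (Metric.measure_ball_pos volume _ one_pos).ne' measure_ball_lt_top.ne
  have hκe : volume (Metric.ball (0 : V) 1) = ENNReal.ofReal κ :=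
    (ofReal_measureReal measure_ball_lt_top.ne).symm
  refine ⟨2 * d * 3 ^ d * κ, by positivity, fun x r hr => ?_⟩
  rcases le_or_gt r 1 with hr1 | hr1
  · by_cases hne : ((Metric.closedBall x r) ∩ Metric.sphere (0 : V) 1).Nonempty
    swap
    · rw [sphereMeasure_apply Metric.isClosed_closedBall.measurableSet,
        not_nonempty_iff_eq_empty.1 hne]
      simp
    obtain ⟨ω₀, hω₀, -⟩ := hne
    rw [sphereMeasure_apply Metric.isClosed_closedBall.measurableSet]
    have hsub : Ioo (0 : ℝ) 1 • (Metric.closedBall x r ∩ Metric.sphere (0 : V) 1) ⊆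
        ⋃ j ∈ Finset.range (⌊1 / r⌋₊ + 1), Metric.closedBall (((j : ℝ) * r) • ω₀) (3 * r) := by
      intro y hy
      obtain ⟨s, hs, ω, ⟨hω, hω1⟩, rfl⟩ := mem_smul.1 hy
      have hs0 : 0 < s := hs.1
      have hω1 : ‖ω‖ = 1 := mem_sphere_zero_iff_norm.1 hω1
      have hdist : dist ω ω₀ ≤ 2 * r := by
        linarith [dist_triangle_right ω ω₀ x, Metric.mem_closedBall.1 hω,
          Metric.mem_closedBall.1 hω₀]
      simp only [mem_iUnion]
      refine ⟨⌊s / r⌋₊, ?_, ?_⟩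
      · rw [Finset.mem_range]
        have : ⌊s / r⌋₊ ≤ ⌊1 / r⌋₊ := Nat.floor_mono (by gcongr; exact hs.2.le)
        omega
      · have h1 : (⌊s / r⌋₊ : ℝ) * r ≤ s := by
          rw [← le_div_iff₀ hr]
          exact Nat.floor_le (by positivity)
        have h2 : s < ((⌊s / r⌋₊ : ℝ) + 1) * r := by
          rw [← div_lt_iff₀ hr]
          exact Nat.lt_floor_add_one _
        rw [Metric.mem_closedBall, dist_eq_norm]
        have h3 : s • ω - ((⌊s / r⌋₊ : ℝ) * r) • ω₀ =
            (s - (⌊s / r⌋₊ : ℝ) * r) • ω + ((⌊s / r⌋₊ : ℝ) * r) • (ω - ω₀) := by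
          rw [sub_smul, smul_sub]
          abel
        rw [h3]
        refine (norm_add_le _ _).trans ?_
        have h5 : 0 ≤ s - (⌊s / r⌋₊ : ℝ) * r := by linarith
        have h6 : 0 ≤ (⌊s / r⌋₊ : ℝ) * r := by positivity
        rw [norm_smul, norm_smul, hω1, ← dist_eq_norm ω ω₀, Real.norm_of_nonneg h5,
          Real.norm_of_nonneg h6]
        have h4 : (⌊s / r⌋₊ : ℝ) * r * dist ω ω₀ ≤ 1 * (2 * r) :=
          mul_le_mul (by linarith [hs.2]) hdist dist_nonneg (by norm_num)
        linarith
    have hcount : ((⌊1 / r⌋₊ + 1 : ℕ) : ℝ) ≤ 2 / r := by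
      have h1 : (⌊1 / r⌋₊ : ℝ) ≤ 1 / r := Nat.floor_le (by positivity)
      have h2 : 1 ≤ 1 / r := (one_le_div hr).2 hr1
      push_cast
      calc _ ≤ 1 / r + 1 / r := by linarith
        _ = 2 / r := by ring
    calc _ ≤ (d : ℝ≥0∞) * ∑ j ∈ Finset.range (⌊1 / r⌋₊ + 1),
          volume (Metric.closedBall (((j : ℝ) * r) • ω₀) (3 * r)) := by
          gcongr
          exact (measure_mono hsub).trans (measure_biUnion_finset_le _ _)
      _ = ENNReal.ofReal (d * (((⌊1 / r⌋₊ + 1 : ℕ) : ℝ) * ((3 * r) ^ d * κ))) := by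
          have : ∀ j : ℕ, volume (Metric.closedBall (((j : ℝ) * r) • ω₀) (3 * r)) =
              ENNReal.ofReal ((3 * r) ^ d * κ) := fun j => by
            rw [Measure.addHaar_closedBall _ _ (by positivity), hκe,
              ← ENNReal.ofReal_mul (by positivity)]
          simp only [this, Finset.sum_const, Finset.card_range, nsmul_eq_mul]
          rw [← ENNReal.ofReal_natCast d, ← ENNReal.ofReal_natCast (⌊1 / r⌋₊ + 1),
            ← ENNReal.ofReal_mul (by positivity), ← ENNReal.ofReal_mul (by positivity)]
      _ ≤ _ := by
          apply ENNReal.ofReal_le_ofReal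
          have h1 : r ^ ((d : ℝ) - 1) = r ^ d / r := by
            rw [Real.rpow_sub hr, Real.rpow_one, Real.rpow_natCast]
          rw [h1, mul_pow]
          calc _ ≤ (d : ℝ) * ((2 / r) * (3 ^ d * r ^ d * κ)) := by gcongr
            _ = _ := by field_simp
  · refine (measure_mono (subset_univ _)).trans ?_
    rw [sphereMeasure, Measure.map_apply measurable_subtype_coe MeasurableSet.univ, preimage_univ,
      Measure.toSphere_apply_univ, hκe, ← ENNReal.ofReal_natCast,
      ← ENNReal.ofReal_mul (by positivity)]
    apply ENNReal.ofReal_le_ofReal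
    have h1 : (1 : ℝ) ≤ r ^ ((d : ℝ) - 1) := Real.one_le_rpow hr1.le (by linarith)
    have h2 : (1 : ℝ) ≤ 3 ^ d := one_le_pow₀ (by norm_num)
    calc (d : ℝ) * κ = (1 * d * 1 * κ) * 1 := by ring
      _ ≤ _ := by gcongr; norm_num

theorem lintegral_eq_lintegral_sphereMeasure [Nontrivial V] {f : V → ℝ≥0∞} (hf : Measurable f) :
    ∫⁻ x, f x = ∫⁻ t in Ioi (0 : ℝ), ENNReal.ofReal (t ^ (Module.finrank ℝ V - 1)) *
      ∫⁻ ω, f (t • ω) ∂(sphereMeasure V) := by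
  have hmp := (volume : Measure V).measurePreserving_homeomorphUnitSphereProd
  have hg : Measurable fun p : Metric.sphere (0 : V) 1 × Ioi (0 : ℝ) => f ((p.2 : ℝ) • (p.1 : V)) :=
    hf.comp (by fun_prop)
  have h1 : ∫⁻ x, f x = ∫⁻ x : ({0}ᶜ : Set V), f x ∂((volume : Measure V).comap Subtype.val) := by
    rw [lintegral_subtype_comap (measurableSet_singleton _).compl, restrict_compl_singleton]
  have h2 := hmp.lintegral_comp_emb (homeomorphUnitSphereProd V).measurableEmbedding
    (fun p : Metric.sphere (0 : V) 1 × Ioi (0 : ℝ) => f ((p.2 : ℝ) • (p.1 : V)))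
  have h3 : ∀ x : ({0}ᶜ : Set V), (((homeomorphUnitSphereProd V x).2 : ℝ) •
      ((homeomorphUnitSphereProd V x).1 : V)) = x := by
    intro x
    have hx : ‖(x : V)‖ ≠ 0 := norm_ne_zero_iff.2 x.2
    simp [smul_smul, hx]
  simp only [h3] at h2
  rw [h1, h2, lintegral_prod_symm' _ hg]
  have hmeas : Measurable fun t : ℝ => ∫⁻ ω, f (t • ω) ∂(sphereMeasure V) :=
    Measurable.lintegral_prod_right' (f := fun p : ℝ × V => f (p.1 • p.2)) (hf.comp (by fun_prop))
  have h4 : ∀ t : Ioi (0 : ℝ), ∫⁻ ω : Metric.sphere (0 : V) 1, f ((t : ℝ) • (ω : V))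
      ∂(volume : Measure V).toSphere = ∫⁻ ω, f ((t : ℝ) • ω) ∂(sphereMeasure V) := by
    intro t
    exact (lintegral_map (f := fun ω : V => f ((t : ℝ) • ω)) (hf.comp (by fun_prop))
      measurable_subtype_coe).symm
  simp only [h4]
  refine (lintegral_withDensity_eq_lintegral_mul _ (by fun_prop)
    (hmeas.comp measurable_subtype_coe)).trans ?_
  exact lintegral_subtype_comap measurableSet_Ioi (fun t => ENNReal.ofReal
    (t ^ (Module.finrank ℝ V - 1)) * ∫⁻ ω, f (t • ω) ∂(sphereMeasure V))

end

theorem exists_linearIsometryEquiv_reflect_plane {V : Type*} [NormedAddCommGroup V]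
    [InnerProductSpace ℝ V] [FiniteDimensional ℝ V] {u e : V} (hu : ‖u‖ = 1) (he : ‖e‖ = 1)
    (hue : ⟪u, e⟫ = 0) (θ : ℝ) :
    ∃ R : V ≃ₗᵢ[ℝ] V, (∀ x y, ⟪R x, y⟫ = ⟪x, R y⟫) ∧
      R u = Real.cos θ • u + Real.sin θ • e ∧ R e = Real.sin θ • u - Real.cos θ • e := by
  obtain ⟨φ, rfl⟩ : ∃ φ, θ = 2 * φ := ⟨θ / 2, by ring⟩
  set v : V := Real.sin φ • u - Real.cos φ • e with hv
  have huu : ⟪u, u⟫ = 1 := by rw [real_inner_self_eq_norm_sq, hu]; norm_num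
  have hee : ⟪e, e⟫ = 1 := by rw [real_inner_self_eq_norm_sq, he]; norm_num
  have heu : ⟪e, u⟫ = 0 := by rw [real_inner_comm, hue]
  have hvu : ⟪v, u⟫ = Real.sin φ := by
    rw [hv, inner_sub_left, inner_smul_left, inner_smul_left, huu, heu]; simp
  have hve : ⟪v, e⟫ = -Real.cos φ := by
    rw [hv, inner_sub_left, inner_smul_left, inner_smul_left, hue, hee]; simp
  have hvv : ‖v‖ = 1 := by
    have : ‖v‖ ^ 2 = 1 := by
      rw [← real_inner_self_eq_norm_sq]
      nth_rewrite 2 [hv]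
      rw [inner_sub_right, inner_smul_right, inner_smul_right, hvu, hve]
      nlinarith [Real.sin_sq_add_cos_sq φ]
    nlinarith [norm_nonneg v]
  have hR : ∀ x, (Submodule.span ℝ {v})ᗮ.reflection x = x - (2 * ⟪v, x⟫) • v := by
    intro x
    rw [Submodule.reflection_orthogonal_apply, Submodule.reflection_singleton_apply, hvv]
    simp [mul_smul, two_smul]
  refine ⟨(Submodule.span ℝ {v})ᗮ.reflection, fun x y => ?_, ?_, ?_⟩
  · rw [hR, hR, inner_sub_left, inner_sub_right, inner_smul_left, inner_smul_right,
      real_inner_comm x v]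
    simp only [conj_trivial]
    ring
  · rw [hR, hvu, hv, Real.cos_two_mul, Real.sin_two_mul, smul_sub, smul_smul, smul_smul,
      Real.cos_sq']
    module
  · rw [hR, hve, hv, Real.cos_two_mul, Real.sin_two_mul, smul_sub, smul_smul, smul_smul]
    module

section

variable {V : Type*} [NormedAddCommGroup V] [InnerProductSpace ℝ V] [FiniteDimensional ℝ V]
  [MeasurableSpace V] [BorelSpace V]

theorem ae_sphereMeasure_mem_sphere : ∀ᵐ ω ∂(sphereMeasure V), ω ∈ Metric.sphere (0 : V) 1 :=
  sphereMeasure_compl_sphere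

theorem integrable_sphereMeasure {f : V → ℝ} (hf : Continuous f) :
    Integrable f (sphereMeasure V) := by
  obtain ⟨C, hC⟩ := (isCompact_sphere (0 : V) 1).exists_bound_of_continuousOn hf.continuousOn
  refine Integrable.of_bound hf.aestronglyMeasurable C ?_
  filter_upwards [ae_sphereMeasure_mem_sphere] with ω hω using hC ω hω

theorem hasDerivAt_integral_sphereMeasure {F F' : ℝ → V → ℝ}
    (hF : Continuous (Function.uncurry F)) (hF' : Continuous (Function.uncurry F'))
    (h : ∀ r ω, HasDerivAt (F · ω) (F' r ω) r) (r : ℝ) :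
    HasDerivAt (fun r => ∫ ω, F r ω ∂(sphereMeasure V)) (∫ ω, F' r ω ∂(sphereMeasure V)) r := by
  obtain ⟨C, hC⟩ := ((isCompact_closedBall r 1).prod
    (isCompact_sphere (0 : V) 1)).exists_bound_of_continuousOn hF'.continuousOn
  refine (hasDerivAt_integral_of_dominated_loc_of_deriv_le (bound := fun _ => C)
    (Metric.closedBall_mem_nhds r one_pos) ?_ ?_ ?_ ?_ (integrable_const _) ?_).2
  · exact Filter.Eventually.of_forall fun r =>
      (hF.comp (by fun_prop : Continuous fun ω : V => (r, ω))).aestronglyMeasurable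
  · exact integrable_sphereMeasure (hF.comp (by fun_prop : Continuous fun ω : V => (r, ω)))
  · exact (hF'.comp (by fun_prop : Continuous fun ω : V => (r, ω))).aestronglyMeasurable
  · filter_upwards [ae_sphereMeasure_mem_sphere] with ω hω x hx using hC (x, ω) ⟨hx, hω⟩
  · exact Filter.Eventually.of_forall fun ω x _ => h x ω

theorem integral_sphereMeasure_inner_mul_sin {u e : V} (hu : ‖u‖ = 1) (he : ‖e‖ = 1)
    (hue : ⟪u, e⟫ = 0) (r : ℝ) :
    ∫ ω, ⟪ω, u⟫ * Real.sin (r * ⟪ω, u⟫) ∂(sphereMeasure V) =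
      r * ∫ ω, ⟪ω, e⟫ ^ 2 * Real.cos (r * ⟪ω, u⟫) ∂(sphereMeasure V) := by
  set F : ℝ → V → ℝ := fun θ ω => (Real.sin θ * ⟪ω, u⟫ - Real.cos θ * ⟪ω, e⟫) *
    Real.sin (r * (Real.cos θ * ⟪ω, u⟫ + Real.sin θ * ⟪ω, e⟫)) with hF
  set F' : ℝ → V → ℝ := fun θ ω => (Real.cos θ * ⟪ω, u⟫ + Real.sin θ * ⟪ω, e⟫) *
      Real.sin (r * (Real.cos θ * ⟪ω, u⟫ + Real.sin θ * ⟪ω, e⟫)) +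
    (Real.sin θ * ⟪ω, u⟫ - Real.cos θ * ⟪ω, e⟫) *
      (Real.cos (r * (Real.cos θ * ⟪ω, u⟫ + Real.sin θ * ⟪ω, e⟫)) *
        (r * (-Real.sin θ * ⟪ω, u⟫ + Real.cos θ * ⟪ω, e⟫))) with hF'
  have hder : ∀ θ ω, HasDerivAt (F · ω) (F' θ ω) θ := by
    intro θ ω
    have h1 : HasDerivAt (fun θ => Real.sin θ * ⟪ω, u⟫ - Real.cos θ * ⟪ω, e⟫)
        (Real.cos θ * ⟪ω, u⟫ + Real.sin θ * ⟪ω, e⟫) θ := by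
      have := ((Real.hasDerivAt_sin θ).mul_const ⟪ω, u⟫).sub
        ((Real.hasDerivAt_cos θ).mul_const ⟪ω, e⟫)
      convert! this using 1
      ring
    have h2 : HasDerivAt (fun θ => Real.cos θ * ⟪ω, u⟫ + Real.sin θ * ⟪ω, e⟫)
        (-Real.sin θ * ⟪ω, u⟫ + Real.cos θ * ⟪ω, e⟫) θ :=
      ((Real.hasDerivAt_cos θ).mul_const ⟪ω, u⟫).add ((Real.hasDerivAt_sin θ).mul_const ⟪ω, e⟫)
    exact h1.mul ((h2.const_mul r).sin)
  have hconst : ∀ θ, ∫ ω, F θ ω ∂(sphereMeasure V) = ∫ ω, ⟪ω, e⟫ * Real.sin (r * ⟪ω, u⟫)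
      ∂(sphereMeasure V) := by
    intro θ
    obtain ⟨R, hR, hRu, hRe⟩ := exists_linearIsometryEquiv_reflect_plane hu he hue θ
    rw [← (measurePreserving_sphereMeasure R).integral_comp R.toHomeomorph.measurableEmbedding
      (fun ω => ⟪ω, e⟫ * Real.sin (r * ⟪ω, u⟫))]
    congr with ω
    rw [hR, hR, hRu, hRe]
    simp only [hF, inner_add_right, inner_sub_right, inner_smul_right]
  have hd := hasDerivAt_integral_sphereMeasure (F := F) (F' := F') (by
    simp only [hF, Function.uncurry_def]; fun_prop) (by
    simp only [hF', Function.uncurry_def]; fun_prop) hder 0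
  simp only [hconst] at hd
  have h0 := hd.unique (hasDerivAt_const _ _)
  simp only [hF', Real.cos_zero, Real.sin_zero] at h0
  rw [← integral_const_mul, ← sub_eq_zero, ← integral_sub
    (integrable_sphereMeasure (by fun_prop))
    (integrable_sphereMeasure (by fun_prop)), ← h0]
  congr with ω
  ring_nf

/-- The spherical cosine transform satisfies Bessel's equation along rays. -/
theorem sphereMeasure_bessel {u : V} (hu : ‖u‖ = 1) (r : ℝ) :
    ((Module.finrank ℝ V : ℝ) - 1) * ∫ ω, ⟪ω, u⟫ * Real.sin (r * ⟪ω, u⟫) ∂(sphereMeasure V) =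
      r * (∫ ω, Real.cos (r * ⟪ω, u⟫) ∂(sphereMeasure V) -
        ∫ ω, ⟪ω, u⟫ ^ 2 * Real.cos (r * ⟪ω, u⟫) ∂(sphereMeasure V)) := by
  set K := (Submodule.span ℝ {u})ᗮ
  have hK : (Module.finrank ℝ K : ℝ) = (Module.finrank ℝ V : ℝ) - 1 := by
    have h1 := Submodule.finrank_add_finrank_orthogonal (Submodule.span ℝ {u})
    rw [finrank_span_singleton (by rintro rfl; simp at hu)] at h1
    rw [← h1]
    push_cast
    ring
  set b := stdOrthonormalBasis ℝ K
  have hb1 : ∀ i, ‖(b i : V)‖ = 1 := fun i => b.orthonormal.1 i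
  have hb2 : ∀ i, ⟪u, (b i : V)⟫ = 0 := fun i =>
    (Submodule.mem_orthogonal_singleton_iff_inner_right).1 (b i).2
  have hpars : ∀ ω : V, ∑ i, ⟪ω, (b i : V)⟫ ^ 2 = ‖ω‖ ^ 2 - ⟪ω, u⟫ ^ 2 := by
    intro ω
    have hp : ω - ⟪ω, u⟫ • u ∈ K := by
      rw [Submodule.mem_orthogonal_singleton_iff_inner_right, inner_sub_right, inner_smul_right,
        real_inner_self_eq_norm_sq, hu, real_inner_comm]
      ring
    have h1 : ∀ i, ⟪ω, (b i : V)⟫ = ⟪(⟨ω - ⟪ω, u⟫ • u, hp⟩ : K), b i⟫ := by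
      intro i
      rw [Submodule.coe_inner, inner_sub_left, inner_smul_left, hb2]
      simp
    have h2 := b.sum_sq_norm_inner_left (⟨ω - ⟪ω, u⟫ • u, hp⟩ : K)
    simp only [Real.norm_eq_abs, sq_abs] at h2
    simp only [h1, h2]
    rw [Submodule.coe_norm, norm_sub_sq_real, inner_smul_right, norm_smul, hu]
    simp only [Real.norm_eq_abs, mul_one, sq_abs]
    ring
  have hsum : ∑ i, (r * ∫ ω, ⟪ω, (b i : V)⟫ ^ 2 * Real.cos (r * ⟪ω, u⟫) ∂(sphereMeasure V)) =
      ((Module.finrank ℝ V : ℝ) - 1) * ∫ ω, ⟪ω, u⟫ * Real.sin (r * ⟪ω, u⟫) ∂(sphereMeasure V) := by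
    simp only [← integral_sphereMeasure_inner_mul_sin hu (hb1 _) (hb2 _) r]
    rw [Finset.sum_const, Finset.card_univ, Fintype.card_fin, nsmul_eq_mul, hK]
  rw [← hsum, ← Finset.mul_sum, ← integral_finsetSum _ (fun i _ =>
    integrable_sphereMeasure (by fun_prop)), ← integral_sub
    (integrable_sphereMeasure (by fun_prop)) (integrable_sphereMeasure (by fun_prop))]
  congr 1
  refine integral_congr_ae ?_
  filter_upwards [ae_sphereMeasure_mem_sphere] with ω hω
  rw [← Finset.sum_mul, hpars, mem_sphere_zero_iff_norm.1 hω]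
  ring

theorem sq_integral_cos_sphereMeasure_le {u : V} (hu : ‖u‖ = 1) {r : ℝ} (hr : 1 ≤ r) {n : ℕ}
    (hn : Module.finrank ℝ V = n + 1) :
    r ^ n * (∫ ω, Real.cos (r * ⟪ω, u⟫) ∂(sphereMeasure V)) ^ 2 ≤
      (((1 + n / 2) ^ 2 + 1) * (sphereMeasure V).real univ ^ 2) *
        Real.exp (|(n : ℝ) / 2 * (n / 2 - 1)|) := by
  set a : ℝ → ℝ := fun r => ∫ ω, Real.cos (r * ⟪ω, u⟫) ∂(sphereMeasure V) with ha
  set b : ℝ → ℝ := fun r => -∫ ω, ⟪ω, u⟫ * Real.sin (r * ⟪ω, u⟫) ∂(sphereMeasure V) with hb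
  set c : ℝ → ℝ := fun r => -∫ ω, ⟪ω, u⟫ ^ 2 * Real.cos (r * ⟪ω, u⟫) ∂(sphereMeasure V) with hc
  set S := (sphereMeasure V).real univ with hS
  set κ : ℝ := n / 2 * (n / 2 - 1) with hκ
  have hda : ∀ r, HasDerivAt a (b r) r := by
    intro r
    have := hasDerivAt_integral_sphereMeasure (V := V) (F := fun r ω => Real.cos (r * ⟪ω, u⟫))
      (F' := fun r ω => -(⟪ω, u⟫ * Real.sin (r * ⟪ω, u⟫))) (by
        simp only [Function.uncurry_def]; fun_prop) (by
        simp only [Function.uncurry_def]; fun_prop) (fun r ω => by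
        convert! ((hasDerivAt_id r).mul_const ⟪ω, u⟫).cos using 1
        simp only [id]
        ring) r
    rwa [integral_neg] at this
  have hdb : ∀ r, HasDerivAt b (c r) r := by
    intro r
    have := hasDerivAt_integral_sphereMeasure (V := V)
      (F := fun r ω => ⟪ω, u⟫ * Real.sin (r * ⟪ω, u⟫))
      (F' := fun r ω => ⟪ω, u⟫ ^ 2 * Real.cos (r * ⟪ω, u⟫)) (by
        simp only [Function.uncurry_def]; fun_prop) (by
        simp only [Function.uncurry_def]; fun_prop) (fun r ω => by
        convert! (((hasDerivAt_id r).mul_const ⟪ω, u⟫).sin).const_mul ⟪ω, u⟫ using 1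
        simp only [id]
        ring) r
    exact this.neg
  have hbes : ∀ r, c r * r = -(n * b r) - r * a r := by
    intro r
    have := sphereMeasure_bessel hu r
    rw [hn] at this
    push_cast at this
    simp only [ha, hb, hc]
    linarith
  set p : ℝ → ℝ := fun r => b r + n / 2 * (r⁻¹ * a r) with hp
  set e : ℝ → ℝ := fun r => r ^ n * (p r ^ 2 + a r ^ 2) with he
  have hdp : ∀ r, r ≠ 0 → HasDerivAt p (c r + n / 2 * (-(r ^ 2)⁻¹ * a r + r⁻¹ * b r)) r :=
    fun r hr => (hdb r).add (((hasDerivAt_inv hr).mul (hda r)).const_mul _)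
  have hde : ∀ r, r ≠ 0 → HasDerivAt e (r ^ n * (2 * κ / r ^ 2 * (p r * a r))) r := by
    intro r hr
    have h1 := (hasDerivAt_pow n r).mul (((hdp r hr).pow 2).add ((hda r).pow 2))
    refine h1.congr_deriv ?_
    have hcr : c r = (-(n * b r) - r * a r) / r := by rw [← hbes r]; field_simp
    have hpow : (n : ℝ) * r ^ (n - 1) = n * r ^ n / r := by
      rcases n with _ | n
      · simp
      · rw [Nat.add_sub_cancel, pow_succ]
        field_simp
    rw [hpow, hcr, hκ]
    simp only [hp, Pi.add_apply, Pi.pow_apply, Nat.add_one_sub_one, pow_one]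
    push_cast
    field_simp
    ring
  have hg : ∀ r, r ≠ 0 → HasDerivAt (fun r => e r * Real.exp (|κ| * r⁻¹))
      (r ^ n * (2 * κ / r ^ 2 * (p r * a r)) * Real.exp (|κ| * r⁻¹) +
        e r * (Real.exp (|κ| * r⁻¹) * (|κ| * -(r ^ 2)⁻¹))) r := fun r hr =>
    (hde r hr).mul (((hasDerivAt_inv hr).const_mul _).exp)
  have hanti : AntitoneOn (fun r => e r * Real.exp (|κ| * r⁻¹)) (Ici 1) := by
    refine antitoneOn_of_hasDerivWithinAt_nonpos (convex_Ici 1)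
      (fun r hr => (hg r (by have := mem_Ici.1 hr; positivity)).continuousAt.continuousWithinAt)
      (fun r hr => (hg r ?_).hasDerivWithinAt) (fun r hr => ?_)
    · rw [interior_Ici] at hr
      have := mem_Ioi.1 hr
      positivity
    · rw [interior_Ici] at hr
      have hr0 : 0 < r := by linarith [mem_Ioi.1 hr]
      have h1 : 2 * κ * (p r * a r) ≤ |κ| * (p r ^ 2 + a r ^ 2) := by
        have h2 : 2 * |p r * a r| ≤ p r ^ 2 + a r ^ 2 := by
          rw [abs_mul]
          have := two_mul_le_add_sq |p r| |a r|
          rw [sq_abs, sq_abs] at this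
          linarith
        have h3 : κ * (p r * a r) ≤ |κ| * |p r * a r| := by
          rw [← abs_mul]
          exact le_abs_self _
        nlinarith [abs_nonneg κ]
      have h4 : r ^ n * (2 * κ / r ^ 2 * (p r * a r)) * Real.exp (|κ| * r⁻¹) +
          e r * (Real.exp (|κ| * r⁻¹) * (|κ| * -(r ^ 2)⁻¹)) =
          r ^ n * Real.exp (|κ| * r⁻¹) * (r ^ 2)⁻¹ *
            (2 * κ * (p r * a r) - |κ| * (p r ^ 2 + a r ^ 2)) := by
        simp only [he]
        field_simp
        ring
      rw [h4]
      exact mul_nonpos_of_nonneg_of_nonpos (by positivity) (by linarith)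
  have h1 := hanti (mem_Ici.2 le_rfl) (mem_Ici.2 hr) hr
  simp only [inv_one, mul_one] at h1
  have hr0 : 0 < r := by linarith
  have habs : ∀ f : V → ℝ, (∀ ω ∈ Metric.sphere (0 : V) 1, |f ω| ≤ 1) →
      |∫ ω, f ω ∂(sphereMeasure V)| ≤ S := by
    intro f hf
    have := norm_integral_le_of_norm_le_const (μ := sphereMeasure V) (f := f) (C := 1)
      (ae_sphereMeasure_mem_sphere.mono hf)
    rwa [one_mul] at this
  have ha1 : |a 1| ≤ S := habs _ fun ω _ => Real.abs_cos_le_one _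
  have hb1 : |b 1| ≤ S := by
    rw [hb, abs_neg]
    refine habs _ fun ω hω => ?_
    rw [abs_mul]
    refine mul_le_one₀ ?_ (abs_nonneg _) (Real.abs_sin_le_one _)
    refine (abs_real_inner_le_norm _ _).trans ?_
    rw [hu, mem_sphere_zero_iff_norm.1 hω]
    norm_num
  have hS0 : 0 ≤ S := measureReal_nonneg
  have he1 : e 1 ≤ ((1 + n / 2) ^ 2 + 1) * S ^ 2 := by
    have hp1 : |p 1| ≤ (1 + n / 2) * S := by
      simp only [hp, inv_one, one_mul]
      refine (abs_add_le _ _).trans ?_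
      rw [abs_mul, abs_of_nonneg (by positivity : (0 : ℝ) ≤ n / 2)]
      nlinarith [mul_le_mul_of_nonneg_left ha1 (by positivity : (0 : ℝ) ≤ n / 2)]
    have h2 : p 1 ^ 2 ≤ ((1 + n / 2) * S) ^ 2 := sq_le_sq' (by linarith [neg_abs_le (p 1)])
      (by linarith [le_abs_self (p 1)])
    have h3 : a 1 ^ 2 ≤ S ^ 2 := sq_le_sq' (by linarith [neg_abs_le (a 1)])
      (by linarith [le_abs_self (a 1)])
    simp only [he, one_pow, one_mul]
    nlinarith
  calc r ^ n * a r ^ 2 ≤ e r := by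
        simp only [he]
        gcongr
        nlinarith [sq_nonneg (p r)]
    _ ≤ e r * Real.exp (|κ| * r⁻¹) := le_mul_of_one_le_right
        (by simp only [he]; positivity) (Real.one_le_exp (by positivity))
    _ ≤ e 1 * Real.exp |κ| := h1
    _ ≤ _ := by gcongr

/-- Decay of the Fourier transform of the surface measure of the unit sphere. -/
theorem exists_sphereMeasure_decay [Nontrivial V] : ∃ K : ℝ, 0 < K ∧ ∀ ξ : V, ξ ≠ 0 →
    |∫ ω, Real.cos (2 * Real.pi * ⟪ω, ξ⟫) ∂(sphereMeasure V)| ≤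
      K * ‖ξ‖ ^ (-(((Module.finrank ℝ V : ℝ) - 1) / 2)) := by
  obtain ⟨n, hn⟩ : ∃ n, Module.finrank ℝ V = n + 1 :=
    Nat.exists_eq_succ_of_ne_zero Module.finrank_pos.ne'
  set S := (sphereMeasure V).real univ with hS
  have hS0 : 0 ≤ S := measureReal_nonneg
  set K2 : ℝ := (((1 + n / 2) ^ 2 + 1) * S ^ 2) * Real.exp (|(n : ℝ) / 2 * (n / 2 - 1)|)
  have hK2 : 0 ≤ K2 := by positivity
  refine ⟨S + √K2 + 1, by positivity, fun ξ hξ => ?_⟩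
  have hξ0 : 0 < ‖ξ‖ := norm_pos_iff.2 hξ
  have hexp : -(((Module.finrank ℝ V : ℝ) - 1) / 2) = -((n : ℝ) / 2) := by
    rw [hn]; push_cast; ring
  rw [hexp]
  rcases le_or_gt 1 ‖ξ‖ with h1 | h1
  · set r : ℝ := 2 * Real.pi * ‖ξ‖ with hr
    have hrξ : ‖ξ‖ ≤ r := by rw [hr]; nlinarith [Real.pi_gt_three]
    have hu : ‖‖ξ‖⁻¹ • ξ‖ = 1 := by
      rw [norm_smul, norm_inv, norm_norm, inv_mul_cancel₀ hξ0.ne']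
    have hkey := sq_integral_cos_sphereMeasure_le hu (h1.trans hrξ) hn
    have hcos : ∀ ω : V, r * ⟪ω, ‖ξ‖⁻¹ • ξ⟫ = 2 * Real.pi * ⟪ω, ξ⟫ := by
      intro ω
      rw [inner_smul_right, hr]
      field_simp
    simp only [hcos] at hkey
    set a := ∫ ω, Real.cos (2 * Real.pi * ⟪ω, ξ⟫) ∂(sphereMeasure V)
    have h2 : ‖ξ‖ ^ n * a ^ 2 ≤ K2 := le_trans (by gcongr) hkey
    have h3 : ‖ξ‖ ^ ((n : ℝ) / 2) * |a| ≤ √K2 := by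
      apply Real.le_sqrt_of_sq_le
      rw [mul_pow, sq_abs, ← Real.rpow_natCast (‖ξ‖ ^ ((n : ℝ) / 2)) 2, ← Real.rpow_mul hξ0.le]
      convert h2 using 2
      rw [← Real.rpow_natCast]
      congr 1
      push_cast
      ring
    rw [Real.rpow_neg hξ0.le, ← div_eq_mul_inv, le_div_iff₀ (by positivity), mul_comm]
    linarith
  · have h2 : 1 ≤ ‖ξ‖ ^ (-((n : ℝ) / 2)) :=
      Real.one_le_rpow_of_pos_of_le_one_of_nonpos hξ0 h1.le (by
        have : (0 : ℝ) ≤ n / 2 := by positivity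
        linarith)
    have h3 : |∫ ω, Real.cos (2 * Real.pi * ⟪ω, ξ⟫) ∂(sphereMeasure V)| ≤ S := by
      have := norm_integral_le_of_norm_le_const (μ := sphereMeasure V)
        (f := fun ω => Real.cos (2 * Real.pi * ⟪ω, ξ⟫)) (C := 1)
        (Filter.Eventually.of_forall fun ω => Real.abs_cos_le_one _)
      rwa [one_mul] at this
    calc _ ≤ S := h3
      _ ≤ (S + √K2 + 1) * 1 := by linarith [Real.sqrt_nonneg K2]
      _ ≤ _ := by gcongr

end

section

variable {V : Type*} [NormedAddCommGroup V] [InnerProductSpace ℝ V] [FiniteDimensional ℝ V]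
  [MeasurableSpace V] [BorelSpace V]

/-- The Fourier transform of the surface measure of the unit sphere. -/
noncomputable def sphereTransform (ξ : V) : ℝ :=
  ∫ ω, Real.cos (2 * Real.pi * ⟪ω, ξ⟫) ∂(sphereMeasure V)

/-- The surface measure of the sphere of radius `t`, mollified by a Gaussian at scale `r`. -/
noncomputable def sphereKernel (r t : ℝ) (x : V) : ℝ :=
  ∫ ω, (r ^ Module.finrank ℝ V)⁻¹ * Real.exp (-Real.pi * ‖x - t • ω‖ ^ 2 / r ^ 2)
    ∂(sphereMeasure V)

/-- The Fourier transform of `sphereKernel`. -/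
noncomputable def sphereMultiplier (r t : ℝ) (ξ : V) : ℝ :=
  Real.exp (-Real.pi * r ^ 2 * ‖ξ‖ ^ 2) * sphereTransform (t • ξ)

theorem abs_sphereTransform_le (ξ : V) : |sphereTransform ξ| ≤ (sphereMeasure V).real univ := by
  have := norm_integral_le_of_norm_le_const (μ := sphereMeasure V)
    (f := fun ω => Real.cos (2 * Real.pi * ⟪ω, ξ⟫)) (C := 1)
    (Filter.Eventually.of_forall fun ω => Real.abs_cos_le_one _)
  rwa [one_mul] at this

theorem continuous_sphereTransform : Continuous (sphereTransform : V → ℝ) := by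
  refine continuous_of_dominated (bound := fun _ => 1) (fun ξ => ?_) (fun ξ => ?_)
    (integrable_const _) (Filter.Eventually.of_forall fun ω => by fun_prop)
  · exact Continuous.aestronglyMeasurable (by fun_prop)
  · exact Filter.Eventually.of_forall fun ω => Real.abs_cos_le_one _

theorem integrable_sphereMultiplier {r : ℝ} (hr : 0 < r) (t : ℝ) :
    Integrable (sphereMultiplier r t : V → ℝ) := by
  refine (integrable_gaussian V hr).mul_bdd (c := (sphereMeasure V).real univ)
    (continuous_sphereTransform.comp (by fun_prop)).aestronglyMeasurable ?_
  exact Filter.Eventually.of_forall fun ξ => abs_sphereTransform_le _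

theorem integral_sin_sphereMeasure (ξ : V) :
    ∫ ω, Real.sin (2 * Real.pi * ⟪ω, ξ⟫) ∂(sphereMeasure V) = 0 := by
  have h := (measurePreserving_sphereMeasure (LinearIsometryEquiv.neg ℝ (E := V))).integral_comp
    (LinearIsometryEquiv.neg ℝ (E := V)).toHomeomorph.measurableEmbedding
    (fun ω => Real.sin (2 * Real.pi * ⟪ω, ξ⟫))
  simp only [LinearIsometryEquiv.coe_neg, inner_neg_left, mul_neg, Real.sin_neg,
    integral_neg] at h
  linarith

theorem sphereKernel_eq_cosTransform {r : ℝ} (hr : 0 < r) (t : ℝ) (x : V) :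
    sphereKernel r t x = cosTransform (sphereMultiplier r t) x := by
  have hint : Integrable (fun q : V × V => Real.exp (-Real.pi * r ^ 2 * ‖q.2‖ ^ 2) *
      Real.cos (2 * Real.pi * ⟪x - t • q.1, q.2⟫)) ((sphereMeasure V).prod volume) := by
    refine ((integrable_gaussian V hr).comp_snd (sphereMeasure V)).mul_bdd (c := 1)
      (Continuous.aestronglyMeasurable (by fun_prop)) ?_
    exact Filter.Eventually.of_forall fun q => Real.abs_cos_le_one _
  rw [sphereKernel, cosTransform]
  have h0 : ∀ ω : V, (r ^ Module.finrank ℝ V)⁻¹ * Real.exp (-Real.pi * ‖x - t • ω‖ ^ 2 / r ^ 2) =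
      ∫ ξ : V, Real.exp (-Real.pi * r ^ 2 * ‖ξ‖ ^ 2) * Real.cos (2 * Real.pi * ⟪x - t • ω, ξ⟫) :=
    fun ω => (integral_gaussian_mul_cos hr _).symm
  rw [integral_congr_ae (Filter.Eventually.of_forall h0)]
  rw [integral_integral_swap (f := fun ω ξ => Real.exp (-Real.pi * r ^ 2 * ‖ξ‖ ^ 2) *
      Real.cos (2 * Real.pi * ⟪x - t • ω, ξ⟫)) hint]
  congr with ξ
  rw [integral_const_mul, sphereMultiplier, mul_assoc (Real.exp _)]
  congr 1
  have h1 : ∀ ω : V, Real.cos (2 * Real.pi * ⟪x - t • ω, ξ⟫) =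
      Real.cos (2 * Real.pi * ⟪ω, t • ξ⟫) * Real.cos (2 * Real.pi * ⟪x, ξ⟫) +
      Real.sin (2 * Real.pi * ⟪ω, t • ξ⟫) * Real.sin (2 * Real.pi * ⟪x, ξ⟫) := by
    intro ω
    rw [inner_sub_left, inner_smul_left, inner_smul_right, mul_sub, Real.cos_sub]
    simp only [conj_trivial]
    ring
  rw [integral_congr_ae (Filter.Eventually.of_forall h1)]
  rw [integral_add (integrable_sphereMeasure (by fun_prop))
    (integrable_sphereMeasure (by fun_prop)),
    integral_mul_const, integral_mul_const, integral_sin_sphereMeasure, sphereTransform]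
  ring

theorem sphereKernel_nonneg {r : ℝ} (hr : 0 < r) (t : ℝ) (x : V) : 0 ≤ sphereKernel r t x :=
  integral_nonneg fun ω => by positivity

theorem continuous_sphereKernel {r : ℝ} (hr : 0 < r) :
    Continuous fun q : ℝ × V => sphereKernel r q.1 q.2 := by
  refine continuous_of_dominated (bound := fun _ => (r ^ Module.finrank ℝ V)⁻¹) (fun q => ?_)
    (fun q => ?_) (integrable_const _) (Filter.Eventually.of_forall fun ω => by fun_prop)
  · exact Continuous.aestronglyMeasurable (by fun_prop)
  · refine Filter.Eventually.of_forall fun ω => ?_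
    rw [Real.norm_of_nonneg (by positivity)]
    refine mul_le_of_le_one_right (by positivity) (Real.exp_le_one_iff.2 ?_)
    rw [neg_mul, neg_div]
    exact neg_nonpos.2 (by positivity)

theorem sphereKernel_neg {r : ℝ} (hr : 0 < r) (t : ℝ) (x : V) :
    sphereKernel r t (-x) = sphereKernel r t x := by
  rw [sphereKernel_eq_cosTransform hr, sphereKernel_eq_cosTransform hr, cosTransform_neg]

theorem sphereKernel_le_exp {r t : ℝ} (hr : 0 < r) (ht : 0 ≤ t) (x : V) :
    sphereKernel r t x ≤ (sphereMeasure V).real univ * (r ^ Module.finrank ℝ V)⁻¹ *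
      Real.exp (-Real.pi * (‖x‖ - t) ^ 2 / r ^ 2) := by
  have h : ∀ᵐ ω ∂(sphereMeasure V), ‖(r ^ Module.finrank ℝ V)⁻¹ *
      Real.exp (-Real.pi * ‖x - t • ω‖ ^ 2 / r ^ 2)‖ ≤ (r ^ Module.finrank ℝ V)⁻¹ *
      Real.exp (-Real.pi * (‖x‖ - t) ^ 2 / r ^ 2) := by
    filter_upwards [ae_sphereMeasure_mem_sphere] with ω hω
    rw [Real.norm_of_nonneg (by positivity)]
    have h1 : |‖x‖ - t| ≤ ‖x - t • ω‖ := by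
      have := abs_norm_sub_norm_le x (t • ω)
      rwa [norm_smul, mem_sphere_zero_iff_norm.1 hω, mul_one, Real.norm_of_nonneg ht] at this
    have h2 : (‖x‖ - t) ^ 2 ≤ ‖x - t • ω‖ ^ 2 := by
      rw [← sq_abs]
      gcongr
    gcongr ?_ * Real.exp (?_ / _)
    nlinarith [Real.pi_pos]
  have := norm_integral_le_of_norm_le_const h
  refine (le_abs_self _).trans (this.trans (le_of_eq ?_))
  ring

theorem exists_sphereKernel_le [Nontrivial V] {a : ℝ} (ha : 0 < a) : ∃ C : ℝ, 0 < C ∧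
    ∀ r t : ℝ, 0 < r → a ≤ t → ∀ x : V, sphereKernel r t x ≤ C * r⁻¹ := by
  obtain ⟨n, hn⟩ : ∃ n, Module.finrank ℝ V = n + 1 :=
    Nat.exists_eq_succ_of_ne_zero Module.finrank_pos.ne'
  obtain ⟨C, hC, hgrow⟩ := exists_sphereMeasure_growth (V := V)
  have hg := gaussianGrowthConst_pos ((Module.finrank ℝ V : ℝ) - 1)
  refine ⟨C * gaussianGrowthConst ((Module.finrank ℝ V : ℝ) - 1) * (a ^ n)⁻¹, by positivity,
    fun r t hr ht x => ?_⟩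
  have ht0 : 0 < t := ha.trans_le ht
  have h1 := integral_gaussian_le_of_growth hC.le (hgrow (t⁻¹ • x)) (div_pos hr ht0)
  have h2 : ∀ ω : V, -Real.pi * dist (t⁻¹ • x) ω ^ 2 / (r / t) ^ 2 =
      -Real.pi * ‖x - t • ω‖ ^ 2 / r ^ 2 := by
    intro ω
    have : t⁻¹ • x - ω = t⁻¹ • (x - t • ω) := by
      rw [smul_sub, smul_smul, inv_mul_cancel₀ ht0.ne', one_smul]
    rw [dist_eq_norm, this, norm_smul, Real.norm_of_nonneg (by positivity)]
    field_simp
  simp only [h2] at h1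
  rw [sphereKernel, integral_const_mul]
  have h3 : (r / t) ^ ((Module.finrank ℝ V : ℝ) - 1) = r ^ n * (t ^ n)⁻¹ := by
    rw [hn]
    push_cast
    rw [add_sub_cancel_right, Real.rpow_natCast, div_pow, div_eq_mul_inv]
  calc _ ≤ (r ^ Module.finrank ℝ V)⁻¹ *
        (C * gaussianGrowthConst ((Module.finrank ℝ V : ℝ) - 1) *
          (r / t) ^ ((Module.finrank ℝ V : ℝ) - 1)) := by gcongr
    _ = C * gaussianGrowthConst ((Module.finrank ℝ V : ℝ) - 1) * (t ^ n)⁻¹ * r⁻¹ := by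
        rw [h3, hn, pow_succ]
        field_simp
    _ ≤ _ := by gcongr

end

theorem gaussian_diff_mul_le_sum {b P Q x y : ℝ} (hb : 0 ≤ b) (hx : 0 ≤ x) (hP : |y| ≤ P)
    (hQ0 : 0 ≤ Q) (hQ : 0 < x → |y| ≤ Q * x ^ (-b)) (n : ℕ) :
    |Real.exp (-Real.pi * ((1 / 2) ^ (n + 1)) ^ 2 * x ^ 2) * y -
      Real.exp (-Real.pi * ((1 / 2) ^ n) ^ 2 * x ^ 2) * y| ≤
    4 * Real.pi * Real.exp (4 * Real.pi) * (P + Q) * ∑ j ∈ Finset.range (n + 2),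
      ((2 : ℝ) ^ j) ^ (-b) * (4 ^ j / 4 ^ n) *
        Real.exp (-Real.pi * ((1 / 2) ^ j) ^ 2 * x ^ 2) := by
  have hP0 : 0 ≤ P := (abs_nonneg y).trans hP
  have hpi := Real.pi_pos
  have hpi3 := Real.pi_gt_three
  have hsq : ∀ j : ℕ, ((1 / 2 : ℝ) ^ j) ^ 2 = 1 / 4 ^ j := fun j => by
    rw [← pow_mul, mul_comm, pow_mul, ← one_div_pow]; norm_num
  simp only [hsq]
  set u : ℝ := Real.pi * (1 / 4 ^ n) * x ^ 2 with hu
  have hu0 : 0 ≤ u := by positivity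
  have e1 : -Real.pi * (1 / 4 ^ (n + 1)) * x ^ 2 = -(u / 4) := by
    rw [hu, pow_succ]; field_simp
  have e2 : -Real.pi * (1 / 4 ^ n) * x ^ 2 = -u := by rw [hu]; ring
  have hG0 : 0 ≤ Real.exp (-(u / 4)) - Real.exp (-u) :=
    sub_nonneg.2 (Real.exp_le_exp.2 (by linarith))
  have hGu : Real.exp (-(u / 4)) - Real.exp (-u) ≤ u := by
    have h1 : Real.exp (-(u / 4)) ≤ 1 := Real.exp_le_one_iff.2 (by linarith)
    have h2 := Real.add_one_le_exp (-u)
    linarith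
  have hGe : Real.exp (-(u / 4)) - Real.exp (-u) ≤ Real.exp (-(u / 4)) := by
    linarith [Real.exp_pos (-u)]
  have hlhs : |Real.exp (-Real.pi * (1 / 4 ^ (n + 1)) * x ^ 2) * y -
      Real.exp (-Real.pi * (1 / 4 ^ n) * x ^ 2) * y| =
      (Real.exp (-(u / 4)) - Real.exp (-u)) * |y| := by
    rw [e1, e2, ← sub_mul, abs_mul, abs_of_nonneg hG0]
  rw [hlhs]
  set f : ℕ → ℝ := fun j => ((2 : ℝ) ^ j) ^ (-b) * (4 ^ j / 4 ^ n) *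
        Real.exp (-Real.pi * (1 / 4 ^ j) * x ^ 2) with hf
  have hf0 : ∀ j, 0 ≤ f j := fun j => by positivity
  suffices ∃ j ∈ Finset.range (n + 2), (Real.exp (-(u / 4)) - Real.exp (-u)) * |y| ≤
      4 * Real.pi * Real.exp (4 * Real.pi) * (P + Q) * f j by
    obtain ⟨j, hj, hle⟩ := this
    refine hle.trans (mul_le_mul_of_nonneg_left ?_ (by positivity))
    exact Finset.single_le_sum (f := f) (fun i _ => hf0 i) hj
  have hE1 : (1 : ℝ) ≤ Real.exp (4 * Real.pi) := Real.one_le_exp (by positivity)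
  rcases le_or_gt x 1 with h1 | h1
  · refine ⟨0, by simp, ?_⟩
    have hx2 : x ^ 2 ≤ 1 := by nlinarith
    have h3 : 1 ≤ Real.exp (4 * Real.pi) * Real.exp (-Real.pi * (1 / 4 ^ 0) * x ^ 2) := by
      rw [← Real.exp_add]
      refine Real.one_le_exp ?_
      simp only [pow_zero]
      nlinarith
    have h4 : (Real.exp (-(u / 4)) - Real.exp (-u)) * |y| ≤ Real.pi * (1 / 4 ^ n) * P := by
      refine mul_le_mul (hGu.trans ?_) hP (abs_nonneg _) (by positivity)
      rw [hu]
      exact mul_le_of_le_one_right (by positivity) hx2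
    refine h4.trans ?_
    simp only [hf]
    simp only [pow_zero, Real.one_rpow, one_mul] at h3 ⊢
    have h5 : Real.pi * (1 / 4 ^ n) * P ≤ 4 * Real.pi * (1 / 4 ^ n) * (P + Q) := by
      have : 0 ≤ Real.pi * (1 / 4 ^ n : ℝ) := by positivity
      nlinarith [mul_nonneg this hP0, mul_nonneg this hQ0]
    refine h5.trans ((le_mul_of_one_le_right (by positivity) h3).trans (le_of_eq ?_))
    ring
  obtain ⟨j, hj1, hj2⟩ := exists_nat_pow_near h1.le (one_lt_two : (1 : ℝ) < 2)
  have hx0 : 0 < x := by linarith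
  have hyQ := hQ hx0
  have hmono : ∀ i : ℕ, (2 : ℝ) ^ i ≤ x → |y| ≤ Q * ((2 : ℝ) ^ i) ^ (-b) := fun i hi =>
    hyQ.trans (mul_le_mul_of_nonneg_left
      (Real.rpow_le_rpow_of_nonpos (by positivity) hi (by linarith)) hQ0)
  rcases le_or_gt j n with hjn | hjn
  · refine ⟨j, Finset.mem_range.2 (by omega), ?_⟩
    have hx2 : x ^ 2 ≤ 4 * 4 ^ j := by
      have : x ^ 2 ≤ ((2 : ℝ) ^ (j + 1)) ^ 2 := by gcongr
      refine this.trans (le_of_eq ?_)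
      rw [← pow_mul, mul_comm, pow_mul, pow_succ]; norm_num; ring
    have h3 : 1 ≤ Real.exp (4 * Real.pi) * Real.exp (-Real.pi * (1 / 4 ^ j) * x ^ 2) := by
      rw [← Real.exp_add]
      refine Real.one_le_exp ?_
      have : (1 / 4 ^ j) * x ^ 2 ≤ 4 := by
        rw [one_div_mul_eq_div, div_le_iff₀ (by positivity)]
        exact hx2
      nlinarith
    have h4 : (Real.exp (-(u / 4)) - Real.exp (-u)) * |y| ≤
        (Real.pi * (1 / 4 ^ n) * (4 * 4 ^ j)) * (Q * ((2 : ℝ) ^ j) ^ (-b)) := by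
      refine mul_le_mul (hGu.trans ?_) (hmono j hj1) (abs_nonneg _) (by positivity)
      rw [hu]
      gcongr
    have h5 : (Real.pi * (1 / 4 ^ n) * (4 * 4 ^ j)) * (Q * ((2 : ℝ) ^ j) ^ (-b)) ≤
        (Real.pi * (1 / 4 ^ n) * (4 * 4 ^ j)) * ((P + Q) * ((2 : ℝ) ^ j) ^ (-b)) := by
      gcongr
      linarith
    refine (h4.trans h5).trans ((le_mul_of_one_le_right (by positivity) h3).trans (le_of_eq ?_))
    simp only [hf]
    ring
  · refine ⟨n + 1, Finset.mem_range.2 (by omega), ?_⟩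
    have h6 : (2 : ℝ) ^ (n + 1) ≤ x := (pow_le_pow_right₀ one_le_two hjn).trans hj1
    have h4 : (Real.exp (-(u / 4)) - Real.exp (-u)) * |y| ≤
        Real.exp (-(u / 4)) * ((P + Q) * ((2 : ℝ) ^ (n + 1)) ^ (-b)) := by
      refine mul_le_mul hGe ((hmono _ h6).trans ?_) (abs_nonneg _) (by positivity)
      gcongr
      linarith
    have h7 : 1 ≤ 4 * Real.pi * Real.exp (4 * Real.pi) * 4 := by nlinarith
    refine h4.trans ((le_mul_of_one_le_right (by positivity) h7).trans (le_of_eq ?_))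
    simp only [hf]
    rw [e1, pow_succ (4 : ℝ) n]
    field_simp

section

variable {V : Type*} [NormedAddCommGroup V] [InnerProductSpace ℝ V] [FiniteDimensional ℝ V]
  [MeasurableSpace V] [BorelSpace V]

theorem exists_sphereMultiplier_diff_majorant [Nontrivial V] {ν : Measure V} [IsFiniteMeasure ν]
    {A s a : ℝ} (hA : 0 < A) (ha : 0 < a)
    (hν : ∀ (x : V) r, 0 < r → ν (Metric.closedBall x r) ≤ ENNReal.ofReal (A * r ^ s))
    (hs : ((Module.finrank ℝ V : ℝ) - 1) / 2 - (Module.finrank ℝ V - s) ≤ 1) :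
    ∃ B : ℝ, 0 < B ∧ ∀ n : ℕ, ∃ M : V → ℝ, Integrable M ∧
      (∀ t, a ≤ t → ∀ ξ : V, |sphereMultiplier ((1 / 2) ^ (n + 1)) t ξ -
        sphereMultiplier ((1 / 2) ^ n) t ξ| ≤ M ξ) ∧
      ∀ x, ∫ y, |cosTransform M (x - y)| ∂ν ≤
        B * ((2 : ℝ) ^ (-(((Module.finrank ℝ V : ℝ) - 1) / 2 - (Module.finrank ℝ V - s)))) ^ n := by
  obtain ⟨K, hK, hdec⟩ := exists_sphereMeasure_decay (V := V)
  set d : ℝ := (Module.finrank ℝ V : ℝ) with hd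
  set b : ℝ := (d - 1) / 2 with hb
  have hd1 : 1 ≤ d := by
    rw [hd]; exact_mod_cast (Module.finrank_pos : 0 < Module.finrank ℝ V)
  have hb0 : 0 ≤ b := by rw [hb]; linarith
  set S := (sphereMeasure V).real univ with hS
  have hS0 : 0 ≤ S := measureReal_nonneg
  set K' := 4 * Real.pi * Real.exp (4 * Real.pi) * (S + K * a ^ (-b)) with hK'
  have hK'0 : 0 < K' := by positivity
  set g := gaussianGrowthConst s with hg
  have hg0 : 0 < g := gaussianGrowthConst_pos s
  set q : ℝ := (2 : ℝ) ^ (2 - (b - (d - s))) with hq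
  have hq2 : 2 ≤ q := by
    calc (2 : ℝ) = (2 : ℝ) ^ (1 : ℝ) := (Real.rpow_one _).symm
      _ ≤ q := Real.rpow_le_rpow_of_exponent_le one_le_two (by linarith)
  refine ⟨K' * (A * g) * q ^ 2, by positivity, fun n => ?_⟩
  set w : ℕ → ℝ := fun j => ((2 : ℝ) ^ j) ^ (-b) * (4 ^ j / 4 ^ n) with hw
  have hw0 : ∀ j, 0 < w j := fun j => by positivity
  have hr0 : ∀ j : ℕ, (0 : ℝ) < (1 / 2) ^ j := fun j => by positivity
  set M : V → ℝ := fun ξ => K' * ∑ j ∈ Finset.range (n + 2),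
    w j * Real.exp (-Real.pi * ((1 / 2) ^ j) ^ 2 * ‖ξ‖ ^ 2) with hM
  have hMint : Integrable M := (integrable_finsetSum _ fun j _ =>
    (integrable_gaussian V (hr0 j)).const_mul _).const_mul _
  refine ⟨M, hMint, fun t ht ξ => ?_, fun x => ?_⟩
  · have ht0 : 0 < t := ha.trans_le ht
    refine gaussian_diff_mul_le_sum hb0 (norm_nonneg ξ) (abs_sphereTransform_le (t • ξ))
      (by positivity) (fun hξ => ?_) n
    have := hdec (t • ξ) (smul_ne_zero ht0.ne' (norm_pos_iff.1 hξ))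
    refine this.trans ?_
    rw [norm_smul, Real.norm_of_nonneg ht0.le, Real.mul_rpow ht0.le (norm_nonneg _), mul_assoc]
    exact mul_le_mul_of_nonneg_left (mul_le_mul_of_nonneg_right
      (Real.rpow_le_rpow_of_nonpos ha ht (by linarith)) (by positivity)) hK.le
  · have hc : ∀ z : V, cosTransform M z = K' * ∑ j ∈ Finset.range (n + 2), w j *
        ((((1 / 2 : ℝ) ^ j) ^ Module.finrank ℝ V)⁻¹ *
          Real.exp (-Real.pi * ‖z‖ ^ 2 / ((1 / 2) ^ j) ^ 2)) := by
      intro z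
      have : ∀ ξ : V, M ξ * Real.cos (2 * Real.pi * ⟪z, ξ⟫) = K' * ∑ j ∈ Finset.range (n + 2),
          w j * (Real.exp (-Real.pi * ((1 / 2) ^ j) ^ 2 * ‖ξ‖ ^ 2) *
            Real.cos (2 * Real.pi * ⟪z, ξ⟫)) := by
        intro ξ
        simp only [hM, mul_assoc, Finset.sum_mul]
      rw [cosTransform, integral_congr_ae (Filter.Eventually.of_forall this), integral_const_mul,
        integral_finsetSum _ fun j _ =>
          (integrable_mul_cos (integrable_gaussian V (hr0 j)) z).const_mul _]
      congr 1
      refine Finset.sum_congr rfl fun j _ => ?_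
      rw [integral_const_mul, integral_gaussian_mul_cos (hr0 j)]
    have hpos : ∀ z : V, 0 ≤ cosTransform M z := fun z => by
      rw [hc]
      exact mul_nonneg hK'0.le (Finset.sum_nonneg fun j _ => by positivity)
    simp only [abs_of_nonneg (hpos _)]
    simp only [hc]
    have hint : ∀ j : ℕ, Integrable (fun y =>
        Real.exp (-Real.pi * ‖x - y‖ ^ 2 / ((1 / 2) ^ j) ^ 2)) ν := by
      intro j
      refine Integrable.of_bound (C := 1) (Continuous.aestronglyMeasurable (by fun_prop))
        (Filter.Eventually.of_forall fun y => ?_)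
      rw [Real.norm_of_nonneg (by positivity), neg_mul, neg_div]
      exact Real.exp_le_one_iff.2 (neg_nonpos.2 (by positivity))
    rw [integral_const_mul, integral_finsetSum _ fun j _ => ((hint j).const_mul _).const_mul _]
    have hterm : ∀ j ∈ Finset.range (n + 2), ∫ y, w j *
        ((((1 / 2 : ℝ) ^ j) ^ Module.finrank ℝ V)⁻¹ *
          Real.exp (-Real.pi * ‖x - y‖ ^ 2 / ((1 / 2) ^ j) ^ 2)) ∂ν ≤
        (A * g) * ((4 ^ n)⁻¹ * q ^ j) := by
      intro j _
      rw [integral_const_mul, integral_const_mul]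
      have h1 := integral_gaussian_le_of_growth hA.le (hν x) (hr0 j)
      simp only [dist_eq_norm] at h1
      have h2 : w j * ((((1 / 2 : ℝ) ^ j) ^ Module.finrank ℝ V)⁻¹ * ((1 / 2) ^ j) ^ s) =
          (4 ^ n)⁻¹ * q ^ j := by
        have e1 : ((2 : ℝ) ^ j) ^ (-b) = (2 : ℝ) ^ ((j : ℝ) * (-b)) := by
          rw [Real.rpow_mul two_pos.le, Real.rpow_natCast]
        have e2 : (4 : ℝ) ^ j = (2 : ℝ) ^ ((j : ℝ) * 2) := by
          rw [mul_comm, Real.rpow_mul two_pos.le, Real.rpow_natCast]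
          norm_num
        have e3 : (((1 / 2 : ℝ) ^ j) ^ Module.finrank ℝ V)⁻¹ = (2 : ℝ) ^ ((j : ℝ) * d) := by
          rw [Real.rpow_mul two_pos.le, hd, Real.rpow_natCast, Real.rpow_natCast, one_div,
            inv_pow, inv_pow, inv_inv]
        have e4 : ((1 / 2 : ℝ) ^ j) ^ s = (2 : ℝ) ^ ((j : ℝ) * (-s)) := by
          rw [Real.rpow_mul two_pos.le, Real.rpow_natCast, one_div, inv_pow, Real.rpow_neg
            (by positivity), Real.inv_rpow (by positivity)]
        have e5 : q ^ j = (2 : ℝ) ^ ((j : ℝ) * (2 - (b - (d - s)))) := by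
          rw [hq, mul_comm, Real.rpow_mul two_pos.le, Real.rpow_natCast]
        simp only [hw]
        rw [e1, e2, e3, e4, e5, div_eq_inv_mul]
        rw [show (2 : ℝ) ^ ((j : ℝ) * -b) * ((4 ^ n)⁻¹ * (2 : ℝ) ^ ((j : ℝ) * 2)) *
          ((2 : ℝ) ^ ((j : ℝ) * d) * (2 : ℝ) ^ ((j : ℝ) * -s)) = (4 ^ n)⁻¹ *
          ((2 : ℝ) ^ ((j : ℝ) * -b) * (2 : ℝ) ^ ((j : ℝ) * 2) *
          ((2 : ℝ) ^ ((j : ℝ) * d) * (2 : ℝ) ^ ((j : ℝ) * -s))) by ring]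
        rw [← Real.rpow_add two_pos, ← Real.rpow_add two_pos, ← Real.rpow_add two_pos]
        congr 2
        ring
      rw [← h2]
      calc _ ≤ w j * ((((1 / 2 : ℝ) ^ j) ^ Module.finrank ℝ V)⁻¹ *
            (A * g * ((1 / 2) ^ j) ^ s)) := by
            have := hw0 j
            gcongr
        _ = _ := by ring
    have hgeom : ∀ m : ℕ, ∑ j ∈ Finset.range m, q ^ j ≤ q ^ m := by
      intro m
      induction m with
      | zero => simp
      | succ m ih =>
        rw [Finset.sum_range_succ, pow_succ]
        nlinarith [pow_pos (show 0 < q by linarith) m]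
    have hq4 : q = 4 * (2 : ℝ) ^ (-(b - (d - s))) := by
      rw [hq, sub_eq_add_neg, Real.rpow_add two_pos]
      norm_num
    calc _ ≤ K' * ∑ j ∈ Finset.range (n + 2), (A * g) * ((4 ^ n)⁻¹ * q ^ j) := by
          gcongr with j hj
          exact hterm j hj
      _ = K' * ((A * g) * ((4 ^ n)⁻¹ * ∑ j ∈ Finset.range (n + 2), q ^ j)) := by
          simp only [Finset.mul_sum]
      _ ≤ K' * ((A * g) * ((4 ^ n)⁻¹ * q ^ (n + 2))) := by
          gcongr
          exact hgeom _
      _ = K' * (A * g) * q ^ 2 * ((4 ^ n)⁻¹ * q ^ n) := by ring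
      _ = _ := by
          congr 1
          conv_lhs => rw [hq4, mul_pow, ← mul_assoc, inv_mul_cancel₀ (by positivity), one_mul]

end

theorem integrable_of_continuous_of_abs_le {X : Type*} [TopologicalSpace X] [MeasurableSpace X]
    [OpensMeasurableSpace X] {m : Measure X} [IsFiniteMeasure m] {f : X → ℝ} {c : ℝ}
    (hf : Measurable f) (hc : ∀ x, |f x| ≤ c) : Integrable f m :=
  Integrable.of_bound (C := c) hf.aestronglyMeasurable (Filter.Eventually.of_forall hc)

theorem sq_integral_le_integral_sq {X : Type*} [MeasurableSpace X] {m : Measure X}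
    [IsProbabilityMeasure m] {f : X → ℝ} (hf : Integrable f m)
    (hf2 : Integrable (fun x => f x ^ 2) m) : (∫ x, f x ∂m) ^ 2 ≤ ∫ x, f x ^ 2 ∂m := by
  set c := ∫ x, f x ∂m with hc
  have h0 : 0 ≤ ∫ x, (f x - c) ^ 2 ∂m := integral_nonneg fun x => sq_nonneg _
  have h1 : ∀ x, (f x - c) ^ 2 = f x ^ 2 - 2 * c * f x + c ^ 2 := fun x => by ring
  rw [integral_congr_ae (Filter.Eventually.of_forall h1),
    integral_add (f := fun x => f x ^ 2 - 2 * c * f x) (hf2.sub (hf.const_mul _))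
      (integrable_const _),
    integral_sub hf2 (hf.const_mul _), integral_const_mul, ← hc] at h0
  simp only [integral_const, probReal_univ, smul_eq_mul, one_mul] at h0
  nlinarith

theorem abs_sub_le_of_geometric {f : ℕ → ℝ} {B θ : ℝ} (hB : 0 ≤ B) (hθ0 : 0 ≤ θ) (hθ1 : θ < 1)
    (h : ∀ n, |f (n + 1) - f n| ≤ B * θ ^ n) {m n : ℕ} (hmn : m ≤ n) :
    |f n - f m| ≤ B * θ ^ m / (1 - θ) := by
  obtain ⟨i, rfl⟩ := Nat.exists_eq_add_of_le hmn
  have h1 : (0 : ℝ) < 1 - θ := by linarith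
  have key : |f (m + i) - f m| ≤ B * θ ^ m * (1 - θ ^ i) / (1 - θ) := by
    induction i with
    | zero => simp
    | succ i ih =>
      have h2 : f (m + (i + 1)) - f m = (f (m + i + 1) - f (m + i)) + (f (m + i) - f m) := by
        rw [← add_assoc]; ring
      rw [h2]
      refine (abs_add_le _ _).trans
        ((add_le_add (h _) (ih (Nat.le_add_right _ _))).trans (le_of_eq ?_))
      field_simp
      ring
  have : 0 ≤ θ ^ i := by positivity
  have : 0 ≤ B * θ ^ m := by positivity
  exact key.trans (div_le_div_of_nonneg_right (mul_le_of_le_one_right this (by linarith)) h1.le)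

section

variable {V : Type*} [NormedAddCommGroup V] [MeasurableSpace V]

/-- Even nonnegative kernels `k n`, living at scale `2⁻ⁿ`, whose consecutive differences act on
`L²(ν)` with geometrically decaying norm. -/
structure KernelApproximation (ν : Measure V) (k : ℕ → V → ℝ) (C B θ : ℝ) : Prop where
  continuous (n : ℕ) : Continuous (k n)
  nonneg (n : ℕ) (x : V) : 0 ≤ k n x
  even (n : ℕ) (x : V) : k n (-x) = k n x
  le (n : ℕ) (x : V) : k n x ≤ C * 2 ^ n
  form_le (n : ℕ) :
    |∫ p, (k (n + 1) (p.1 - p.2) - k n (p.1 - p.2)) ∂(ν.prod ν)| ≤ B * θ ^ n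
  conv_le (n : ℕ) (h : V → ℝ) (hh : MemLp h 2 ν) :
    ∫ y, (∫ x, (k (n + 1) (y - x) - k n (y - x)) * h x ∂ν) ^ 2 ∂ν ≤
      (B * θ ^ n) ^ 2 * ∫ x, h x ^ 2 ∂ν

/-- The correlation `∫ k(y - x) k(w - x) dν(x)` counting common neighbours of `y` and `w`. -/
noncomputable def kernelCorrelation (ν : Measure V) (k : V → ℝ) (p : V × V) : ℝ :=
  ∫ x, k (p.1 - x) * k (p.2 - x) ∂ν

namespace KernelApproximation

variable {ν : Measure V} {k : ℕ → V → ℝ} {C B θ : ℝ}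

theorem abs_apply_le (hk : KernelApproximation ν k C B θ) (n : ℕ) (x : V) :
    |k n x| ≤ C * 2 ^ n := by
  rw [abs_of_nonneg (hk.nonneg n x)]
  exact hk.le n x

theorem const_nonneg (hk : KernelApproximation ν k C B θ) : 0 ≤ C := by
  have := (hk.nonneg 0 0).trans (hk.le 0 0)
  simpa using this

variable [BorelSpace V] [IsProbabilityMeasure ν] [SecondCountableTopology V]

theorem integrable_form (hk : KernelApproximation ν k C B θ) (n : ℕ) :
    Integrable (fun p : V × V => k n (p.1 - p.2)) (ν.prod ν) :=
  integrable_of_continuous_of_abs_le (c := C * 2 ^ n)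
    ((hk.continuous n).comp (by fun_prop)).measurable fun p => hk.abs_apply_le n _

theorem abs_form_sub_le (hk : KernelApproximation ν k C B θ) (hB : 0 ≤ B) (hθ0 : 0 ≤ θ)
    (hθ1 : θ < 1) {m n : ℕ} (hmn : m ≤ n) :
    |∫ p, k n (p.1 - p.2) ∂(ν.prod ν) - ∫ p, k m (p.1 - p.2) ∂(ν.prod ν)| ≤
      B * θ ^ m / (1 - θ) := by
  refine abs_sub_le_of_geometric (f := fun n => ∫ p, k n (p.1 - p.2) ∂(ν.prod ν)) hB hθ0 hθ1
    (fun n => ?_) hmn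
  rw [← integral_sub (hk.integrable_form _) (hk.integrable_form _)]
  exact hk.form_le n

theorem form_le_const (hk : KernelApproximation ν k C B θ) (hB : 0 ≤ B) (hθ0 : 0 ≤ θ)
    (hθ1 : θ < 1) (n : ℕ) : ∫ p, k n (p.1 - p.2) ∂(ν.prod ν) ≤ C + B / (1 - θ) := by
  have h1 := (abs_le.1 (hk.abs_form_sub_le hB hθ0 hθ1 (Nat.zero_le n))).2
  have h2 : ∫ p, k 0 (p.1 - p.2) ∂(ν.prod ν) ≤ C := by
    have := integral_mono (hk.integrable_form 0) (integrable_const C) (μ := ν.prod ν) fun p => by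
      have := hk.le 0 (p.1 - p.2)
      simpa using this
    simpa using this
  simp only [pow_zero, mul_one] at h1
  linarith

theorem integral_sq_le (hk : KernelApproximation ν k C B θ) (hB : 0 ≤ B) (hθ0 : 0 ≤ θ)
    (hθ1 : θ < 1) (n : ℕ) :
    ∫ y, ∫ x, k n (y - x) ^ 2 ∂ν ∂ν ≤ C * 2 ^ n * (C + B / (1 - θ)) := by
  have hi : Integrable (fun p : V × V => k n (p.1 - p.2) ^ 2) (ν.prod ν) :=
    integrable_of_continuous_of_abs_le (c := (C * 2 ^ n) ^ 2)
      (((hk.continuous n).comp (by fun_prop)).pow 2).measurable fun p => by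
        rw [abs_pow]
        exact pow_le_pow_left₀ (abs_nonneg _) (hk.abs_apply_le n _) 2
  rw [← integral_prod (f := fun p : V × V => k n (p.1 - p.2) ^ 2) hi]
  have hC := hk.const_nonneg
  calc _ ≤ ∫ p : V × V, C * 2 ^ n * k n (p.1 - p.2) ∂(ν.prod ν) := by
        refine integral_mono hi ((hk.integrable_form n).const_mul _) fun p => ?_
        show k n (p.1 - p.2) ^ 2 ≤ _
        rw [sq]
        exact mul_le_mul_of_nonneg_right (hk.le n _) (hk.nonneg n _)
    _ = C * 2 ^ n * ∫ p : V × V, k n (p.1 - p.2) ∂(ν.prod ν) := integral_const_mul _ _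
    _ ≤ _ := by
        gcongr
        exact hk.form_le_const hB hθ0 hθ1 n

theorem integrable_mul (hk : KernelApproximation ν k C B θ) (m n : ℕ) (y w : V) :
    Integrable (fun x => k m (y - x) * k n (w - x)) ν :=
  integrable_of_continuous_of_abs_le (c := (C * 2 ^ m) * (C * 2 ^ n))
    (((hk.continuous m).comp (by fun_prop)).mul ((hk.continuous n).comp (by fun_prop))).measurable
    fun x => by
      rw [abs_mul]
      have := hk.const_nonneg
      exact mul_le_mul (hk.abs_apply_le m _) (hk.abs_apply_le n _) (abs_nonneg _) (by positivity)

theorem continuous_mixed (hk : KernelApproximation ν k C B θ) (m n : ℕ) :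
    Continuous fun p : V × V => ∫ x, k m (p.1 - x) * k n (p.2 - x) ∂ν := by
  have hm := hk.continuous m
  have hn := hk.continuous n
  refine continuous_of_dominated (bound := fun _ => (C * 2 ^ m) * (C * 2 ^ n))
    (fun p => (hk.integrable_mul m n p.1 p.2).aestronglyMeasurable) (fun p => ?_)
    (integrable_const _) (Filter.Eventually.of_forall fun x => by fun_prop)
  refine Filter.Eventually.of_forall fun x => ?_
  rw [Real.norm_eq_abs, abs_mul]
  have := hk.const_nonneg
  exact mul_le_mul (hk.abs_apply_le m _) (hk.abs_apply_le n _) (abs_nonneg _) (by positivity)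

theorem abs_mixed_le (hk : KernelApproximation ν k C B θ) (m n : ℕ) (p : V × V) :
    |∫ x, k m (p.1 - x) * k n (p.2 - x) ∂ν| ≤ (C * 2 ^ m) * (C * 2 ^ n) := by
  have := norm_integral_le_of_norm_le_const (μ := ν)
    (f := fun x => k m (p.1 - x) * k n (p.2 - x)) (C := (C * 2 ^ m) * (C * 2 ^ n))
    (Filter.Eventually.of_forall fun x => by
      rw [Real.norm_eq_abs, abs_mul]
      have := hk.const_nonneg
      exact mul_le_mul (hk.abs_apply_le m _) (hk.abs_apply_le n _) (abs_nonneg _) (by positivity))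
  simpa using this

theorem integrable_sq_sub_mixed (hk : KernelApproximation ν k C B θ) (i j m n : ℕ) :
    Integrable (fun p : V × V => ((∫ x, k i (p.1 - x) * k j (p.2 - x) ∂ν) -
      ∫ x, k m (p.1 - x) * k n (p.2 - x) ∂ν) ^ 2) (ν.prod ν) :=
  integrable_of_continuous_of_abs_le
    (c := ((C * 2 ^ i) * (C * 2 ^ j) + (C * 2 ^ m) * (C * 2 ^ n)) ^ 2)
    (((hk.continuous_mixed i j).sub (hk.continuous_mixed m n)).pow 2).measurable fun p => by
      rw [abs_pow]
      exact pow_le_pow_left₀ (abs_nonneg _) ((abs_sub _ _).trans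
        (add_le_add (hk.abs_mixed_le i j p) (hk.abs_mixed_le m n p))) 2

theorem continuous_correlation (hk : KernelApproximation ν k C B θ) (n : ℕ) :
    Continuous (kernelCorrelation ν (k n)) := hk.continuous_mixed n n

theorem abs_correlation_le (hk : KernelApproximation ν k C B θ) (n : ℕ) (p : V × V) :
    |kernelCorrelation ν (k n) p| ≤ (C * 2 ^ n) * (C * 2 ^ n) := hk.abs_mixed_le n n p

theorem memLp_translate (hk : KernelApproximation ν k C B θ) (n : ℕ) (w : V) :
    MemLp (fun x => k n (w - x)) 2 ν :=
  MemLp.of_bound (((hk.continuous n).comp (by fun_prop)).aestronglyMeasurable) (C * 2 ^ n)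
    (Filter.Eventually.of_forall fun x => hk.abs_apply_le n _)

theorem integral_sq_mixed_sub_le (hk : KernelApproximation ν k C B θ) (hB : 0 ≤ B) (hθ0 : 0 ≤ θ)
    (hθ1 : θ < 1) (n j : ℕ) :
    ∫ p : V × V, ((∫ x, k (n + 1) (p.1 - x) * k j (p.2 - x) ∂ν) -
      ∫ x, k n (p.1 - x) * k j (p.2 - x) ∂ν) ^ 2 ∂(ν.prod ν) ≤
      (B * θ ^ n) ^ 2 * (C * 2 ^ j * (C + B / (1 - θ))) := by
  have hi := hk.integrable_sq_sub_mixed (n + 1) j n j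
  rw [integral_prod_symm _ hi]
  have hi2 : Integrable (fun p : V × V => k j (p.1 - p.2) ^ 2) (ν.prod ν) :=
    integrable_of_continuous_of_abs_le (c := (C * 2 ^ j) ^ 2)
      (((hk.continuous j).comp (by fun_prop)).pow 2).measurable fun p => by
        rw [abs_pow]
        exact pow_le_pow_left₀ (abs_nonneg _) (hk.abs_apply_le j _) 2
  calc _ ≤ ∫ w, (B * θ ^ n) ^ 2 * (∫ x, k j (w - x) ^ 2 ∂ν) ∂ν := by
        refine integral_mono hi.integral_prod_right (hi2.integral_prod_left.const_mul _) fun w => ?_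
        refine le_trans (le_of_eq ?_) (hk.conv_le n _ (hk.memLp_translate j w))
        congr with y
        congr 1
        rw [← integral_sub (hk.integrable_mul _ _ _ _) (hk.integrable_mul _ _ _ _)]
        congr with x
        ring
    _ = (B * θ ^ n) ^ 2 * ∫ w, ∫ x, k j (w - x) ^ 2 ∂ν ∂ν := integral_const_mul _ _
    _ ≤ _ := by
        gcongr
        exact hk.integral_sq_le hB hθ0 hθ1 j

theorem integral_sq_correlation_step_le (hk : KernelApproximation ν k C B θ) (hB : 0 ≤ B)
    (hθ0 : 0 ≤ θ) (hθ1 : θ < 1) (n : ℕ) :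
    ∫ p : V × V, (kernelCorrelation ν (k (n + 1)) p - kernelCorrelation ν (k n) p) ^ 2
      ∂(ν.prod ν) ≤ 6 * B ^ 2 * C * (C + B / (1 - θ)) * (2 * θ ^ 2) ^ n := by
  have h1 := hk.integral_sq_mixed_sub_le hB hθ0 hθ1 n (n + 1)
  have h2 := hk.integral_sq_mixed_sub_le hB hθ0 hθ1 n n
  have i1 := hk.integrable_sq_sub_mixed (n + 1) (n + 1) n (n + 1)
  have i2 := hk.integrable_sq_sub_mixed (n + 1) n n n
  have i3 := hk.integrable_sq_sub_mixed (n + 1) (n + 1) n n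
  have h3 : ∫ p : V × V, ((∫ x, k n (p.1 - x) * k (n + 1) (p.2 - x) ∂ν) -
      ∫ x, k n (p.1 - x) * k n (p.2 - x) ∂ν) ^ 2 ∂(ν.prod ν) ≤
      (B * θ ^ n) ^ 2 * (C * 2 ^ n * (C + B / (1 - θ))) := by
    refine le_trans (le_of_eq ?_) h2
    rw [← integral_prod_swap]
    congr with p
    simp only [Prod.fst_swap, Prod.snd_swap, mul_comm]
  have i4 := hk.integrable_sq_sub_mixed n (n + 1) n n
  have h4 : ∫ p : V × V, (kernelCorrelation ν (k (n + 1)) p - kernelCorrelation ν (k n) p) ^ 2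
      ∂(ν.prod ν) ≤ ∫ p : V × V, (2 * ((∫ x, k (n + 1) (p.1 - x) * k (n + 1) (p.2 - x) ∂ν) -
      ∫ x, k n (p.1 - x) * k (n + 1) (p.2 - x) ∂ν) ^ 2 +
      2 * ((∫ x, k n (p.1 - x) * k (n + 1) (p.2 - x) ∂ν) -
      ∫ x, k n (p.1 - x) * k n (p.2 - x) ∂ν) ^ 2) ∂(ν.prod ν) := by
    refine integral_mono i3 ((i1.const_mul _).add (i4.const_mul _)) fun p => ?_
    simp only [kernelCorrelation]
    set u := ∫ x, k (n + 1) (p.1 - x) * k (n + 1) (p.2 - x) ∂ν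
    set v := ∫ x, k n (p.1 - x) * k (n + 1) (p.2 - x) ∂ν
    set w := ∫ x, k n (p.1 - x) * k n (p.2 - x) ∂ν
    nlinarith [sq_nonneg ((u - v) - (v - w))]
  rw [integral_add (i1.const_mul _) (i4.const_mul _), integral_const_mul, integral_const_mul] at h4
  have e : (2 * θ ^ 2) ^ n = (θ ^ n) ^ 2 * 2 ^ n := by
    rw [mul_pow, ← pow_mul, ← pow_mul, mul_comm n 2]; ring
  rw [e]
  refine h4.trans ((add_le_add (mul_le_mul_of_nonneg_left h1 two_pos.le)
    (mul_le_mul_of_nonneg_left h3 two_pos.le)).trans (le_of_eq ?_))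
  rw [pow_succ]
  ring

theorem integral_sq_correlation_sub_le (hk : KernelApproximation ν k C B θ) (hB : 0 ≤ B)
    (hθ0 : 0 < θ) (hθ1 : θ < 1) {q : ℝ} (hq0 : 0 < q) (hq1 : q < 1) (hq : 2 * θ ^ 2 = q ^ 2)
    {m n : ℕ} (hmn : m ≤ n) :
    ∫ p : V × V, (kernelCorrelation ν (k n) p - kernelCorrelation ν (k m) p) ^ 2 ∂(ν.prod ν) ≤
      6 * B ^ 2 * C * (C + B / (1 - θ)) / (1 - q) ^ 2 * (q ^ 2) ^ m := by
  set K := 6 * B ^ 2 * C * (C + B / (1 - θ)) with hK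
  have hC := hk.const_nonneg
  have h1θ : 0 < 1 - θ := by linarith
  have hK0 : 0 ≤ K := by positivity
  have h1q : 0 < 1 - q := by linarith
  set g : ℕ → V × V → ℝ := fun j p =>
    kernelCorrelation ν (k (j + 1)) p - kernelCorrelation ν (k j) p with hg
  have hgi : ∀ j, Integrable (fun p => g j p ^ 2) (ν.prod ν) := fun j =>
    hk.integrable_sq_sub_mixed (j + 1) (j + 1) j j
  have hgeom : ∑ j ∈ Finset.Ico m n, q ^ j ≤ q ^ m / (1 - q) := by
    exact geom_sum_Ico_le_of_lt_one hq0.le hq1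
  have htel : ∀ p, kernelCorrelation ν (k n) p - kernelCorrelation ν (k m) p =
      ∑ j ∈ Finset.Ico m n, g j p := fun p =>
    (Finset.sum_Ico_sub (fun j => kernelCorrelation ν (k j) p) hmn).symm
  have hcs : ∀ p, (kernelCorrelation ν (k n) p - kernelCorrelation ν (k m) p) ^ 2 ≤
      (q ^ m / (1 - q)) * ∑ j ∈ Finset.Ico m n, (q ^ j)⁻¹ * g j p ^ 2 := by
    intro p
    rw [htel]
    refine (Finset.sum_sq_le_sum_mul_sum_of_sq_le_mul (Finset.Ico m n) (f := fun j => q ^ j)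
      (g := fun j => (q ^ j)⁻¹ * g j p ^ 2) (fun j _ => by positivity)
      (fun j _ => by positivity) (fun j _ => ?_)).trans ?_
    · rw [← mul_assoc, mul_inv_cancel₀ (by positivity), one_mul]
    · refine mul_le_mul_of_nonneg_right hgeom (Finset.sum_nonneg fun j _ => by positivity)
  calc _ ≤ ∫ p, (q ^ m / (1 - q)) * ∑ j ∈ Finset.Ico m n, (q ^ j)⁻¹ * g j p ^ 2 ∂(ν.prod ν) :=
        integral_mono (hk.integrable_sq_sub_mixed n n m m)
          ((integrable_finsetSum _ fun j _ => (hgi j).const_mul _).const_mul _) hcs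
    _ = (q ^ m / (1 - q)) * ∑ j ∈ Finset.Ico m n, (q ^ j)⁻¹ * ∫ p, g j p ^ 2 ∂(ν.prod ν) := by
        rw [integral_const_mul, integral_finsetSum _ fun j _ => (hgi j).const_mul _]
        simp only [integral_const_mul]
    _ ≤ (q ^ m / (1 - q)) * ∑ j ∈ Finset.Ico m n, (q ^ j)⁻¹ * (K * (q ^ 2) ^ j) := by
        gcongr with j hj
        rw [← hq]
        exact hk.integral_sq_correlation_step_le hB hθ0.le hθ1 j
    _ = (q ^ m / (1 - q)) * (K * ∑ j ∈ Finset.Ico m n, q ^ j) := by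
        rw [Finset.mul_sum (a := K)]
        congr 1
        refine Finset.sum_congr rfl fun j _ => ?_
        rw [← pow_mul, mul_comm 2 j, pow_mul]
        field_simp
    _ ≤ (q ^ m / (1 - q)) * (K * (q ^ m / (1 - q))) := by gcongr
    _ = _ := by
        rw [← pow_mul, mul_comm 2 m, pow_mul]
        field_simp

end KernelApproximation

end

theorem setOf_dist_lt_measure_le {V : Type*} [MetricSpace V] [MeasurableSpace V] [BorelSpace V]
    [SecondCountableTopology V] {ν : Measure V} [IsProbabilityMeasure ν] {A s η : ℝ} (hη : 0 < η)
    (hν : ∀ (x : V) r, 0 < r → ν (Metric.closedBall x r) ≤ ENNReal.ofReal (A * r ^ s)) :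
    (ν.prod ν) {p : V × V | dist p.1 p.2 < η} ≤ ENNReal.ofReal (A * η ^ s) := by
  have hm : MeasurableSet {p : V × V | dist p.1 p.2 < η} :=
    (isOpen_lt (by fun_prop) (by fun_prop)).measurableSet
  rw [Measure.prod_apply hm]
  calc _ ≤ ∫⁻ _, ENNReal.ofReal (A * η ^ s) ∂ν := by
        refine lintegral_mono fun x => (measure_mono ?_).trans (hν x η hη)
        intro y hy
        rw [Metric.mem_closedBall, dist_comm]
        exact (show dist x y < η from hy).le
    _ = _ := by simp

section

variable {V : Type*} [NormedAddCommGroup V] [MeasurableSpace V]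

/-- The product of the kernel over the four sides of the quadrilateral with opposite vertices
`p.1, p.2` and `q.1, q.2`. -/
def quadrilateralKernel (k : V → ℝ) (p q : V × V) : ℝ :=
  k (p.1 - q.1) * k (p.2 - q.1) * (k (p.1 - q.2) * k (p.2 - q.2))

theorem integral_quadrilateralKernel (ν : Measure V) [SFinite ν] (k : V → ℝ) (p : V × V) :
    ∫ q, quadrilateralKernel k p q ∂(ν.prod ν) = kernelCorrelation ν k p ^ 2 := by
  rw [sq, kernelCorrelation, ← integral_prod_mul]
  rfl

namespace KernelApproximation

variable {ν : Measure V} {k : ℕ → V → ℝ} {C B θ : ℝ}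

theorem quadrilateralKernel_comm (hk : KernelApproximation ν k C B θ) (n : ℕ) (p q : V × V) :
    quadrilateralKernel (k n) p q = quadrilateralKernel (k n) q p := by
  have h : ∀ x y, k n (x - y) = k n (y - x) := fun x y => by rw [← hk.even n, neg_sub]
  simp only [quadrilateralKernel, h p.1, h p.2]
  ring

variable [BorelSpace V] [IsProbabilityMeasure ν] [SecondCountableTopology V]

theorem integrable_quadrilateralKernel (hk : KernelApproximation ν k C B θ) (n : ℕ) :
    Integrable (fun P : (V × V) × (V × V) => quadrilateralKernel (k n) P.1 P.2)
      ((ν.prod ν).prod (ν.prod ν)) := by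
  have hc := hk.continuous n
  have hC := hk.const_nonneg
  have hm : Continuous fun P : (V × V) × (V × V) => quadrilateralKernel (k n) P.1 P.2 := by
    unfold quadrilateralKernel
    fun_prop
  refine integrable_of_continuous_of_abs_le
    (c := (C * 2 ^ n) * (C * 2 ^ n) * ((C * 2 ^ n) * (C * 2 ^ n))) hm.measurable fun P => ?_
  simp only [quadrilateralKernel, abs_mul]
  gcongr <;> exact hk.abs_apply_le n _

theorem pow_four_le_integral_sq (hk : KernelApproximation ν k C B θ) {c : ℝ} (hc : 0 ≤ c) (n : ℕ)
    (hn : c ≤ ∫ p, k n (p.1 - p.2) ∂(ν.prod ν)) :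
    c ^ 4 ≤ ∫ p, kernelCorrelation ν (k n) p ^ 2 ∂(ν.prod ν) := by
  have hcont := hk.continuous n
  have hGi : Integrable (kernelCorrelation ν (k n)) (ν.prod ν) :=
    integrable_of_continuous_of_abs_le (hk.continuous_correlation n).measurable
      (hk.abs_correlation_le n)
  have hG2 : Integrable (fun p => kernelCorrelation ν (k n) p ^ 2) (ν.prod ν) :=
    integrable_of_continuous_of_abs_le (c := ((C * 2 ^ n) * (C * 2 ^ n)) ^ 2)
      ((hk.continuous_correlation n).pow 2).measurable fun p => by
        rw [abs_pow]
        exact pow_le_pow_left₀ (abs_nonneg _) (hk.abs_correlation_le n p) 2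
  set u : V → ℝ := fun x => ∫ y, k n (y - x) ∂ν with hu
  have hub : ∀ x, |u x| ≤ C * 2 ^ n := fun x => by
    have := norm_integral_le_of_norm_le_const (μ := ν) (f := fun y => k n (y - x))
      (C := C * 2 ^ n) (Filter.Eventually.of_forall fun y => hk.abs_apply_le n _)
    simpa using this
  have hum : Continuous u := by
    refine continuous_of_dominated (bound := fun _ => C * 2 ^ n)
      (fun x => (hcont.comp (by fun_prop)).aestronglyMeasurable) (fun x => ?_)
      (integrable_const _) (Filter.Eventually.of_forall fun x => by fun_prop)
    exact Filter.Eventually.of_forall fun y => hk.abs_apply_le n _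
  have h1 : ∫ p, k n (p.1 - p.2) ∂(ν.prod ν) = ∫ x, u x ∂ν :=
    integral_prod_symm _ (hk.integrable_form n)
  have h2 : ∫ p, kernelCorrelation ν (k n) p ∂(ν.prod ν) = ∫ x, u x ^ 2 ∂ν := by
    have hi : Integrable (fun P : (V × V) × V => k n (P.1.1 - P.2) * k n (P.1.2 - P.2))
        ((ν.prod ν).prod ν) := by
      have hC := hk.const_nonneg
      refine integrable_of_continuous_of_abs_le (c := (C * 2 ^ n) * (C * 2 ^ n))
        (Continuous.measurable (by fun_prop)) fun P => ?_
      rw [abs_mul]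
      gcongr <;> exact hk.abs_apply_le n _
    simp only [kernelCorrelation]
    rw [integral_integral_swap (f := fun (p : V × V) x => k n (p.1 - x) * k n (p.2 - x)) hi]
    congr with x
    rw [integral_prod_mul (fun y => k n (y - x)) (fun y => k n (y - x)), ← sq]
  have h3 := sq_integral_le_integral_sq (m := ν) (f := u)
    (integrable_of_continuous_of_abs_le hum.measurable hub)
    (integrable_of_continuous_of_abs_le (c := (C * 2 ^ n) ^ 2) (hum.pow 2).measurable fun x => by
      rw [abs_pow]
      exact pow_le_pow_left₀ (abs_nonneg _) (hub x) 2)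
  have h4 := sq_integral_le_integral_sq hGi hG2
  rw [h2] at h4
  rw [← h1] at h3
  calc c ^ 4 = (c ^ 2) ^ 2 := by ring
    _ ≤ (∫ x, u x ^ 2 ∂ν) ^ 2 := by
        refine pow_le_pow_left₀ (by positivity) (le_trans ?_ h3) 2
        exact pow_le_pow_left₀ hc hn 2
    _ ≤ _ := h4

theorem exists_separated_quadrilateral (hk : KernelApproximation ν k C B θ) (hB : 0 ≤ B)
    (hθ0 : 0 < θ) (hθ1 : 2 * θ ^ 2 < 1) {A s : ℝ} (hA : 0 < A) (hs : 0 < s)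
    (hν : ∀ (x : V) r, 0 < r → ν (Metric.closedBall x r) ≤ ENNReal.ofReal (A * r ^ s))
    {E : Set V} (hE : ν Eᶜ = 0) {c : ℝ} (hc : 0 < c) {N : ℕ}
    (hN : ∀ n, N ≤ n → c ≤ ∫ p, k n (p.1 - p.2) ∂(ν.prod ν)) :
    ∃ η > 0, ∃ J, ∀ n, J ≤ n → ∃ p q : V × V, p.1 ∈ E ∧ p.2 ∈ E ∧ q.1 ∈ E ∧ q.2 ∈ E ∧
      η ≤ dist p.1 p.2 ∧ η ≤ dist q.1 q.2 ∧ c ^ 4 / 4 ≤ quadrilateralKernel (k n) p q := by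
  have hC := hk.const_nonneg
  have hθ1' : θ < 1 := by nlinarith
  set q : ℝ := √(2 * θ ^ 2) with hq
  have hq0 : 0 < q := Real.sqrt_pos.2 (by positivity)
  have hqq : 2 * θ ^ 2 = q ^ 2 := (Real.sq_sqrt (by positivity)).symm
  have hq1 : q < 1 := by nlinarith
  set K := 6 * B ^ 2 * C * (C + B / (1 - θ)) / (1 - q) ^ 2 with hK
  have h1θ : 0 < 1 - θ := by linarith
  have hK0 : 0 ≤ K := by positivity
  obtain ⟨J, hJN, hJ⟩ : ∃ J, N ≤ J ∧ 2 * (K * (q ^ 2) ^ J) ≤ c ^ 4 / 8 := by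
    have ht : Filter.Tendsto (fun J : ℕ => 2 * (K * (q ^ 2) ^ J)) Filter.atTop
        (nhds (2 * (K * 0))) :=
      ((tendsto_pow_atTop_nhds_zero_of_lt_one (by positivity)
        (by nlinarith)).const_mul _).const_mul _
    rw [mul_zero, mul_zero] at ht
    have h1 := ht.eventually (ge_mem_nhds (show (0 : ℝ) < c ^ 4 / 8 by positivity))
    obtain ⟨J, h, h'⟩ := (h1.and (Filter.eventually_ge_atTop N)).exists
    exact ⟨J, h', h⟩
  set S : ℝ := ((C * 2 ^ J) * (C * 2 ^ J)) ^ 2 with hS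
  have hS0 : 0 ≤ S := by positivity
  obtain ⟨η, hη, hηS⟩ : ∃ η : ℝ, 0 < η ∧ 2 * (S * (A * η ^ s)) ≤ c ^ 4 / 8 := by
    have ht : Filter.Tendsto (fun η : ℝ => 2 * (S * (A * η ^ s))) (nhdsWithin 0 (Ioi 0))
        (nhds (2 * (S * (A * 0)))) := by
      have h0 : Filter.Tendsto (fun η : ℝ => η ^ s) (nhdsWithin 0 (Ioi 0)) (nhds 0) := by
        have := (Real.continuousAt_rpow_const 0 s (Or.inr hs.le)).tendsto
        rw [Real.zero_rpow hs.ne'] at this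
        exact this.mono_left nhdsWithin_le_nhds
      exact ((h0.const_mul _).const_mul _).const_mul _
    rw [mul_zero, mul_zero, mul_zero] at ht
    have h1 := ht.eventually (ge_mem_nhds (show (0 : ℝ) < c ^ 4 / 8 by positivity))
    obtain ⟨η, h, h'⟩ := (h1.and self_mem_nhdsWithin).exists
    exact ⟨η, h', h⟩
  set T : Set (V × V) := {p | dist p.1 p.2 < η} with hT
  have hTm : MeasurableSet T := (isOpen_lt (by fun_prop) (by fun_prop)).measurableSet
  have hTν : (ν.prod ν).real T ≤ A * η ^ s := by
    have := setOf_dist_lt_measure_le hη hν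
    exact ENNReal.toReal_le_of_le_ofReal (by positivity) this
  refine ⟨η, hη, J, fun n hn => ?_⟩
  have hG2 : ∀ n, Integrable (fun p => kernelCorrelation ν (k n) p ^ 2) (ν.prod ν) := fun n =>
    integrable_of_continuous_of_abs_le (c := ((C * 2 ^ n) * (C * 2 ^ n)) ^ 2)
      ((hk.continuous_correlation n).pow 2).measurable fun p => by
        rw [abs_pow]
        exact pow_le_pow_left₀ (abs_nonneg _) (hk.abs_correlation_le n p) 2
  have hGd := hk.integral_sq_correlation_sub_le hB hθ0 hθ1' hq0 hq1 hqq hn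
  rw [← hK] at hGd
  have hGdi : Integrable (fun p => (kernelCorrelation ν (k n) p - kernelCorrelation ν (k J) p) ^ 2)
      (ν.prod ν) := hk.integrable_sq_sub_mixed n n J J
  have hnear : ∫ p in T, kernelCorrelation ν (k n) p ^ 2 ∂(ν.prod ν) ≤ c ^ 4 / 4 := by
    calc _ ≤ ∫ p in T, (2 * kernelCorrelation ν (k J) p ^ 2 +
          2 * (kernelCorrelation ν (k n) p - kernelCorrelation ν (k J) p) ^ 2) ∂(ν.prod ν) := by
          refine integral_mono (hG2 n).integrableOn
            (((hG2 J).const_mul _).add (hGdi.const_mul _)).integrableOn fun p => ?_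
          show kernelCorrelation ν (k n) p ^ 2 ≤ 2 * kernelCorrelation ν (k J) p ^ 2 +
            2 * (kernelCorrelation ν (k n) p - kernelCorrelation ν (k J) p) ^ 2
          nlinarith [sq_nonneg (kernelCorrelation ν (k n) p - 2 * kernelCorrelation ν (k J) p)]
      _ = 2 * ∫ p in T, kernelCorrelation ν (k J) p ^ 2 ∂(ν.prod ν) +
          2 * ∫ p in T, (kernelCorrelation ν (k n) p - kernelCorrelation ν (k J) p) ^ 2
            ∂(ν.prod ν) := by
          rw [integral_add ((hG2 J).const_mul _).integrableOn (hGdi.const_mul _).integrableOn,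
            integral_const_mul, integral_const_mul]
      _ ≤ 2 * (S * (A * η ^ s)) + 2 * (K * (q ^ 2) ^ J) := by
          gcongr
          · calc _ ≤ ∫ p in T, S ∂(ν.prod ν) := by
                  refine integral_mono (hG2 J).integrableOn (integrable_const _) fun p => ?_
                  show kernelCorrelation ν (k J) p ^ 2 ≤ S
                  rw [← sq_abs]
                  exact pow_le_pow_left₀ (abs_nonneg _) (hk.abs_correlation_le J p) 2
              _ = S * (ν.prod ν).real T := by
                  rw [setIntegral_const, smul_eq_mul, mul_comm]
              _ ≤ _ := by gcongr
          · exact (setIntegral_le_integral hGdi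
              (Filter.Eventually.of_forall fun p => sq_nonneg _)).trans hGd
      _ ≤ _ := by linarith
  have hfull := hk.pow_four_le_integral_sq hc.le n (hN n (hJN.trans hn))
  by_contra hcon
  have hfar : ∀ p q : V × V, p.1 ∈ E → p.2 ∈ E → q.1 ∈ E → q.2 ∈ E → p ∉ T → q ∉ T →
      quadrilateralKernel (k n) p q ≤ c ^ 4 / 4 := by
    intro p q h1 h2 h3 h4 h5 h6
    by_contra h7
    exact hcon ⟨p, q, h1, h2, h3, h4, not_lt.1 h5, not_lt.1 h6, (not_le.1 h7).le⟩
  have hHi := hk.integrable_quadrilateralKernel n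
  have hH0 : ∀ p q, 0 ≤ quadrilateralKernel (k n) p q := fun p q =>
    mul_nonneg (mul_nonneg (hk.nonneg n _) (hk.nonneg n _))
      (mul_nonneg (hk.nonneg n _) (hk.nonneg n _))
  have hEae : ∀ᵐ x ∂ν, x ∈ E := hE
  have hE2 : ∀ᵐ p ∂(ν.prod ν), p.1 ∈ E ∧ p.2 ∈ E :=
    (Measure.quasiMeasurePreserving_fst.ae hEae).and (Measure.quasiMeasurePreserving_snd.ae hEae)
  have hE4 : ∀ᵐ P ∂((ν.prod ν).prod (ν.prod ν)),
      (P.1.1 ∈ E ∧ P.1.2 ∈ E) ∧ (P.2.1 ∈ E ∧ P.2.2 ∈ E) :=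
    (Measure.quasiMeasurePreserving_fst.ae hE2).and (Measure.quasiMeasurePreserving_snd.ae hE2)
  set F1 : (V × V) × (V × V) → ℝ := fun P =>
    T.indicator (fun _ => (1 : ℝ)) P.1 * quadrilateralKernel (k n) P.1 P.2 with hF1
  have hind : ∀ p : V × V, |T.indicator (fun _ => (1 : ℝ)) p| ≤ 1 := fun p => by
    by_cases hp : p ∈ T <;> simp [hp]
  have hF1i : Integrable F1 ((ν.prod ν).prod (ν.prod ν)) :=
    hHi.bdd_mul (c := 1)
      (((measurable_const.indicator hTm).comp measurable_fst).aestronglyMeasurable)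
      (Filter.Eventually.of_forall fun P => hind P.1)
  have hF1v : ∫ P, F1 P ∂((ν.prod ν).prod (ν.prod ν)) =
      ∫ p in T, kernelCorrelation ν (k n) p ^ 2 ∂(ν.prod ν) := by
    rw [integral_prod _ hF1i, ← integral_indicator hTm]
    congr with p
    simp only [hF1]
    rw [integral_const_mul, integral_quadrilateralKernel]
    by_cases hp : p ∈ T <;> simp [hp]
  have hF1s : ∫ P : (V × V) × (V × V), F1 P.swap ∂((ν.prod ν).prod (ν.prod ν)) =
      ∫ P, F1 P ∂((ν.prod ν).prod (ν.prod ν)) := integral_prod_swap F1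
  have hF1si : Integrable (fun P => F1 P.swap) ((ν.prod ν).prod (ν.prod ν)) := hF1i.swap
  have htot : ∫ P : (V × V) × (V × V), quadrilateralKernel (k n) P.1 P.2
      ∂((ν.prod ν).prod (ν.prod ν)) = ∫ p, kernelCorrelation ν (k n) p ^ 2 ∂(ν.prod ν) := by
    rw [integral_prod _ hHi]
    simp only [integral_quadrilateralKernel]
  have hle : ∫ P : (V × V) × (V × V), quadrilateralKernel (k n) P.1 P.2
      ∂((ν.prod ν).prod (ν.prod ν)) ≤
      ∫ P, (F1 P + F1 P.swap + c ^ 4 / 4) ∂((ν.prod ν).prod (ν.prod ν)) := by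
    refine integral_mono_ae hHi ((hF1i.add hF1si).add (integrable_const _)) ?_
    filter_upwards [hE4] with P hP
    simp only [hF1, Prod.fst_swap, Prod.snd_swap]
    rw [hk.quadrilateralKernel_comm n P.2 P.1]
    have h0 := hH0 P.1 P.2
    have hc4 : 0 < c ^ 4 := by positivity
    by_cases h1 : P.1 ∈ T <;> by_cases h2 : P.2 ∈ T <;> simp only [h1, h2, indicator_of_mem,
      indicator_of_notMem, not_false_eq_true, one_mul, zero_mul]
    · linarith
    · linarith
    · linarith
    · linarith [hfar P.1 P.2 hP.1.1 hP.1.2 hP.2.1 hP.2.2 h1 h2]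
  rw [integral_add (f := fun P => F1 P + F1 P.swap) (hF1i.add hF1si)
    (integrable_const _), integral_add hF1i hF1si, hF1s, hF1v,
    htot, integral_const, probReal_univ, one_smul] at hle
  have hc4 : 0 < c ^ 4 := by positivity
  linarith

end KernelApproximation

end

section

variable {V : Type*} [NormedAddCommGroup V] [InnerProductSpace ℝ V] [FiniteDimensional ℝ V]
  [MeasurableSpace V] [BorelSpace V]

theorem cosTransform_sub {m₁ m₂ : V → ℝ} (h₁ : Integrable m₁) (h₂ : Integrable m₂) (x : V) :
    cosTransform (fun ξ => m₁ ξ - m₂ ξ) x = cosTransform m₁ x - cosTransform m₂ x := by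
  simp only [cosTransform, sub_mul]
  exact integral_sub (integrable_mul_cos h₁ x) (integrable_mul_cos h₂ x)

theorem exists_kernelApproximation_sphereKernel [Nontrivial V] {ν : Measure V}
    [IsProbabilityMeasure ν] {A s a : ℝ} (hA : 0 < A) (ha : 0 < a)
    (hν : ∀ (x : V) r, 0 < r → ν (Metric.closedBall x r) ≤ ENNReal.ofReal (A * r ^ s))
    (hs : ((Module.finrank ℝ V : ℝ) - 1) / 2 - (Module.finrank ℝ V - s) ≤ 1) :
    ∃ C B : ℝ, 0 < B ∧ ∀ t, a ≤ t →
      KernelApproximation ν (fun n => sphereKernel ((1 / 2) ^ n) t) C B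
        ((2 : ℝ) ^ (-(((Module.finrank ℝ V : ℝ) - 1) / 2 - (Module.finrank ℝ V - s)))) := by
  obtain ⟨C, hC, hCb⟩ := exists_sphereKernel_le (V := V) ha
  obtain ⟨B, hB, hM⟩ := exists_sphereMultiplier_diff_majorant hA ha hν hs
  set θ : ℝ := (2 : ℝ) ^ (-(((Module.finrank ℝ V : ℝ) - 1) / 2 - (Module.finrank ℝ V - s)))
  have hθ : 0 < θ := by positivity
  have hr : ∀ n : ℕ, (0 : ℝ) < (1 / 2) ^ n := fun n => by positivity
  have hdiff : ∀ n t (x : V),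
      sphereKernel ((1 / 2) ^ (n + 1)) t x - sphereKernel ((1 / 2) ^ n) t x =
      cosTransform (fun ξ => sphereMultiplier ((1 / 2) ^ (n + 1)) t ξ -
        sphereMultiplier ((1 / 2) ^ n) t ξ) x := by
    intro n t x
    rw [cosTransform_sub (integrable_sphereMultiplier (hr _) t)
      (integrable_sphereMultiplier (hr _) t), sphereKernel_eq_cosTransform (hr _),
      sphereKernel_eq_cosTransform (hr _)]
  refine ⟨C, B, hB, fun t ht => ⟨fun n => ?_, fun n x => sphereKernel_nonneg (hr n) t x,
    fun n x => sphereKernel_neg (hr n) t x, fun n x => ?_, fun n => ?_, fun n h hh => ?_⟩⟩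
  · exact (continuous_sphereKernel (hr n)).comp (by fun_prop : Continuous fun x : V => (t, x))
  · have := hCb _ t (hr n) ht x
    rwa [one_div, inv_pow, inv_inv, ← inv_pow, ← one_div] at this
  · obtain ⟨M, hMi, hMd, hMB⟩ := hM n
    have h1 : MemLp (fun _ : V => (1 : ℝ)) 2 ν := memLp_const _
    have := abs_integral_cosTransform_bilinear_le ((integrable_sphereMultiplier (hr (n + 1)) t).sub
      (integrable_sphereMultiplier (hr n) t)) hMi (hMd t ht) hMB h1 h1
    simp only [hdiff]
    refine le_trans (le_of_eq ?_) (this.trans (le_of_eq ?_))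
    · congr 2 with p
      rw [mul_one, mul_one]
      rfl
    · simp
      ring
  · obtain ⟨M, hMi, hMd, hMB⟩ := hM n
    simp only [hdiff]
    exact integral_sq_cosTransform_conv_le ((integrable_sphereMultiplier (hr (n + 1)) t).sub
      (integrable_sphereMultiplier (hr n) t)) hMi (hMd t ht) (by positivity) hMB hh

theorem exists_lintegral_sphereKernel_ge [Nontrivial V] {a R : ℝ} (ha : 0 < a) :
    ∃ c : ℝ, 0 < c ∧ ∀ r : ℝ, 0 < r → r ≤ 1 → ∀ x : V, 2 * a ≤ ‖x‖ → ‖x‖ ≤ R →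
      ENNReal.ofReal c ≤ ∫⁻ t in Ioo a (R + a),
        ENNReal.ofReal (t ^ (Module.finrank ℝ V - 1) * sphereKernel r t x) := by
  set d := Module.finrank ℝ V with hd
  set ε : ℝ := min a 1 with hε
  have hε0 : 0 < ε := lt_min ha one_pos
  have hvol : 0 < (volume : Measure V).real (Metric.ball 0 1) :=
    ENNReal.toReal_pos (Metric.measure_ball_pos _ _ one_pos).ne' measure_ball_lt_top.ne
  refine ⟨Real.exp (-Real.pi) * ε ^ d * (volume : Measure V).real (Metric.ball 0 1), by positivity,
    fun r hr hr1 x hx1 hx2 => ?_⟩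
  set φ : V → ℝ := fun v => (r ^ d)⁻¹ * Real.exp (-Real.pi * ‖x - v‖ ^ 2 / r ^ 2) with hφ
  have hφ0 : ∀ v, 0 ≤ φ v := fun v => by positivity
  have hφc : Continuous φ := by fun_prop
  set T : Set V := {v | ‖v‖ ∈ Ioo a (R + a)} with hT
  have hTm : MeasurableSet T := (isOpen_Ioo.preimage continuous_norm).measurableSet
  set f : V → ℝ≥0∞ := T.indicator fun v => ENNReal.ofReal (φ v) with hf
  have hfm : Measurable f := hφc.measurable.ennreal_ofReal.indicator hTm
  have hupper : ∫⁻ v, f v = ∫⁻ t in Ioo a (R + a), ENNReal.ofReal (t ^ (d - 1) *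
      sphereKernel r t x) := by
    rw [lintegral_eq_lintegral_sphereMeasure hfm]
    have hsub : Ioo a (R + a) ⊆ Ioi 0 := fun t ht => ha.trans ht.1
    rw [← inter_eq_self_of_subset_left hsub, ← Measure.restrict_restrict measurableSet_Ioo,
      ← lintegral_indicator measurableSet_Ioo]
    refine setLIntegral_congr_fun measurableSet_Ioi fun t ht => ?_
    have ht0 : 0 < t := ht
    have hval : ∀ᵐ ω ∂(sphereMeasure V), f (t • ω) =
        (Ioo a (R + a)).indicator (fun _ => ENNReal.ofReal (φ (t • ω))) t := by
      filter_upwards [ae_sphereMeasure_mem_sphere] with ω hω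
      have hn : ‖t • ω‖ = t := by
        rw [norm_smul, mem_sphere_zero_iff_norm.1 hω, mul_one, Real.norm_of_nonneg ht0.le]
      simp only [hf, indicator, hT, mem_ofPred_eq, hn]
    show ENNReal.ofReal (t ^ (d - 1)) * _ = _
    rw [lintegral_congr_ae hval]
    by_cases h : t ∈ Ioo a (R + a)
    · simp only [h, indicator_of_mem]
      rw [ENNReal.ofReal_mul (by positivity), sphereKernel,
        ofReal_integral_eq_lintegral_ofReal (integrable_sphereMeasure (by fun_prop))
          (Filter.Eventually.of_forall fun ω => hφ0 _)]
    · simp [h]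
  rw [← hupper]
  have hball : Metric.ball x (ε * r) ⊆ T := by
    intro v hv
    rw [Metric.mem_ball, dist_eq_norm] at hv
    have h1 : ε * r ≤ a := by
      have : ε * r ≤ ε := mul_le_of_le_one_right hε0.le hr1
      exact this.trans (min_le_left _ _)
    have h2 := norm_sub_norm_le x v
    have h3 := norm_sub_norm_le v x
    rw [norm_sub_rev] at h2
    exact ⟨by linarith, by linarith⟩
  have hrd : 0 < r ^ d := by positivity
  calc ENNReal.ofReal (Real.exp (-Real.pi) * ε ^ d * (volume : Measure V).real (Metric.ball 0 1))
      = ENNReal.ofReal ((r ^ d)⁻¹ * Real.exp (-Real.pi)) * volume (Metric.ball x (ε * r)) := by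
        rw [Measure.addHaar_ball _ _ (by positivity), ← hd,
          ← ofReal_measureReal measure_ball_lt_top.ne, ← ENNReal.ofReal_mul (by positivity),
          ← ENNReal.ofReal_mul (by positivity)]
        congr 1
        rw [mul_pow]
        field_simp
    _ = ∫⁻ v in Metric.ball x (ε * r), ENNReal.ofReal ((r ^ d)⁻¹ * Real.exp (-Real.pi)) := by
        rw [setLIntegral_const]
    _ ≤ ∫⁻ v in Metric.ball x (ε * r), f v := by
        refine setLIntegral_mono' measurableSet_ball fun v hv => ?_
        simp only [hf]
        rw [indicator_of_mem (hball hv)]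
        refine ENNReal.ofReal_le_ofReal ?_
        simp only [hφ]
        gcongr
        rw [le_div_iff₀ (by positivity)]
        rw [Metric.mem_ball, dist_comm, dist_eq_norm] at hv
        have h1 : ε * r ≤ r := mul_le_of_le_one_left hr.le (min_le_right _ _)
        have h2 : ‖x - v‖ ^ 2 ≤ r ^ 2 := by
          have := norm_nonneg (x - v)
          gcongr
          linarith
        nlinarith [Real.pi_pos]
    _ ≤ ∫⁻ v, f v := setLIntegral_le_lintegral _ _

theorem integrable_sphereKernel_form {ν : Measure V} [IsProbabilityMeasure ν] {r t : ℝ}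
    (hr : 0 < r) (ht : 0 ≤ t) :
    Integrable (fun p : V × V => sphereKernel r t (p.1 - p.2)) (ν.prod ν) := by
  have hct : Continuous fun p : V × V => sphereKernel r t (p.1 - p.2) :=
    (continuous_sphereKernel hr).comp (by fun_prop : Continuous fun p : V × V => (t, p.1 - p.2))
  refine integrable_of_continuous_of_abs_le
    (c := (sphereMeasure V).real univ * (r ^ Module.finrank ℝ V)⁻¹) hct.measurable fun p => ?_
  rw [abs_of_nonneg (sphereKernel_nonneg hr _ _)]
  refine (sphereKernel_le_exp hr ht _).trans
    (mul_le_of_le_one_right (by positivity) (Real.exp_le_one_iff.2 ?_))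
  rw [neg_mul, neg_div]
  exact neg_nonpos.2 (by positivity)

theorem lintegral_sphereKernel_form_le {ν : Measure V} [IsProbabilityMeasure ν] {a R c r : ℝ}
    (ha : 0 < a) (hR : 0 < R) (hr : 0 < r) (n : ℕ)
    (h : ∀ t ∈ Ioo a (R + a), ∫ p, sphereKernel r t (p.1 - p.2) ∂(ν.prod ν) ≤ c) :
    ∫⁻ p : V × V, (∫⁻ t in Ioo a (R + a),
      ENNReal.ofReal (t ^ n * sphereKernel r t (p.1 - p.2))) ∂(ν.prod ν) ≤
      ENNReal.ofReal ((R + a) ^ n * c * R) := by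
  have hcont : Continuous fun q : (V × V) × ℝ => sphereKernel r q.2 (q.1.1 - q.1.2) :=
    (continuous_sphereKernel hr).comp
      (by fun_prop : Continuous fun q : (V × V) × ℝ => (q.2, q.1.1 - q.1.2))
  have hjoint : Continuous fun q : (V × V) × ℝ =>
      q.2 ^ n * sphereKernel r q.2 (q.1.1 - q.1.2) := (continuous_snd.pow _).mul hcont
  have hm : Measurable fun q : (V × V) × ℝ =>
      ENNReal.ofReal (q.2 ^ n * sphereKernel r q.2 (q.1.1 - q.1.2)) :=
    hjoint.measurable.ennreal_ofReal
  have hinner : ∀ t ∈ Ioo a (R + a), ∫⁻ p : V × V,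
      ENNReal.ofReal (t ^ n * sphereKernel r t (p.1 - p.2)) ∂(ν.prod ν) ≤
      ENNReal.ofReal ((R + a) ^ n * c) := by
    intro t ht
    have ht0 : 0 < t := ha.trans ht.1
    rw [← ofReal_integral_eq_lintegral_ofReal
      ((integrable_sphereKernel_form hr ht0.le).const_mul _)
      (Filter.Eventually.of_forall fun p =>
        mul_nonneg (pow_nonneg ht0.le _) (sphereKernel_nonneg hr _ _)), integral_const_mul]
    exact ENNReal.ofReal_le_ofReal (mul_le_mul (pow_le_pow_left₀ ht0.le ht.2.le _) (h t ht)
      (integral_nonneg fun p => sphereKernel_nonneg hr _ _) (by positivity))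
  rw [lintegral_lintegral_swap (μ := ν.prod ν) (ν := volume.restrict (Ioo a (R + a)))
    (f := fun (p : V × V) t => ENNReal.ofReal (t ^ n * sphereKernel r t (p.1 - p.2)))
    hm.aemeasurable]
  refine (setLIntegral_mono' measurableSet_Ioo hinner).trans (le_of_eq ?_)
  rw [setLIntegral_const, Real.volume_Ioo, ← ENNReal.ofReal_mul' (by linarith)]
  congr 2
  ring

theorem exists_form_sphereKernel_ge [Nontrivial V] {ν : Measure V} [IsProbabilityMeasure ν]
    {E : Set V} (hE : ν Eᶜ = 0) {a R : ℝ} (ha : 0 < a) (hR0 : 0 < R)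
    (hR : ∀ x ∈ E, ∀ y ∈ E, ‖x - y‖ ≤ R)
    (hnear : (ν.prod ν) {p : V × V | dist p.1 p.2 < 2 * a} ≤ ENNReal.ofReal (1 / 2)) :
    ∃ c : ℝ, 0 < c ∧ ∀ r : ℝ, 0 < r → r ≤ 1 → ∃ t ∈ Ioo a (R + a),
      c ≤ ∫ p, sphereKernel r t (p.1 - p.2) ∂(ν.prod ν) := by
  obtain ⟨c₁, hc₁, hge⟩ := exists_lintegral_sphereKernel_ge (V := V) (R := R) ha
  set d := Module.finrank ℝ V with hd
  set L : ℝ := (R + a) ^ (d - 1) * R with hL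
  have hL0 : 0 < L := by positivity
  refine ⟨c₁ / (4 * L), by positivity, fun r hr hr1 => ?_⟩
  by_contra hcon
  push Not at hcon
  set T : Set (V × V) := {p : V × V | dist p.1 p.2 < 2 * a} with hT
  have hTm : MeasurableSet T := (isOpen_lt (by fun_prop) (by fun_prop)).measurableSet
  have hEae : ∀ᵐ x ∂ν, x ∈ E := hE
  have hE2 : ∀ᵐ p ∂(ν.prod ν), p.1 ∈ E ∧ p.2 ∈ E :=
    (Measure.quasiMeasurePreserving_fst.ae hEae).and (Measure.quasiMeasurePreserving_snd.ae hEae)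
  have hhalf : ENNReal.ofReal (1 / 2) ≤ (ν.prod ν) Tᶜ := by
    rw [prob_compl_eq_one_sub hTm]
    refine ENNReal.le_sub_of_add_le_left (measure_ne_top _ _) ?_
    refine (add_le_add_left hnear _).trans (le_of_eq ?_)
    rw [← ENNReal.ofReal_add (by norm_num) (by norm_num)]
    norm_num
  have hlow : ENNReal.ofReal (c₁ * (1 / 2)) ≤ ∫⁻ p : V × V, (∫⁻ t in Ioo a (R + a),
      ENNReal.ofReal (t ^ (d - 1) * sphereKernel r t (p.1 - p.2))) ∂(ν.prod ν) := by
    rw [ENNReal.ofReal_mul hc₁.le]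
    calc _ ≤ ENNReal.ofReal c₁ * (ν.prod ν) Tᶜ := by gcongr
      _ = ∫⁻ p in Tᶜ, ENNReal.ofReal c₁ ∂(ν.prod ν) := by rw [setLIntegral_const]
      _ ≤ ∫⁻ p in Tᶜ, (∫⁻ t in Ioo a (R + a),
          ENNReal.ofReal (t ^ (d - 1) * sphereKernel r t (p.1 - p.2))) ∂(ν.prod ν) := by
          refine lintegral_mono_ae ?_
          filter_upwards [ae_restrict_mem hTm.compl, ae_restrict_of_ae hE2] with p hp hpE
          refine hge r hr hr1 _ ?_ (hR _ hpE.1 _ hpE.2)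
          rw [← dist_eq_norm]
          exact not_lt.1 hp
      _ ≤ _ := setLIntegral_le_lintegral _ _
  have hup := lintegral_sphereKernel_form_le (ν := ν) ha hR0 hr (d - 1) fun t ht => (hcon t ht).le
  have h := hlow.trans hup
  rw [ENNReal.ofReal_le_ofReal_iff (by positivity)] at h
  have h2 : (R + a) ^ (d - 1) * (c₁ / (4 * L)) * R = c₁ / 4 := by
    rw [hL]
    field_simp
  linarith

end

section

variable {V : Type*} [NormedAddCommGroup V] [InnerProductSpace ℝ V] [FiniteDimensional ℝ V]
  [MeasurableSpace V] [BorelSpace V]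

theorem continuousOn_sphereKernel_form {ν : Measure V} [IsProbabilityMeasure ν] {r : ℝ}
    (hr : 0 < r) :
    ContinuousOn (fun t => ∫ p, sphereKernel r t (p.1 - p.2) ∂(ν.prod ν)) (Ici 0) := by
  refine continuousOn_of_dominated
    (bound := fun _ => (sphereMeasure V).real univ * (r ^ Module.finrank ℝ V)⁻¹)
    (fun t ht => (integrable_sphereKernel_form hr ht).aestronglyMeasurable) (fun t ht => ?_)
    (integrable_const _) (Filter.Eventually.of_forall fun p => ?_)
  · refine Filter.Eventually.of_forall fun p => ?_
    rw [Real.norm_of_nonneg (sphereKernel_nonneg hr _ _)]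
    refine (sphereKernel_le_exp hr ht _).trans
      (mul_le_of_le_one_right (by positivity) (Real.exp_le_one_iff.2 ?_))
    rw [neg_mul, neg_div]
    exact neg_nonpos.2 (by positivity)
  · exact ((continuous_sphereKernel hr).comp
      (by fun_prop : Continuous fun t : ℝ => (t, p.1 - p.2))).continuousOn

/-- The total squared deviation of the four sides of a quadrilateral from length `t`. -/
noncomputable def sideDefect (t : ℝ) (P : (V × V) × (V × V)) : ℝ :=
  (‖P.1.1 - P.2.1‖ - t) ^ 2 + (‖P.1.2 - P.2.1‖ - t) ^ 2 +
    ((‖P.1.1 - P.2.2‖ - t) ^ 2 + (‖P.1.2 - P.2.2‖ - t) ^ 2)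

theorem quadrilateralKernel_sphereKernel_le {r t : ℝ} (hr : 0 < r) (ht : 0 ≤ t) (p q : V × V) :
    quadrilateralKernel (sphereKernel r t) p q ≤
      ((sphereMeasure V).real univ * (r ^ Module.finrank ℝ V)⁻¹) ^ 4 *
        Real.exp (-Real.pi * sideDefect t (p, q) / r ^ 2) := by
  have hK : 0 ≤ (sphereMeasure V).real univ * (r ^ Module.finrank ℝ V)⁻¹ := by positivity
  have h := sphereKernel_le_exp (V := V) hr ht
  have h0 := sphereKernel_nonneg (V := V) hr t
  set K := (sphereMeasure V).real univ * (r ^ Module.finrank ℝ V)⁻¹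
  have hexp : Real.exp (-Real.pi * sideDefect t (p, q) / r ^ 2) =
      Real.exp (-Real.pi * (‖p.1 - q.1‖ - t) ^ 2 / r ^ 2) *
      Real.exp (-Real.pi * (‖p.2 - q.1‖ - t) ^ 2 / r ^ 2) *
      (Real.exp (-Real.pi * (‖p.1 - q.2‖ - t) ^ 2 / r ^ 2) *
      Real.exp (-Real.pi * (‖p.2 - q.2‖ - t) ^ 2 / r ^ 2)) := by
    rw [← Real.exp_add, ← Real.exp_add, ← Real.exp_add]
    congr 1
    simp only [sideDefect]
    ring
  rw [hexp, quadrilateralKernel]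
  calc _ ≤ (K * Real.exp (-Real.pi * (‖p.1 - q.1‖ - t) ^ 2 / r ^ 2)) *
      (K * Real.exp (-Real.pi * (‖p.2 - q.1‖ - t) ^ 2 / r ^ 2)) *
      ((K * Real.exp (-Real.pi * (‖p.1 - q.2‖ - t) ^ 2 / r ^ 2)) *
      (K * Real.exp (-Real.pi * (‖p.2 - q.2‖ - t) ^ 2 / r ^ 2))) := by
        refine mul_le_mul (mul_le_mul (h _) (h _) (h0 _) (by positivity))
          (mul_le_mul (h _) (h _) (h0 _) (by positivity)) (mul_nonneg (h0 _) (h0 _))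
          (by positivity)
    _ = _ := by ring

theorem exists_rhombus_of_separated_quadrilateral {E : Set V} (hE : IsCompact E) {t η c : ℝ}
    (ht : 0 < t) (hη : 0 < η) (hc : 0 < c) {J : ℕ}
    (h : ∀ n, J ≤ n → ∃ p q : V × V, p.1 ∈ E ∧ p.2 ∈ E ∧ q.1 ∈ E ∧ q.2 ∈ E ∧
      η ≤ dist p.1 p.2 ∧ η ≤ dist q.1 q.2 ∧
        c ≤ quadrilateralKernel (sphereKernel ((1 / 2) ^ n) t) p q) :
    ∃ x y z w : V, x ∈ E ∧ y ∈ E ∧ z ∈ E ∧ w ∈ E ∧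
      x ≠ y ∧ x ≠ z ∧ x ≠ w ∧ y ≠ z ∧ y ≠ w ∧ z ≠ w ∧
      dist x y = t ∧ dist y z = t ∧ dist z w = t ∧ dist w x = t := by
  set Q : Set ((V × V) × (V × V)) := ((E ×ˢ E) ×ˢ (E ×ˢ E)) ∩
    {P | η ≤ dist P.1.1 P.1.2 ∧ η ≤ dist P.2.1 P.2.2} with hQ
  have hcl : IsClosed {P : (V × V) × (V × V) | η ≤ dist P.1.1 P.1.2 ∧ η ≤ dist P.2.1 P.2.2} :=
    IsClosed.and (isClosed_le (by fun_prop) (by fun_prop)) (isClosed_le (by fun_prop) (by fun_prop))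
  have hQc : IsCompact Q := ((hE.prod hE).prod (hE.prod hE)).inter_right hcl
  have hmem : ∀ n, J ≤ n → ∃ P ∈ Q,
      c ≤ quadrilateralKernel (sphereKernel ((1 / 2) ^ n) t) P.1 P.2 := by
    intro n hn
    obtain ⟨p, q, h1, h2, h3, h4, h5, h6, h7⟩ := h n hn
    exact ⟨(p, q), ⟨⟨⟨h1, h2⟩, ⟨h3, h4⟩⟩, h5, h6⟩, h7⟩
  have hQne : Q.Nonempty := (hmem J le_rfl).imp fun P hP => hP.1
  have hdc : Continuous (sideDefect (V := V) t) := by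
    unfold sideDefect
    fun_prop
  obtain ⟨P, hPQ, hPmin⟩ := hQc.exists_isMinOn hQne hdc.continuousOn
  have hdef : ∀ P, 0 ≤ sideDefect (V := V) t P := fun P => by
    unfold sideDefect
    positivity
  rcases (hdef P).eq_or_lt with h0 | hpos
  · obtain ⟨⟨⟨h1, h2⟩, ⟨h3, h4⟩⟩, h5, h6⟩ := hPQ
    simp only [sideDefect] at h0
    have key : ∀ u : ℝ, (u - t) ^ 2 ≤ 0 → u = t := fun u hu => by
      have := pow_eq_zero_iff (two_ne_zero) |>.1 (le_antisymm hu (sq_nonneg _))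
      linarith
    have s1 := sq_nonneg (‖P.1.1 - P.2.1‖ - t)
    have s2 := sq_nonneg (‖P.1.2 - P.2.1‖ - t)
    have s3 := sq_nonneg (‖P.1.1 - P.2.2‖ - t)
    have s4 := sq_nonneg (‖P.1.2 - P.2.2‖ - t)
    have e1 : dist P.1.1 P.2.1 = t := by rw [dist_eq_norm]; exact key _ (by linarith)
    have e2 : dist P.1.2 P.2.1 = t := by rw [dist_eq_norm]; exact key _ (by linarith)
    have e3 : dist P.1.1 P.2.2 = t := by rw [dist_eq_norm]; exact key _ (by linarith)
    have e4 : dist P.1.2 P.2.2 = t := by rw [dist_eq_norm]; exact key _ (by linarith)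
    refine ⟨P.1.1, P.2.1, P.1.2, P.2.2, h1, h3, h2, h4, dist_pos.1 (by linarith),
      dist_pos.1 (by linarith), dist_pos.1 (by linarith),
      (dist_pos.1 (by linarith : 0 < dist P.1.2 P.2.1)).symm, dist_pos.1 (by linarith),
      dist_pos.1 (by linarith), e1, ?_, e4, ?_⟩
    · rw [dist_comm]; exact e2
    · rw [dist_comm]; exact e3
  · exfalso
    set ρ := sideDefect t P with hρ
    set d := Module.finrank ℝ V with hd
    have hupow : ∀ n : ℕ, (0 : ℝ) < (1 / 2) ^ n := fun n => by positivity
    have hbound : ∀ n, J ≤ n → c ≤ (sphereMeasure V).real univ ^ 4 *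
        (((2 : ℝ) ^ n) ^ ((4 * d : ℕ) : ℝ) * Real.exp (-(Real.pi * ρ) * 2 ^ n)) := by
      intro n hn
      obtain ⟨P', hP', hcP⟩ := hmem n hn
      refine hcP.trans ((quadrilateralKernel_sphereKernel_le (hupow n) ht.le _ _).trans ?_)
      have hmin : ρ ≤ sideDefect t P' := hPmin hP'
      have h2n : (1 : ℝ) ≤ 2 ^ n := one_le_pow₀ (by norm_num)
      have hinv : ((1 / 2 : ℝ) ^ n)⁻¹ = 2 ^ n := by
        rw [one_div, inv_pow, inv_inv]
      have hK : ((sphereMeasure V).real univ * (((1 / 2) ^ n) ^ d)⁻¹) ^ 4 =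
          (sphereMeasure V).real univ ^ 4 * ((2 : ℝ) ^ n) ^ (4 * d) := by
        rw [← inv_pow, hinv, mul_pow, ← pow_mul, mul_comm d 4]
      rw [Real.rpow_natCast, hK, mul_assoc]
      have hpi := Real.pi_pos
      have h2 : (2 : ℝ) ^ n ≤ (2 ^ n) ^ 2 := by nlinarith
      have hexp : -Real.pi * sideDefect t P' / ((1 / 2) ^ n) ^ 2 ≤ -(Real.pi * ρ) * 2 ^ n := by
        rw [div_eq_mul_inv, ← inv_pow, hinv, neg_mul, neg_mul, neg_mul, neg_le_neg_iff]
        exact mul_le_mul (mul_le_mul_of_nonneg_left hmin hpi.le) h2 (by positivity)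
          (mul_nonneg hpi.le (hdef _))
      gcongr
    have hlim : Filter.Tendsto (fun n : ℕ => (sphereMeasure V).real univ ^ 4 *
        (((2 : ℝ) ^ n) ^ ((4 * d : ℕ) : ℝ) * Real.exp (-(Real.pi * ρ) * 2 ^ n)))
        Filter.atTop (nhds ((sphereMeasure V).real univ ^ 4 * 0)) :=
      ((tendsto_rpow_mul_exp_neg_mul_atTop_nhds_zero _ _ (by positivity)).comp
        (tendsto_pow_atTop_atTop_of_one_lt (by norm_num : (1 : ℝ) < 2))).const_mul _
    have := ge_of_tendsto hlim (Filter.eventually_atTop.2 ⟨J, hbound⟩)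
    linarith

theorem exists_rhombus_of_growth [Nontrivial V] {ν : Measure V} [IsProbabilityMeasure ν]
    {E : Set V} (hEc : IsCompact E) (hE : ν Eᶜ = 0) {A s : ℝ} (hA : 0 < A) (hs0 : 0 < s)
    (hν : ∀ (x : V) r, 0 < r → ν (Metric.closedBall x r) ≤ ENNReal.ofReal (A * r ^ s))
    (hs1 : 1 / 2 < ((Module.finrank ℝ V : ℝ) - 1) / 2 - (Module.finrank ℝ V - s))
    (hs2 : ((Module.finrank ℝ V : ℝ) - 1) / 2 - (Module.finrank ℝ V - s) ≤ 1) :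
    ∃ a b : ℝ, 0 ≤ a ∧ a < b ∧ ∀ t ∈ Ioo a b, ∃ x y z w : V, x ∈ E ∧ y ∈ E ∧ z ∈ E ∧ w ∈ E ∧
      x ≠ y ∧ x ≠ z ∧ x ≠ w ∧ y ≠ z ∧ y ≠ w ∧ z ≠ w ∧
      dist x y = t ∧ dist y z = t ∧ dist z w = t ∧ dist w x = t := by
  obtain ⟨a, ha, haA⟩ : ∃ a : ℝ, 0 < a ∧ A * (2 * a) ^ s ≤ 1 / 2 := by
    refine ⟨(1 / (2 * A)) ^ s⁻¹ / 2, by positivity, ?_⟩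
    rw [mul_div_cancel₀ _ two_ne_zero, Real.rpow_inv_rpow (by positivity) hs0.ne']
    field_simp
    rfl
  have hnear : (ν.prod ν) {p : V × V | dist p.1 p.2 < 2 * a} ≤ ENNReal.ofReal (1 / 2) :=
    (setOf_dist_lt_measure_le (by positivity) hν).trans (ENNReal.ofReal_le_ofReal haA)
  obtain ⟨R, hR0, hR⟩ : ∃ R : ℝ, 0 < R ∧ ∀ x ∈ E, ∀ y ∈ E, ‖x - y‖ ≤ R := by
    obtain ⟨R, hR⟩ := Metric.isBounded_iff.1 hEc.isBounded
    refine ⟨max R 1, by positivity, fun x hx y hy => ?_⟩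
    rw [← dist_eq_norm]
    exact (hR hx hy).trans (le_max_left _ _)
  obtain ⟨c, hc, hform⟩ := exists_form_sphereKernel_ge hE ha hR0 hR hnear
  obtain ⟨C, B, hB, hk⟩ := exists_kernelApproximation_sphereKernel hA ha hν hs2
  set α := ((Module.finrank ℝ V : ℝ) - 1) / 2 - (Module.finrank ℝ V - s)
  set θ : ℝ := (2 : ℝ) ^ (-α) with hθ
  have hθ0 : 0 < θ := by positivity
  have hθ1 : 2 * θ ^ 2 < 1 := by
    rw [hθ, ← Real.rpow_natCast, ← Real.rpow_mul (by norm_num)]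
    nth_rewrite 1 [← Real.rpow_one 2]
    rw [← Real.rpow_add (by norm_num)]
    refine Real.rpow_lt_one_of_one_lt_of_neg (by norm_num) ?_
    push_cast
    linarith
  have hθ1' : θ < 1 := by nlinarith
  obtain ⟨m, hm⟩ : ∃ m : ℕ, B * θ ^ m / (1 - θ) < c / 4 := by
    have hlim : Filter.Tendsto (fun m : ℕ => B * θ ^ m / (1 - θ)) Filter.atTop
        (nhds (B * 0 / (1 - θ))) :=
      ((tendsto_pow_atTop_nhds_zero_of_lt_one hθ0.le hθ1').const_mul B).div_const _
    rw [mul_zero, zero_div] at hlim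
    exact (hlim.eventually_lt_const (by positivity)).exists
  have hr0 : (0 : ℝ) < (1 / 2) ^ m := by positivity
  obtain ⟨t₀, ht₀, hct₀⟩ := hform ((1 / 2) ^ m) hr0 (pow_le_one₀ (by norm_num) (by norm_num))
  have hcont := (continuousOn_sphereKernel_form (ν := ν) hr0).continuousAt
    (Ici_mem_nhds (ha.trans ht₀.1))
  have hev := (hcont.eventually_const_lt (by linarith : c / 2 < _)).and (lt_mem_nhds ht₀.1)
  obtain ⟨ε, hε, hball⟩ := Metric.eventually_nhds_iff.1 hev
  refine ⟨max a (t₀ - ε), t₀, ha.le.trans (le_max_left _ _), max_lt ht₀.1 (by linarith),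
    fun t ht => ?_⟩
  have hta : a < t := (le_max_left _ _).trans_lt ht.1
  have htε : t₀ - ε < t := (le_max_right _ _).trans_lt ht.1
  have hform2 : c / 2 < ∫ p, sphereKernel ((1 / 2) ^ m) t (p.1 - p.2) ∂(ν.prod ν) := by
    refine (hball ?_).1
    rw [Real.dist_eq, abs_lt]
    constructor <;> linarith [ht.2]
  have hN : ∀ n, m ≤ n → c / 4 ≤ ∫ p, sphereKernel ((1 / 2) ^ n) t (p.1 - p.2) ∂(ν.prod ν) := by
    intro n hn
    have := (abs_le.1 ((hk t hta.le).abs_form_sub_le hB.le hθ0.le hθ1' hn)).1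
    linarith
  obtain ⟨η, hη, J, hJ⟩ := (hk t hta.le).exists_separated_quadrilateral hB.le hθ0 hθ1 hA hs0 hν hE
    (by positivity) hN
  exact exists_rhombus_of_separated_quadrilateral hEc (ha.trans hta) hη (by positivity) hJ

end

section

variable {V : Type*} [NormedAddCommGroup V] [InnerProductSpace ℝ V] [FiniteDimensional ℝ V]
  [MeasurableSpace V] [BorelSpace V]

theorem integrable_gaussian_mul_norm_rpow [Nontrivial V] {β : ℝ} (hβ : β < Module.finrank ℝ V) :
    Integrable fun ξ : V => Real.exp (-Real.pi * ‖ξ‖ ^ 2) * ‖ξ‖ ^ (-β) := by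
  refine (integrable_fun_norm_addHaar (volume : Measure V)
    (f := fun t => Real.exp (-Real.pi * t ^ 2) * t ^ (-β))).2 ?_
  have hd : 1 ≤ Module.finrank ℝ V := Module.finrank_pos
  refine (integrableOn_rpow_mul_exp_neg_mul_sq Real.pi_pos
    (s := (Module.finrank ℝ V : ℝ) - 1 - β) (by linarith)).congr_fun (fun t ht => ?_)
    measurableSet_Ioi
  have ht : 0 < t := ht
  simp only [smul_eq_mul]
  rw [sub_eq_add_neg _ β, Real.rpow_add ht, ← Nat.cast_one, ← Nat.cast_sub hd, Real.rpow_natCast]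
  ring

theorem exists_gaussian_energy_le [Nontrivial V] {μ : Measure V} [IsProbabilityMeasure μ]
    {D β : ℝ} (hD : 0 < D) (hβ : β < Module.finrank ℝ V)
    (hdec : ∀ ξ : V, ξ ≠ 0 → (∫ x, Real.cos (2 * Real.pi * ⟪x, ξ⟫) ∂μ) ^ 2 +
      (∫ x, Real.sin (2 * Real.pi * ⟪x, ξ⟫) ∂μ) ^ 2 ≤ D * ‖ξ‖ ^ (-β)) :
    ∃ K : ℝ, 0 ≤ K ∧ ∀ r, 0 < r →
      ∫ p, Real.exp (-Real.pi * ‖p.1 - p.2‖ ^ 2 / r ^ 2) ∂(μ.prod μ) ≤ K * r ^ β := by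
  have hI := integrable_gaussian_mul_norm_rpow (V := V) hβ
  refine ⟨D * ∫ ξ : V, Real.exp (-Real.pi * ‖ξ‖ ^ 2) * ‖ξ‖ ^ (-β),
    mul_nonneg hD.le (integral_nonneg fun ξ => by positivity), fun r hr => ?_⟩
  set d := Module.finrank ℝ V
  have hrd : 0 < (r ^ d)⁻¹ := by positivity
  have h := integral_cosTransform_eq (integrable_gaussian V hr) (ν := μ)
    (integrable_const (1 : ℝ)) (integrable_const (1 : ℝ))
  simp only [cosTransform, integral_gaussian_mul_cos hr, mul_one] at h
  rw [integral_const_mul] at h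
  have hscale : ∀ ξ : V, Real.exp (-Real.pi * r ^ 2 * ‖ξ‖ ^ 2) * (D * ‖ξ‖ ^ (-β)) =
      D * r ^ β * (Real.exp (-Real.pi * ‖r • ξ‖ ^ 2) * ‖r • ξ‖ ^ (-β)) := by
    intro ξ
    rw [norm_smul, Real.norm_of_nonneg hr.le, Real.mul_rpow hr.le (norm_nonneg _), mul_pow,
      Real.rpow_neg hr.le]
    have : r ^ β ≠ 0 := by positivity
    field_simp
  have hint : Integrable fun ξ : V =>
      Real.exp (-Real.pi * r ^ 2 * ‖ξ‖ ^ 2) * (D * ‖ξ‖ ^ (-β)) := by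
    simp only [hscale]
    exact (hI.comp_smul hr.ne').const_mul _
  have hle : (r ^ d)⁻¹ * ∫ p, Real.exp (-Real.pi * ‖p.1 - p.2‖ ^ 2 / r ^ 2) ∂(μ.prod μ) ≤
      ∫ ξ : V, Real.exp (-Real.pi * r ^ 2 * ‖ξ‖ ^ 2) * (D * ‖ξ‖ ^ (-β)) := by
    rw [h]
    refine integral_mono_of_nonneg (Filter.Eventually.of_forall fun ξ => ?_) hint ?_
    · exact mul_nonneg (Real.exp_nonneg _) (add_nonneg (mul_self_nonneg _) (mul_self_nonneg _))
    · filter_upwards [compl_mem_ae_iff.2 (measure_singleton (0 : V))] with ξ hξ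
      have := hdec ξ hξ
      rw [sq, sq] at this
      exact mul_le_mul_of_nonneg_left this (Real.exp_nonneg _)
  simp only [hscale] at hle
  rw [integral_const_mul, Measure.integral_comp_smul (volume : Measure V)
    (fun ξ => Real.exp (-Real.pi * ‖ξ‖ ^ 2) * ‖ξ‖ ^ (-β)), smul_eq_mul, abs_of_pos hrd] at hle
  refine le_of_mul_le_mul_left (hle.trans (le_of_eq ?_)) hrd
  ring

end

section

theorem exists_growth_of_dyadic {X : Type*} [PseudoMetricSpace X] [MeasurableSpace X]
    {ν : Measure X} [IsProbabilityMeasure ν] {F : Set X} (hF : ν Fᶜ = 0) {D s : ℝ} (hs : 0 ≤ s)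
    (h : ∀ x ∈ F, ∀ n : ℕ, ν (Metric.closedBall x ((1 / 2) ^ n)) ≤
      ENNReal.ofReal (D * ((1 / 2) ^ n) ^ s)) :
    ∃ A : ℝ, 0 < A ∧ ∀ x r, 0 < r → ν (Metric.closedBall x r) ≤ ENNReal.ofReal (A * r ^ s) := by
  set A : ℝ := max D 1 * 4 ^ s with hA
  have hD : 0 < max D 1 := by positivity
  have h4 : (1 : ℝ) ≤ 4 ^ s := Real.one_le_rpow (by norm_num) hs
  refine ⟨A, by positivity, fun x r hr => ?_⟩
  rcases le_or_gt (1 / 2) r with h1 | h1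
  · refine prob_le_one.trans ?_
    rw [ENNReal.one_le_ofReal, hA, mul_assoc, ← Real.mul_rpow (by norm_num) hr.le]
    have : (1 : ℝ) ≤ (4 * r) ^ s := Real.one_le_rpow (by linarith) hs
    nlinarith [le_max_right D 1]
  · by_cases hne : (Metric.closedBall x r ∩ F).Nonempty
    · obtain ⟨y, hy, hyF⟩ := hne
      obtain ⟨n, hn1, hn2⟩ := exists_nat_pow_near_of_lt_one (x := 2 * r) (y := 1 / 2)
        (by positivity) (by linarith) (by norm_num) (by norm_num)
      have hsub : Metric.closedBall x r ⊆ Metric.closedBall y ((1 / 2) ^ n) := by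
        intro z hz
        rw [Metric.mem_closedBall] at hz hy ⊢
        have := dist_triangle_right z y x
        linarith
      refine (measure_mono hsub).trans ((h y hyF n).trans (ENNReal.ofReal_le_ofReal ?_))
      rw [hA, mul_assoc, ← Real.mul_rpow (by norm_num) hr.le]
      have hle : ((1 / 2 : ℝ) ^ n) ^ s ≤ (4 * r) ^ s := by
        refine Real.rpow_le_rpow (by positivity) ?_ hs
        rw [pow_succ] at hn1
        linarith
      exact mul_le_mul (le_max_left _ _) hle (by positivity) hD.le
    · have : ν (Metric.closedBall x r) = 0 :=
        measure_mono_null (fun z hz hzF => hne ⟨z, hz, hzF⟩) hF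
      rw [this]
      exact zero_le

theorem exists_growth_of_lintegral_ne_top {X : Type*} [PseudoMetricSpace X] [MeasurableSpace X]
    {μ : Measure X} [IsProbabilityMeasure μ] {E : Set X} (hE : μ Eᶜ = 0) {s : ℝ}
    (hs : 0 ≤ s) {G : X → ℝ≥0∞} (hG : Measurable G) (hGi : ∫⁻ x, G x ∂μ ≠ ∞)
    (h : ∀ x, ∀ n : ℕ, μ (Metric.closedBall x ((1 / 2) ^ n)) ≤
      G x * ENNReal.ofReal (((1 / 2) ^ n) ^ s)) :
    ∃ ν : Measure X, IsProbabilityMeasure ν ∧ ν Eᶜ = 0 ∧ ∃ A : ℝ, 0 < A ∧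
      ∀ x r, 0 < r → ν (Metric.closedBall x r) ≤ ENNReal.ofReal (A * r ^ s) := by
  obtain ⟨M, hM⟩ : ∃ M : ℕ, μ {x | G x ≤ M} ≠ 0 := by
    by_contra hcon
    push Not at hcon
    have h1 : μ (⋃ M : ℕ, {x | G x ≤ M}) = 0 := measure_iUnion_null hcon
    have h2 : ∀ᵐ x ∂μ, x ∈ ⋃ M : ℕ, {x | G x ≤ M} := by
      filter_upwards [ae_lt_top hG hGi] with x hx
      obtain ⟨M, hM⟩ := ENNReal.exists_nat_gt hx.ne
      exact mem_iUnion.2 ⟨M, hM.le⟩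
    have h3 := prob_compl_eq_zero_iff₀
      (MeasurableSet.iUnion fun M : ℕ => measurableSet_le hG measurable_const).nullMeasurableSet
      |>.1 h2
    exact zero_ne_one (h1.symm.trans h3)
  set F := {x | G x ≤ M} with hF
  have hFm : MeasurableSet F := measurableSet_le hG measurable_const
  have hprob : IsProbabilityMeasure (ProbabilityTheory.cond μ F) :=
    ProbabilityTheory.cond_isProbabilityMeasure hM
  have hle : ∀ S, ProbabilityTheory.cond μ F S ≤ (μ F)⁻¹ * μ S := fun S => by
    rw [ProbabilityTheory.cond_apply hFm]
    gcongr
    exact inter_subset_right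
  refine ⟨ProbabilityTheory.cond μ F, hprob,
    le_antisymm ((hle _).trans (by rw [hE, mul_zero])) zero_le,
    exists_growth_of_dyadic (F := F) ?_ (D := ((μ F)⁻¹ * M).toReal) hs fun x hx n => ?_⟩
  · rw [ProbabilityTheory.cond_apply hFm, inter_compl_self, measure_empty, mul_zero]
  · have htop : (μ F)⁻¹ * M ≠ ∞ :=
      ENNReal.mul_ne_top (ENNReal.inv_ne_top.2 hM) (ENNReal.natCast_ne_top M)
    rw [ENNReal.ofReal_mul ENNReal.toReal_nonneg, ENNReal.ofReal_toReal htop, mul_assoc]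
    refine (hle _).trans ?_
    gcongr
    exact (h x n).trans (by gcongr; exact hx)

end

section

variable {V : Type*} [NormedAddCommGroup V] [InnerProductSpace ℝ V] [FiniteDimensional ℝ V]
  [MeasurableSpace V] [BorelSpace V]

theorem lintegral_gaussian_energy {μ : Measure V} [IsProbabilityMeasure μ] (r : ℝ) :
    ∫⁻ x, (∫⁻ y, ENNReal.ofReal (Real.exp (-Real.pi * ‖x - y‖ ^ 2 / r ^ 2)) ∂μ) ∂μ =
      ENNReal.ofReal (∫ p, Real.exp (-Real.pi * ‖p.1 - p.2‖ ^ 2 / r ^ 2) ∂(μ.prod μ)) := by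
  have hc : Continuous fun p : V × V => Real.exp (-Real.pi * ‖p.1 - p.2‖ ^ 2 / r ^ 2) := by
    fun_prop
  rw [ofReal_integral_eq_lintegral_ofReal
    (integrable_of_continuous_of_abs_le (c := 1) hc.measurable fun p => ?_)
    (Filter.Eventually.of_forall fun p => Real.exp_nonneg _),
    lintegral_prod _ hc.measurable.ennreal_ofReal.aemeasurable]
  rw [abs_of_pos (Real.exp_pos _), Real.exp_le_one_iff, neg_mul, neg_div]
  exact neg_nonpos.2 (by positivity)

theorem measure_closedBall_le_lintegral_gaussian {W : Type*} [NormedAddCommGroup W]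
    [MeasurableSpace W] [BorelSpace W] {μ : Measure W} {r : ℝ} (hr : 0 < r) (x : W) :
    μ (Metric.closedBall x r) ≤ ENNReal.ofReal (Real.exp Real.pi) *
      ∫⁻ y, ENNReal.ofReal (Real.exp (-Real.pi * ‖x - y‖ ^ 2 / r ^ 2)) ∂μ := by
  have hc : Continuous fun y : W => Real.exp (-Real.pi * ‖x - y‖ ^ 2 / r ^ 2) := by fun_prop
  rw [← lintegral_const_mul _ hc.measurable.ennreal_ofReal]
  calc μ (Metric.closedBall x r) = ∫⁻ _ in Metric.closedBall x r, 1 ∂μ := by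
        rw [setLIntegral_const, one_mul]
    _ ≤ ∫⁻ y in Metric.closedBall x r, ENNReal.ofReal (Real.exp Real.pi) *
        ENNReal.ofReal (Real.exp (-Real.pi * ‖x - y‖ ^ 2 / r ^ 2)) ∂μ := by
        refine setLIntegral_mono' measurableSet_closedBall fun y hy => ?_
        rw [← ENNReal.ofReal_mul (Real.exp_nonneg _), ENNReal.one_le_ofReal, ← Real.exp_add,
          Real.one_le_exp_iff, neg_mul, neg_div, ← sub_eq_add_neg, sub_nonneg,
          div_le_iff₀ (by positivity)]
        rw [Metric.mem_closedBall, dist_comm, dist_eq_norm] at hy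
        exact mul_le_mul_of_nonneg_left (pow_le_pow_left₀ (norm_nonneg _) hy 2) Real.pi_pos.le
    _ ≤ _ := setLIntegral_le_lintegral _ _

theorem exists_growth_of_gaussian_energy_le {μ : Measure V} [IsProbabilityMeasure μ] {E : Set V}
    (hE : μ Eᶜ = 0) {K β s : ℝ} (hs : 0 ≤ s) (hsβ : s < β) (hK : 0 ≤ K)
    (h : ∀ r, 0 < r →
      ∫ p, Real.exp (-Real.pi * ‖p.1 - p.2‖ ^ 2 / r ^ 2) ∂(μ.prod μ) ≤ K * r ^ β) :
    ∃ ν : Measure V, IsProbabilityMeasure ν ∧ ν Eᶜ = 0 ∧ ∃ A : ℝ, 0 < A ∧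
      ∀ x r, 0 < r → ν (Metric.closedBall x r) ≤ ENNReal.ofReal (A * r ^ s) := by
  set ρ : ℕ → ℝ := fun n => (1 / 2) ^ n with hρ
  have hρ0 : ∀ n, 0 < ρ n := fun n => by positivity
  set g : ℕ → V → ℝ≥0∞ := fun n x => ENNReal.ofReal (ρ n ^ (-s)) *
    (ENNReal.ofReal (Real.exp Real.pi) *
      ∫⁻ y, ENNReal.ofReal (Real.exp (-Real.pi * ‖x - y‖ ^ 2 / ρ n ^ 2)) ∂μ) with hg
  have hm : ∀ n, Measurable fun x : V =>
      ∫⁻ y, ENNReal.ofReal (Real.exp (-Real.pi * ‖x - y‖ ^ 2 / ρ n ^ 2)) ∂μ := fun n => by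
    have hc : Continuous fun p : V × V =>
      Real.exp (-Real.pi * ‖p.1 - p.2‖ ^ 2 / ρ n ^ 2) := by fun_prop
    exact hc.measurable.ennreal_ofReal.lintegral_prod_right'
  have hgm : ∀ n, Measurable (g n) := fun n => ((hm n).const_mul _).const_mul _
  refine exists_growth_of_lintegral_ne_top hE hs (G := fun x => ∑' n, g n x)
    (Measurable.tsum hgm) ?_ fun x n => ?_
  · rw [lintegral_tsum fun n => (hgm n).aemeasurable]
    have hterm : ∀ n, ∫⁻ x, g n x ∂μ ≤
        ENNReal.ofReal (Real.exp Real.pi * K * ((1 / 2 : ℝ) ^ (β - s)) ^ n) := by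
      intro n
      simp only [hg]
      rw [lintegral_const_mul _ ((hm n).const_mul _), lintegral_const_mul _ (hm n),
        lintegral_gaussian_energy, ← ENNReal.ofReal_mul (Real.exp_nonneg _),
        ← ENNReal.ofReal_mul (by have := hρ0 n; positivity)]
      refine ENNReal.ofReal_le_ofReal ?_
      have hp : ((1 / 2 : ℝ) ^ (β - s)) ^ n = ρ n ^ (-s) * ρ n ^ β := by
        rw [← Real.rpow_add (hρ0 n)]
        simp only [hρ]
        rw [← Real.rpow_natCast, ← Real.rpow_natCast,
          ← Real.rpow_mul (by norm_num), ← Real.rpow_mul (by norm_num)]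
        congr 1
        ring
      rw [hp]
      calc _ ≤ ρ n ^ (-s) * (Real.exp Real.pi * (K * ρ n ^ β)) := by
            have := hρ0 n
            gcongr
            exact h _ this
        _ = _ := by ring
    refine ne_top_of_le_ne_top ?_ (ENNReal.tsum_le_tsum hterm)
    have hq : (1 / 2 : ℝ) ^ (β - s) < 1 :=
      Real.rpow_lt_one (by norm_num) (by norm_num) (by linarith)
    rw [← ENNReal.ofReal_tsum_of_nonneg (fun n => by positivity)
      ((summable_geometric_of_lt_one (by positivity) hq).mul_left _)]
    exact ENNReal.ofReal_ne_top
  · have h1 : ENNReal.ofReal (ρ n ^ (-s)) * ENNReal.ofReal (ρ n ^ s) = 1 := by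
      rw [← ENNReal.ofReal_mul (by have := hρ0 n; positivity), ← Real.rpow_add (hρ0 n),
        neg_add_cancel, Real.rpow_zero, ENNReal.ofReal_one]
    calc _ ≤ ENNReal.ofReal (Real.exp Real.pi) *
          ∫⁻ y, ENNReal.ofReal (Real.exp (-Real.pi * ‖x - y‖ ^ 2 / ρ n ^ 2)) ∂μ :=
          measure_closedBall_le_lintegral_gaussian (hρ0 n) x
      _ = g n x * ENNReal.ofReal (ρ n ^ s) := by
          simp only [hg]
          rw [mul_right_comm, h1, one_mul]
      _ ≤ _ := by
          gcongr
          exact ENNReal.le_tsum n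

end

theorem exists_growth_of_lt_exponent {X : Type*} [PseudoMetricSpace X] [MeasurableSpace X]
    {ν : Measure X} [IsProbabilityMeasure ν] {A s u : ℝ} (hus : u ≤ s) (hu : 0 ≤ u)
    (h : ∀ x r, 0 < r → ν (Metric.closedBall x r) ≤ ENNReal.ofReal (A * r ^ s)) :
    ∃ B : ℝ, 0 < B ∧ ∀ x r, 0 < r → ν (Metric.closedBall x r) ≤ ENNReal.ofReal (B * r ^ u) := by
  refine ⟨max A 1, by positivity, fun x r hr => ?_⟩
  rcases le_or_gt r 1 with h1 | h1
  · refine (h x r hr).trans (ENNReal.ofReal_le_ofReal ?_)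
    exact mul_le_mul (le_max_left _ _) (Real.rpow_le_rpow_of_exponent_ge hr h1 hus)
      (by positivity) (by positivity)
  · refine prob_le_one.trans ?_
    rw [ENNReal.one_le_ofReal]
    have : (1 : ℝ) ≤ r ^ u := Real.one_le_rpow h1.le hu
    nlinarith [le_max_right A 1]

theorem exists_rhombus_of_large_growth {V : Type*} [NormedAddCommGroup V] [InnerProductSpace ℝ V]
    [FiniteDimensional ℝ V] [MeasurableSpace V] [BorelSpace V] [Nontrivial V] {ν : Measure V}
    [IsProbabilityMeasure ν] {E : Set V} (hEc : IsCompact E) (hE : ν Eᶜ = 0) {A s : ℝ}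
    (hs : ((Module.finrank ℝ V : ℝ) + 2) / 2 < s)
    (hν : ∀ (x : V) r, 0 < r → ν (Metric.closedBall x r) ≤ ENNReal.ofReal (A * r ^ s)) :
    ∃ a b : ℝ, 0 ≤ a ∧ a < b ∧ ∀ t ∈ Ioo a b, ∃ x y z w : V, x ∈ E ∧ y ∈ E ∧ z ∈ E ∧ w ∈ E ∧
      x ≠ y ∧ x ≠ z ∧ x ≠ w ∧ y ≠ z ∧ y ≠ w ∧ z ≠ w ∧
      dist x y = t ∧ dist y z = t ∧ dist z w = t ∧ dist w x = t := by
  set u := min s (((Module.finrank ℝ V : ℝ) + 3) / 2) with hu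
  have hu1 : ((Module.finrank ℝ V : ℝ) + 2) / 2 < u := lt_min hs (by linarith)
  have hu2 : u ≤ ((Module.finrank ℝ V : ℝ) + 3) / 2 := min_le_right _ _
  have hd : (0 : ℝ) ≤ Module.finrank ℝ V := Nat.cast_nonneg _
  have hu0 : 0 < u := by linarith
  obtain ⟨B, hB, hνB⟩ := exists_growth_of_lt_exponent (min_le_left _ _) hu0.le hν
  exact exists_rhombus_of_growth hEc hE hB hu0 hνB (by linarith) (by linarith)

theorem sq_norm_fourierMeasure {d : ℕ} (μ : Measure (EuclideanSpace ℝ (Fin d)))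
    [IsFiniteMeasure μ] (ξ : EuclideanSpace ℝ (Fin d)) :
    ‖fourierMeasure μ ξ‖ ^ 2 = (∫ x, Real.cos (2 * Real.pi * ⟪x, ξ⟫) ∂μ) ^ 2 +
      (∫ x, Real.sin (2 * Real.pi * ⟪x, ξ⟫) ∂μ) ^ 2 := by
  have hc : Integrable (fun x => Real.cos (2 * Real.pi * ⟪x, ξ⟫)) μ :=
    integrable_of_continuous_of_abs_le (c := 1) (Continuous.measurable (by fun_prop))
      fun x => Real.abs_cos_le_one _
  have hs : Integrable (fun x => Real.sin (2 * Real.pi * ⟪x, ξ⟫)) μ :=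
    integrable_of_continuous_of_abs_le (c := 1) (Continuous.measurable (by fun_prop))
      fun x => Real.abs_sin_le_one _
  have hF : fourierMeasure μ ξ = ((∫ x, Real.cos (2 * Real.pi * ⟪x, ξ⟫) ∂μ : ℝ) : ℂ) +
      ((-∫ x, Real.sin (2 * Real.pi * ⟪x, ξ⟫) ∂μ : ℝ) : ℂ) * Complex.I := by
    rw [← integral_neg, ← integral_complex_ofReal, ← integral_complex_ofReal, ← integral_mul_const,
      ← integral_add hc.ofReal (hs.neg.ofReal.mul_const _), fourierMeasure]
    refine integral_congr_ae (Filter.Eventually.of_forall fun x => ?_)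
    simp only [Complex.exp_mul_I]
    push_cast
    rw [Complex.cos_neg, Complex.sin_neg]
  rw [hF, Complex.sq_norm, Complex.normSq_add_mul_I, neg_sq]

theorem sq_norm_fourierMeasure_le {d : ℕ} {μ : Measure (EuclideanSpace ℝ (Fin d))}
    [IsProbabilityMeasure μ] {C δ β : ℝ} (hC : 0 < C) (hβ0 : 0 ≤ β) (hβ : β ≤ 2 + δ)
    {ξ : EuclideanSpace ℝ (Fin d)} (hξ : ξ ≠ 0)
    (h : ‖fourierMeasure μ ξ‖ ≤ C * ‖ξ‖ ^ (-(1 + δ / 2))) :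
    ‖fourierMeasure μ ξ‖ ^ 2 ≤ max (C ^ 2) 1 * ‖ξ‖ ^ (-β) := by
  have hn : 0 < ‖ξ‖ := norm_pos_iff.2 hξ
  rcases le_or_gt 1 ‖ξ‖ with h1 | h1
  · calc ‖fourierMeasure μ ξ‖ ^ 2 ≤ (C * ‖ξ‖ ^ (-(1 + δ / 2))) ^ 2 :=
          pow_le_pow_left₀ (norm_nonneg _) h 2
      _ = C ^ 2 * ‖ξ‖ ^ (-(2 + δ)) := by
          rw [mul_pow, ← Real.rpow_natCast (_ ^ _), ← Real.rpow_mul hn.le]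
          congr 2
          push_cast
          ring
      _ ≤ _ := mul_le_mul (le_max_left _ _)
          (Real.rpow_le_rpow_of_exponent_le h1 (by linarith)) (by positivity) (by positivity)
  · have hF : ‖fourierMeasure μ ξ‖ ≤ 1 := by
      rw [fourierMeasure]
      refine (norm_integral_le_of_norm_le_const (C := 1)
        (Filter.Eventually.of_forall fun x => ?_)).trans (by simp)
      have := Complex.norm_exp_ofReal_mul_I (-(2 * Real.pi * ⟪x, ξ⟫))
      push_cast at this
      exact this.le
    have h2 : 1 ≤ ‖ξ‖ ^ (-β) :=
      Real.one_le_rpow_of_pos_of_le_one_of_nonpos hn h1.le (by linarith)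
    have h3 : ‖fourierMeasure μ ξ‖ ^ 2 ≤ 1 := pow_le_one₀ (norm_nonneg _) hF
    nlinarith [le_max_right (C ^ 2) 1]

theorem exists_large_growth {d : ℕ} (hd : 3 ≤ d) {δ : ℝ}
    {E : Set (EuclideanSpace ℝ (Fin d))} (hE : IsCompact E)
    (hdim : ENNReal.ofReal ((d : ℝ) - δ) < dimH E)
    {μ : Measure (EuclideanSpace ℝ (Fin d))} [IsProbabilityMeasure μ]
    (hsupp : μ Eᶜ = 0) {C : ℝ} (hC : 0 < C)
    (hdecay : ∀ ξ : EuclideanSpace ℝ (Fin d), ξ ≠ 0 →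
      ‖fourierMeasure μ ξ‖ ≤ C * ‖ξ‖ ^ (-(1 + δ / 2))) :
    ∃ ν : Measure (EuclideanSpace ℝ (Fin d)), IsProbabilityMeasure ν ∧ ν Eᶜ = 0 ∧
      ∃ A s : ℝ, ((d : ℝ) + 2) / 2 < s ∧
        ∀ x r, 0 < r → ν (Metric.closedBall x r) ≤ ENNReal.ofReal (A * r ^ s) := by
  have hd3 : (3 : ℝ) ≤ d := by exact_mod_cast hd
  rcases le_or_gt δ (((d : ℝ) - 2) / 2) with hδ | hδ
  · obtain ⟨s, hs1, hs2⟩ := ENNReal.lt_iff_exists_nnreal_btwn.1 hdim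
    have hs : (d : ℝ) - δ < s := by
      rw [← ENNReal.ofReal_coe_nnreal, ENNReal.ofReal_lt_ofReal_iff_of_nonneg (by linarith)] at hs1
      exact hs1
    have hH : Measure.hausdorffMeasure (s : ℝ) E ≠ 0 := by
      rw [hausdorffMeasure_of_lt_dimH hs2]
      exact ENNReal.top_ne_zero
    obtain ⟨ν, h1, h2, A, -, h3⟩ :=
      exists_growth_of_hausdorffMeasure_ne_zero hE (by linarith) hH
    exact ⟨ν, h1, h2, A, s, by linarith, h3⟩
  · have : Nontrivial (EuclideanSpace ℝ (Fin d)) :=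
      Module.nontrivial_of_finrank_pos (R := ℝ) (by rw [finrank_euclideanSpace_fin]; omega)
    obtain ⟨β, hβ1, hβ2⟩ : ∃ β, ((d : ℝ) + 2) / 2 < β ∧ β < min (d : ℝ) (2 + δ) :=
      exists_between (lt_min (by linarith) (by linarith))
    obtain ⟨s, hs1, hs2⟩ := exists_between hβ1
    obtain ⟨K, hK, hKr⟩ := exists_gaussian_energy_le (μ := μ) (D := max (C ^ 2) 1) (β := β)
      (by positivity)
      (by rw [finrank_euclideanSpace_fin]; exact hβ2.trans_le (min_le_left _ _)) fun ξ hξ => by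
        rw [← sq_norm_fourierMeasure]
        exact sq_norm_fourierMeasure_le hC (by linarith) (hβ2.le.trans (min_le_right _ _)) hξ
          (hdecay ξ hξ)
    obtain ⟨ν, h1, h2, A, -, h3⟩ :=
      exists_growth_of_gaussian_energy_le hsupp (by linarith) hs2 hK hKr
    exact ⟨ν, h1, h2, A, s, hs1, h3⟩

/-- Let `d ≥ 3` and `δ > 0`. Suppose `E ⊆ ℝ^d` is compact with
`dim_H(E) > d - δ`, and that there is a Borel probability measure `μ` supported on `E`
whose Fourier transform satisfies `|μ̂(ξ)| ≤ C |ξ|^{-1-δ/2}` for all `ξ ≠ 0`. Then there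
is a non-empty open interval `I ⊆ (0,∞)` such that for every `t ∈ I`, `E` contains four
pairwise distinct points forming a rhombus of side length `t`. -/
theorem rhombi_in_sets_with_fourier_decay
    (d : ℕ) (hd : 3 ≤ d) (δ : ℝ) (hδ : 0 < δ)
    (E : Set (EuclideanSpace ℝ (Fin d))) (hE : IsCompact E)
    (hdim : ENNReal.ofReal ((d : ℝ) - δ) < dimH E)
    (μ : Measure (EuclideanSpace ℝ (Fin d))) [IsProbabilityMeasure μ]
    (hsupp : μ Eᶜ = 0) (C : ℝ) (hC : 0 < C)
    (hdecay : ∀ ξ : EuclideanSpace ℝ (Fin d), ξ ≠ 0 →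
      ‖fourierMeasure μ ξ‖ ≤ C * ‖ξ‖ ^ (-(1 + δ / 2))) :
    ∃ a b : ℝ, 0 ≤ a ∧ a < b ∧ ∀ t ∈ Set.Ioo a b,
      ∃ x y z w : EuclideanSpace ℝ (Fin d),
        x ∈ E ∧ y ∈ E ∧ z ∈ E ∧ w ∈ E ∧
        x ≠ y ∧ x ≠ z ∧ x ≠ w ∧ y ≠ z ∧ y ≠ w ∧ z ≠ w ∧
        dist x y = t ∧ dist y z = t ∧ dist z w = t ∧ dist w x = t := by
  have : Nontrivial (EuclideanSpace ℝ (Fin d)) :=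
    Module.nontrivial_of_finrank_pos (R := ℝ) (by rw [finrank_euclideanSpace_fin]; omega)
  obtain ⟨ν, hν, hνE, A, s, hs, hgrowth⟩ := exists_large_growth hd hE hdim hsupp hC hdecay
  exact exists_rhombus_of_large_growth hE hνE (by rwa [finrank_euclideanSpace_fin]) hgrowth
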